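/- Fix a k-element set H of distinct nonnegative integers and integers l_1, l_2 ≥ 0. There is a constant C = C(k, l_1, l_2) such that if R = R(N) satisfies R ≤ N^{1/2}(log N)^{−C} and R → ∞ as N → ∞, then (1/N) Σ_{N ≤ n < 2N} Λ_R(n; H, l_1) Λ_R(n; H, l_2) = (𝔖(H) + o(1)) · binom(l_1+l_2, l_1) · (log R)^{k+l_1+l_2}/(k+l_1+l_2)! as N → ∞. -/

import Mathlib

open Filter

/-- The Liouville function `λ(n) = (-1)^Ω(n)`. -/
noncomputable def lio (n : ℕ) : ℝ := (-1) ^ n.primeFactorsList.length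

/-- `θ(n) = log n` if `n` is prime, `0` otherwise. -/
noncomputable def theta (n : ℕ) : ℝ := if n.Prime then Real.log n else 0

/-- `max_a |∑_{n ≤ N, n ≡ a (q)} f(n)|`. -/
noncomputable def maxAbs (f : ℕ → ℝ) (q N : ℕ) : ℝ :=
  ⨆ a : ℕ, |∑ n ∈ Finset.Icc 1 N, if n % q = a % q then f n else 0|

/-- `f` has (zero-mean) distribution level `ϑ`. -/
def HasLevel (f : ℕ → ℝ) (ϑ : ℝ) : Prop :=
  ∀ ε > (0 : ℝ), ∀ A > (0 : ℝ), ∃ C > (0 : ℝ), ∀ N : ℕ, 2 ≤ N →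
    ∑ q ∈ Finset.Icc 1 ⌊(N : ℝ) ^ (ϑ - ε)⌋₊, maxAbs f q N ≤ C * N / Real.log N ^ A

/-- `max_{(a,q)=1} |∑_{p ≤ N, p ≡ a (q)} log p - N/φ(q)|`. -/
noncomputable def primeMaxAbs (q N : ℕ) : ℝ :=
  ⨆ a : ℕ, if Nat.Coprime a q then
    |(∑ p ∈ Finset.Icc 1 N, if p.Prime ∧ p % q = a % q then Real.log p else 0)
      - N / q.totient|
  else 0

/-- The primes have distribution level `ϑ` (Bombieri–Vinogradov/Elliott–Halberstam type). -/
def PrimesLevel (ϑ : ℝ) : Prop :=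
  ∀ ε > (0 : ℝ), ∀ A > (0 : ℝ), ∃ C > (0 : ℝ), ∀ N : ℕ, 2 ≤ N →
    ∑ q ∈ Finset.Icc 1 ⌊(N : ℝ) ^ (ϑ - ε)⌋₊, primeMaxAbs q N ≤ C * N / Real.log N ^ A

/-- Hypothesis D(ϑ, h): the primes and the four auxiliary Liouville-type sequences
all have distribution level `ϑ`. -/
def HypD (ϑ : ℝ) (h : ℕ) : Prop :=
  PrimesLevel ϑ ∧
  HasLevel lio ϑ ∧
  HasLevel (fun n => lio n * lio (n + h)) ϑ ∧
  HasLevel (fun n => theta n * lio (n + h)) ϑ ∧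
  HasLevel (fun n => if h < n then theta n * lio (n - h) else 0) ϑ

/-- The Goldston–Pintz–Yıldırım weight
`Λ_R(n; H, l) = (1/(k+l)!) ∑_{d ≤ R, d ∣ P_H(n)} μ(d) (log (R/d))^{k+l}`. -/
noncomputable def LambdaR (R : ℝ) (n : ℕ) (H : Finset ℕ) (l : ℕ) : ℝ :=
  (1 / (H.card + l).factorial) *
    ∑ d ∈ Finset.Icc 1 ⌊R⌋₊,
      if d ∣ ∏ hi ∈ H, (n + hi) then
        (ArithmeticFunction.moebius d : ℝ) * Real.log (R / d) ^ (H.card + l)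
      else 0

/-- `ν_m(H)`: the number of residue classes `n` mod `m` with `m ∣ P_H(n)`. -/
def nu (H : Finset ℕ) (m : ℕ) : ℕ :=
  ((Finset.range m).filter fun n => m ∣ ∏ hi ∈ H, (n + hi)).card

/-- The singular series `𝔖(H) = ∏_p (1 - ν_p(H)/p)(1 - 1/p)^{-k}`. -/
noncomputable def singSeries (H : Finset ℕ) : ℝ :=
  ∏' p : Nat.Primes, (1 - (nu H p : ℝ) / (p : ℕ)) * (1 - 1 / ((p : ℕ) : ℝ)) ^ (-(H.card : ℤ))

/-- `𝔖₀(h) = ∏_{p ∣ h} (1-1/p)⁻¹ ∏_{p ∤ h} (1 - 1/(p-1)²)`. -/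
noncomputable def singSeries0 (h : ℕ) : ℝ :=
  ∏' p : Nat.Primes, if (p : ℕ) ∣ h then (1 - 1 / ((p : ℕ) : ℝ))⁻¹
    else 1 - 1 / (((p : ℕ) : ℝ) - 1) ^ 2

/-- The `n`-th term of the series `∑ₙ (n⁻ˢ - ∫ₙⁿ⁺¹ x⁻ˢ dx)` continuing `ζ(s) - 1/(s-1)`. -/
noncomputable def zetaTerm (n : ℕ) (s : ℂ) : ℂ :=
  (n + 1 : ℂ) ^ (-s) - ((n + 2 : ℂ) ^ (1 - s) - (n + 1 : ℂ) ^ (1 - s)) / (1 - s)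

lemma norm_cpow_neg_sub_le {a x : ℝ} (ha : 0 < a) (hx : a ≤ x) (hx' : x ≤ a + 1) {s : ℂ}
    (hs : 0 ≤ s.re) :
    ‖(a : ℂ) ^ (-s) - (x : ℂ) ^ (-s)‖ ≤ ‖s‖ * a ^ (-s.re - 1) := by
  have key := (convex_Icc a x).norm_image_sub_le_of_norm_hasDerivWithin_le
    (f := fun y : ℝ => (y : ℂ) ^ (-s)) (f' := fun y : ℝ => -s * (y : ℂ) ^ (-s - 1))
    (C := ‖s‖ * a ^ (-s.re - 1)) (x := x) (y := a) ?_ ?_ (Set.right_mem_Icc.2 hx)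
      (Set.left_mem_Icc.2 hx)
  · refine key.trans ?_
    have : ‖a - x‖ ≤ 1 := by rw [Real.norm_eq_abs, abs_le]; constructor <;> linarith
    exact mul_le_of_le_one_right (by positivity) this
  · intro y hy
    have hy0 : 0 < y := ha.trans_le hy.1
    by_cases h0 : s = 0
    · subst h0; simpa using (hasDerivWithinAt_const (y : ℝ) (Set.Icc a x) (1 : ℂ))
    · simpa using (hasDerivAt_ofReal_cpow_const hy0.ne' (neg_ne_zero.2 h0)).hasDerivWithinAt
  · intro y hy
    have hy0 : 0 < y := ha.trans_le hy.1
    rw [norm_mul, norm_neg, Complex.norm_cpow_eq_rpow_re_of_pos hy0]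
    gcongr
    simp only [Complex.sub_re, Complex.neg_re, Complex.one_re]
    exact Real.rpow_le_rpow_of_nonpos ha hy.1 (by linarith)

lemma norm_zetaTerm_le_of_bound (n : ℕ) {s : ℂ} (hs1 : s ≠ 1) {C : ℝ}
    (hC : ∀ x : ℝ, (n : ℝ) + 1 ≤ x → x ≤ n + 2 →
      ‖((n + 1 : ℝ) : ℂ) ^ (-s) - (x : ℂ) ^ (-s)‖ ≤ C) :
    ‖zetaTerm n s‖ ≤ C := by
  have h1 : (1 : ℂ) - s ≠ 0 := sub_ne_zero.2 hs1.symm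
  have key := (convex_Icc (n + 1 : ℝ) (n + 2)).norm_image_sub_le_of_norm_hasDerivWithin_le
    (f := fun y : ℝ => ((n + 1 : ℝ) : ℂ) ^ (-s) * y - (y : ℂ) ^ (1 - s) / (1 - s))
    (f' := fun y : ℝ => ((n + 1 : ℝ) : ℂ) ^ (-s) - (y : ℂ) ^ (-s))
    (C := C) (x := n + 1) (y := n + 2) ?_ ?_ (Set.left_mem_Icc.2 (by linarith))
      (Set.right_mem_Icc.2 (by linarith))
  · have e : ‖((n : ℝ) + 2) - (n + 1)‖ = 1 := by norm_num
    rw [e, mul_one] at key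
    refine le_of_eq_of_le (congrArg norm ?_) key
    simp only [zetaTerm]; push_cast; ring
  · intro y hy
    have hy0 : 0 < y := lt_of_lt_of_le (by positivity) hy.1
    have h2 := (hasDerivAt_ofReal_cpow_const hy0.ne' h1).div_const (1 - s)
    have h3 := (((Complex.ofRealCLM.hasDerivAt (x := y)).const_mul
      (((n + 1 : ℝ) : ℂ) ^ (-s))).sub h2).hasDerivWithinAt (s := Set.Icc (n + 1 : ℝ) (n + 2))
    have e : ((n + 1 : ℝ) : ℂ) ^ (-s) * Complex.ofRealCLM 1 - (1 - s) *
        (y : ℂ) ^ (1 - s - 1) / (1 - s)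
        = ((n + 1 : ℝ) : ℂ) ^ (-s) - (y : ℂ) ^ (-s) := by
      rw [mul_div_cancel_left₀ _ h1]
      simp
    rw [e] at h3
    exact h3
  · intro y hy
    exact hC y hy.1 hy.2

lemma norm_zetaTerm_le (n : ℕ) {s : ℂ} (hs1 : s ≠ 1) (hs : 0 ≤ s.re) {θ : ℝ} (h0 : 0 ≤ θ)
    (h1 : θ ≤ 1) :
    ‖zetaTerm n s‖ ≤ 2 * ‖s‖ ^ θ * (n + 1 : ℝ) ^ (-s.re - θ) := by
  have hn : (0 : ℝ) < n + 1 := by positivity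
  have b1 : ‖zetaTerm n s‖ ≤ ‖s‖ * (n + 1 : ℝ) ^ (-s.re - 1) :=
    norm_zetaTerm_le_of_bound n hs1 fun x hx hx' =>
      norm_cpow_neg_sub_le hn hx (by linarith) hs
  have b2 : ‖zetaTerm n s‖ ≤ 2 * (n + 1 : ℝ) ^ (-s.re) := by
    refine norm_zetaTerm_le_of_bound n hs1 fun x hx hx' => (norm_sub_le _ _).trans ?_
    rw [Complex.norm_cpow_eq_rpow_re_of_pos hn,
      Complex.norm_cpow_eq_rpow_re_of_pos (hn.trans_le hx)]
    have : x ^ (-s).re ≤ (n + 1 : ℝ) ^ (-s).re :=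
      Real.rpow_le_rpow_of_nonpos hn hx (by simpa using hs)
    simp only [Complex.neg_re] at *
    linarith
  calc ‖zetaTerm n s‖ = ‖zetaTerm n s‖ ^ θ * ‖zetaTerm n s‖ ^ (1 - θ) := by
        rw [← Real.rpow_add_of_nonneg (norm_nonneg _) h0 (by linarith)]; simp
    _ ≤ (‖s‖ * (n + 1 : ℝ) ^ (-s.re - 1)) ^ θ * (2 * (n + 1 : ℝ) ^ (-s.re)) ^ (1 - θ) := by
        gcongr
    _ = 2 ^ (1 - θ) * ‖s‖ ^ θ * (n + 1 : ℝ) ^ (-s.re - θ) := by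
        rw [Real.mul_rpow (norm_nonneg _) (by positivity), Real.mul_rpow (by norm_num)
          (by positivity), ← Real.rpow_mul hn.le, ← Real.rpow_mul hn.le]
        have : (-s.re - θ) = (-s.re - 1) * θ + -s.re * (1 - θ) := by ring
        rw [this, Real.rpow_add hn]; ring
    _ ≤ _ := by
        gcongr
        calc (2 : ℝ) ^ (1 - θ) ≤ 2 ^ (1 : ℝ) :=
            Real.rpow_le_rpow_of_exponent_le (by norm_num) (by linarith)
          _ = 2 := by norm_num

lemma summable_succ_rpow {p : ℝ} (hp : 1 < p) : Summable fun n : ℕ => (n + 1 : ℝ) ^ (-p) := by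
  have := (summable_nat_add_iff 1).2 (Real.summable_nat_rpow.2 (show -p < -1 by linarith))
  simpa using this

lemma tsum_zetaTerm_of_one_lt {s : ℂ} (hs : 1 < s.re) :
    HasSum (fun n => zetaTerm n s) (riemannZeta s - 1 / (s - 1)) := by
  have hs1 : s ≠ 1 := by rintro rfl; simp at hs
  have h1 : HasSum (fun n : ℕ => (n + 1 : ℂ) ^ (-s)) (riemannZeta s) := by
    have hsum : Summable fun n : ℕ => 1 / (n + 1 : ℂ) ^ s := by
      simpa using (summable_nat_add_iff 1).2 (Complex.summable_one_div_nat_cpow.2 hs)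
    rw [zeta_eq_tsum_one_div_nat_add_one_cpow hs]
    simpa only [Complex.cpow_neg, one_div] using hsum.hasSum
  have hlim : Tendsto (fun n : ℕ => (n + 1 : ℂ) ^ (1 - s)) atTop (nhds 0) := by
    rw [tendsto_zero_iff_norm_tendsto_zero]
    have : Tendsto (fun n : ℕ => ((n : ℝ) + 1) ^ (-(s.re - 1))) atTop (nhds 0) :=
      (tendsto_rpow_neg_atTop (by linarith)).comp
        (tendsto_atTop_add_const_right _ 1 tendsto_natCast_atTop_atTop)
    refine this.congr fun n => ?_
    have hn : (0 : ℝ) < n + 1 := by positivity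
    have := Complex.norm_cpow_eq_rpow_re_of_pos hn (1 - s)
    push_cast at this
    rw [this]; simp
  have hsummable : Summable fun n => zetaTerm n s := by
    refine Summable.of_norm_bounded (g := fun n : ℕ => 2 * ‖s‖ ^ (0 : ℝ) * (n + 1 : ℝ) ^ (-s.re))
      ((summable_succ_rpow hs).mul_left _) fun n => ?_
    simpa using norm_zetaTerm_le n hs1 (by linarith) le_rfl zero_le_one
  have h2 : HasSum (fun n : ℕ => ((n + 2 : ℂ) ^ (1 - s) - (n + 1 : ℂ) ^ (1 - s)) / (1 - s))
      (1 / (s - 1)) := by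
    have hS : Summable fun n : ℕ => ((n + 2 : ℂ) ^ (1 - s) - (n + 1 : ℂ) ^ (1 - s)) / (1 - s) := by
      refine (h1.summable.sub hsummable).congr fun n => ?_
      rw [zetaTerm]; ring
    rw [hS.hasSum_iff_tendsto_nat]
    have hpart : ∀ N : ℕ, ∑ n ∈ Finset.range N,
        ((n + 2 : ℂ) ^ (1 - s) - (n + 1 : ℂ) ^ (1 - s)) / (1 - s)
        = ((N + 1 : ℂ) ^ (1 - s) - 1) / (1 - s) := by
      intro N
      rw [← Finset.sum_div]
      congr 1
      have := Finset.sum_range_sub (fun n : ℕ => (n + 1 : ℂ) ^ (1 - s)) N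
      simp only [Nat.cast_add, Nat.cast_one, Nat.cast_zero, zero_add, Complex.one_cpow] at this
      rw [← this]
      refine Finset.sum_congr rfl fun n _ => ?_
      congr 2; ring
    simp_rw [hpart]
    have := (hlim.sub_const 1).div_const (1 - s)
    convert this using 2
    rw [zero_sub, ← neg_sub s 1, neg_div_neg_eq]
  exact h1.sub h2

lemma differentiableOn_tsum_zetaTerm :
    DifferentiableOn ℂ (fun s => ∑' n, zetaTerm n s) ({s : ℂ | 1 / 2 < s.re} \ {1}) := by
  have ho : IsOpen ({s : ℂ | 1 / 2 < s.re} \ {1}) :=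
    (isOpen_lt continuous_const Complex.continuous_re).sdiff isClosed_singleton
  intro s₀ hs₀
  have ho' : IsOpen (({s : ℂ | 1 / 2 < s.re} \ {1}) ∩ Metric.ball s₀ 1) :=
    ho.inter Metric.isOpen_ball
  refine (DifferentiableOn.differentiableAt (s := ({s : ℂ | 1 / 2 < s.re} \ {1}) ∩ Metric.ball s₀ 1)
    ?_ (ho'.mem_nhds ⟨hs₀, Metric.mem_ball_self one_pos⟩)).differentiableWithinAt
  refine Complex.differentiableOn_tsum_of_summable_norm
    (u := fun n : ℕ => 2 * (‖s₀‖ + 1) * (n + 1 : ℝ) ^ (-(3 / 2) : ℝ))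
    ((summable_succ_rpow (by norm_num)).mul_left _) ?_ ho' ?_
  · intro n s hs
    have h1 : (1 : ℂ) - s ≠ 0 := sub_ne_zero.2 (fun h => hs.1.2 h.symm)
    have e1 : (n + 1 : ℂ) ≠ 0 := by exact_mod_cast n.succ_ne_zero
    have e2 : (n + 2 : ℂ) ≠ 0 := by exact_mod_cast (n + 1).succ_ne_zero
    unfold zetaTerm
    refine DifferentiableAt.differentiableWithinAt ?_
    fun_prop (disch := first | assumption | simp [*])
  · intro n s hs
    have h1 : (1 / 2 : ℝ) < s.re := hs.1.1
    have := norm_zetaTerm_le n (s := s) hs.1.2 (by linarith) zero_le_one le_rfl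
    refine this.trans ?_
    rw [Real.rpow_one]
    have h3 : ‖s‖ ≤ ‖s₀‖ + 1 := by
      have := hs.2
      rw [Metric.mem_ball, dist_eq_norm] at this
      have := norm_sub_norm_le s s₀
      linarith
    gcongr
    · linarith
    · linarith

lemma riemannZeta_sub_eq_tsum {s : ℂ} (hs : 1 / 2 < s.re) (him : s.im ≠ 0) :
    riemannZeta s - 1 / (s - 1) = ∑' n, zetaTerm n s := by
  obtain ⟨e, he, hes⟩ : ∃ e : ℝ, (e = 1 ∨ e = -1) ∧ 0 < e * s.im := by
    rcases lt_or_gt_of_ne him with h | h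
    · exact ⟨-1, .inr rfl, by linarith⟩
    · exact ⟨1, .inl rfl, by linarith⟩
  set U : Set ℂ := {z | 1 / 2 < z.re} ∩ {z | 0 < e * z.im} with hU
  have ho : IsOpen U := (isOpen_lt continuous_const Complex.continuous_re).inter
    (isOpen_lt continuous_const (continuous_const.mul Complex.continuous_im))
  have hU1 : U ⊆ {z : ℂ | 1 / 2 < z.re} \ {1} := by
    rintro z ⟨h1, h2⟩
    refine ⟨h1, ?_⟩
    rintro rfl
    simp at h2
  have hconn : IsPreconnected U := by
    refine ((convex_halfSpace_re_gt (1 / 2)).inter ?_).isPreconnected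
    have : IsLinearMap ℝ (fun z : ℂ => e * z.im) :=
      ⟨fun x y => by simp [mul_add], fun c x => by simp; ring⟩
    exact convex_halfSpace_gt this 0
  have hA : AnalyticOnNhd ℂ (fun s => riemannZeta s - 1 / (s - 1)) U := by
    refine DifferentiableOn.analyticOnNhd (fun z hz => ?_) ho
    have hz1 : z ≠ 1 := (hU1 hz).2
    have hz2 : z - 1 ≠ 0 := sub_ne_zero.2 hz1
    exact ((differentiableAt_riemannZeta hz1).sub
      (by fun_prop (disch := assumption))).differentiableWithinAt
  have hB := (differentiableOn_tsum_zetaTerm.mono hU1).analyticOnNhd ho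
  have := hA.eqOn_of_preconnected_of_eventuallyEq hB hconn (z₀ := 2 + e * Complex.I) ?_ ?_
  · exact this ⟨hs, hes⟩
  · rcases he with rfl | rfl <;> constructor <;> norm_num
  · have : {s : ℂ | 1 < s.re} ∈ nhds (2 + e * Complex.I : ℂ) :=
      (isOpen_lt continuous_const Complex.continuous_re).mem_nhds (by simp)
    filter_upwards [this] with z hz
    exact (tsum_zetaTerm_of_one_lt hz).tsum_eq.symm

lemma norm_tsum_zetaTerm_le : ∃ C : ℝ, 0 < C ∧ ∀ s : ℂ, s ≠ 1 → 15 / 16 ≤ s.re →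
    ‖∑' n, zetaTerm n s‖ ≤ C * ‖s‖ ^ (1 / 8 : ℝ) := by
  have hS := summable_succ_rpow (p := 17 / 16) (by norm_num)
  refine ⟨2 * ∑' n : ℕ, (n + 1 : ℝ) ^ (-(17 / 16) : ℝ), ?_, fun s hs1 hs => ?_⟩
  · have := hS.tsum_pos (fun n => by positivity) 0 (by norm_num)
    positivity
  · have hb : ∀ n : ℕ, ‖zetaTerm n s‖ ≤ 2 * ‖s‖ ^ (1 / 8 : ℝ) * (n + 1 : ℝ) ^ (-(17 / 16) : ℝ) := by
      intro n
      refine (norm_zetaTerm_le n hs1 (by linarith) (θ := 1 / 8) (by norm_num)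
        (by norm_num)).trans ?_
      gcongr
      · linarith
      · linarith
    refine (tsum_of_norm_bounded (hS.mul_left _).hasSum hb).trans (le_of_eq ?_)
    rw [tsum_mul_left]; ring

/-- A weak form of the bound for `ζ` slightly to the left of the line `Re s = 1`. -/
lemma norm_riemannZeta_le : ∃ C : ℝ, 0 < C ∧ ∀ s : ℂ, 15 / 16 ≤ s.re → s.re ≤ 3 →
    1 / 2 ≤ |s.im| → ‖riemannZeta s‖ ≤ C * |s.im| ^ (1 / 8 : ℝ) := by
  obtain ⟨C, hC, h⟩ := norm_tsum_zetaTerm_le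
  refine ⟨2 * 2 + C * 7, by positivity, fun s h1 h3 ht => ?_⟩
  have him : s.im ≠ 0 := by rintro h0; rw [h0] at ht; norm_num at ht
  have hs1 : s ≠ 1 := by rintro rfl; simp at him
  have e : riemannZeta s = 1 / (s - 1) + ∑' n, zetaTerm n s := by
    rw [← riemannZeta_sub_eq_tsum (by linarith) him]; ring
  have hz : |s.im| ≤ ‖s - 1‖ := by simpa using Complex.abs_im_le_norm (s - 1)
  have h7 : ‖s‖ ≤ 7 * |s.im| := by
    refine (Complex.norm_le_abs_re_add_abs_im s).trans ?_
    rw [abs_of_nonneg (by linarith : 0 ≤ s.re)]; linarith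
  have hpow : (1 / 2 : ℝ) ≤ |s.im| ^ (1 / 8 : ℝ) := by
    calc (1 / 2 : ℝ) = (1 / 2 : ℝ) ^ (1 : ℝ) := by norm_num
      _ ≤ (1 / 2 : ℝ) ^ (1 / 8 : ℝ) :=
        Real.rpow_le_rpow_of_exponent_ge (by norm_num) (by norm_num) (by norm_num)
      _ ≤ _ := by gcongr
  have hb1 : ‖1 / (s - 1)‖ ≤ 2 := by
    rw [norm_div, norm_one, div_le_iff₀ (by linarith)]; linarith
  have hb2 : ‖s‖ ^ (1 / 8 : ℝ) ≤ 7 * |s.im| ^ (1 / 8 : ℝ) := by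
    calc ‖s‖ ^ (1 / 8 : ℝ) ≤ (7 * |s.im|) ^ (1 / 8 : ℝ) := by gcongr
      _ = 7 ^ (1 / 8 : ℝ) * |s.im| ^ (1 / 8 : ℝ) := Real.mul_rpow (by norm_num) (by positivity)
      _ ≤ 7 ^ (1 : ℝ) * |s.im| ^ (1 / 8 : ℝ) := by
        gcongr <;> norm_num
      _ = _ := by norm_num
  rw [e]
  calc _ ≤ ‖1 / (s - 1)‖ + ‖∑' n, zetaTerm n s‖ := norm_add_le _ _
    _ ≤ 2 + C * ‖s‖ ^ (1 / 8 : ℝ) := add_le_add hb1 (h s hs1 h1)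
    _ ≤ 2 * 2 * |s.im| ^ (1 / 8 : ℝ) + C * (7 * |s.im| ^ (1 / 8 : ℝ)) := by gcongr; linarith
    _ = _ := by ring

lemma norm_riemannZeta_le_div : ∃ C : ℝ, 0 < C ∧ ∀ x : ℝ, 0 < x → x ≤ 1 →
    ‖riemannZeta (1 + x)‖ ≤ C / x := by
  obtain ⟨C, hC, h⟩ := norm_tsum_zetaTerm_le
  refine ⟨1 + C * 2, by positivity, fun x hx hx1 => ?_⟩
  have hs : 1 < ((1 : ℂ) + x).re := by simpa using hx
  have hs1 : (1 : ℂ) + x ≠ 1 := by simpa using hx.ne'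
  have e : riemannZeta (1 + x) = 1 / x + ∑' n, zetaTerm n (1 + x) := by
    rw [(tsum_zetaTerm_of_one_lt hs).tsum_eq]; simp
  have hn : ‖(1 : ℂ) + x‖ ^ (1 / 8 : ℝ) ≤ 2 := by
    have : ‖(1 : ℂ) + x‖ = 1 + x := by
      rw [← Complex.ofReal_one, ← Complex.ofReal_add, Complex.norm_real, Real.norm_of_nonneg]
      positivity
    rw [this]
    calc (1 + x) ^ (1 / 8 : ℝ) ≤ (1 + x) ^ (1 : ℝ) :=
        Real.rpow_le_rpow_of_exponent_le (by linarith) (by norm_num)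
      _ ≤ 2 := by rw [Real.rpow_one]; linarith
  rw [e]
  calc _ ≤ ‖1 / (x : ℂ)‖ + ‖∑' n, zetaTerm n (1 + x)‖ := norm_add_le _ _
    _ ≤ 1 / x + C * 2 := by
      gcongr
      · simp [abs_of_pos hx]
      · exact (h _ hs1 (by linarith)).trans (by gcongr)
    _ ≤ 1 / x + C * 2 / x := by
      gcongr
      rw [le_div_iff₀ hx]
      nlinarith
    _ = _ := by ring

lemma riemannZeta_lower_of_pos : ∃ c : ℝ, 0 < c ∧ ∀ x t : ℝ, 0 < x → x ≤ 1 → 1 ≤ |t| →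
    c * x ^ (3 / 4 : ℝ) * |t| ^ (-(1 / 32) : ℝ) ≤ ‖riemannZeta (1 + x + Complex.I * t)‖ := by
  obtain ⟨C₁, hC₁, h₁⟩ := norm_riemannZeta_le_div
  obtain ⟨C₂, hC₂, h₂⟩ := norm_riemannZeta_le
  refine ⟨(1 / (C₁ ^ 3 * C₂ * 2)) ^ (1 / 4 : ℝ), by positivity, fun x t hx hx1 ht => ?_⟩
  have ht0 : 0 < |t| := by linarith
  set w := ‖riemannZeta (1 + x + Complex.I * t)‖ with hw
  have hprod : 1 ≤ (C₁ / x) ^ 3 * w ^ 4 * (C₂ * (2 * |t| ^ (1 / 8 : ℝ))) := by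
    have h := DirichletCharacter.norm_LFunction_product_ge_one
      (χ := (1 : DirichletCharacter ℂ 1)) hx t
    simp only [DirichletCharacter.LFunction_modOne_eq, DirichletCharacter.LFunctionTrivChar,
        one_pow] at h
    rw [norm_mul, norm_mul, norm_pow, norm_pow] at h
    refine h.trans ?_
    have hz2 : ‖riemannZeta (1 + x + 2 * Complex.I * t)‖ ≤ C₂ * (2 * |t| ^ (1 / 8 : ℝ)) := by
      refine (h₂ _ (by simp; linarith) (by simp; linarith) (by simp; linarith)).trans ?_
      gcongr
      have : |((1 : ℂ) + x + 2 * Complex.I * t).im| = 2 * |t| := by simp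
      rw [this, Real.mul_rpow (by norm_num) ht0.le]
      gcongr
      calc (2 : ℝ) ^ (1 / 8 : ℝ) ≤ 2 ^ (1 : ℝ) :=
            Real.rpow_le_rpow_of_exponent_le (by norm_num) (by norm_num)
        _ = 2 := by norm_num
    gcongr
    exact h₁ x hx hx1
  refine le_of_pow_le_pow_left₀ (n := 4) (by norm_num) (norm_nonneg _) ?_
  have e1 : ∀ y r : ℝ, 0 ≤ y → (y ^ r) ^ 4 = y ^ (r * 4) := fun y r hy => by
    rw [← Real.rpow_natCast, ← Real.rpow_mul hy]; norm_num
  rw [mul_pow, mul_pow, e1 _ _ (by positivity), e1 _ _ hx.le, e1 _ _ ht0.le]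
  have e2 : (1 / 4 : ℝ) * 4 = 1 := by norm_num
  have e3 : (3 / 4 : ℝ) * 4 = (3 : ℕ) := by norm_num
  have e4 : (-(1 / 32) : ℝ) * 4 = -(1 / 8) := by norm_num
  rw [e2, e3, e4, Real.rpow_one, Real.rpow_natCast, Real.rpow_neg ht0.le]
  have hp : 0 < |t| ^ (1 / 8 : ℝ) := by positivity
  rw [div_pow] at hprod
  field_simp at hprod ⊢
  linarith

lemma norm_deriv_riemannZeta_le : ∃ C : ℝ, 0 < C ∧ ∀ s : ℂ, 1 ≤ s.re → s.re ≤ 2 → 1 ≤ |s.im| →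
    ‖deriv riemannZeta s‖ ≤ C * |s.im| ^ (1 / 8 : ℝ) := by
  obtain ⟨C₂, hC₂, h₂⟩ := norm_riemannZeta_le
  refine ⟨C₂ * 2 / (1 / 16), by positivity, fun s h1 h2 ht => ?_⟩
  have hclose : ∀ z ∈ Metric.closedBall s (1 / 16 : ℝ),
      |z.re - s.re| ≤ 1 / 16 ∧ |z.im - s.im| ≤ 1 / 16 := by
    intro z hz
    rw [Metric.mem_closedBall, dist_eq_norm] at hz
    exact ⟨by simpa using (Complex.abs_re_le_norm (z - s)).trans hz,
      by simpa using (Complex.abs_im_le_norm (z - s)).trans hz⟩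
  have him : ∀ z ∈ Metric.closedBall s (1 / 16 : ℝ), |s.im| - 1 / 16 ≤ |z.im| ∧
      |z.im| ≤ |s.im| + 1 / 16 := by
    intro z hz
    have := (hclose z hz).2
    have h3 := abs_sub_abs_le_abs_sub s.im z.im
    have h4 := abs_sub_abs_le_abs_sub z.im s.im
    rw [abs_sub_comm] at h3
    constructor <;> linarith
  have hd : DiffContOnCl ℂ riemannZeta (Metric.ball s (1 / 16)) := by
    refine DifferentiableOn.diffContOnCl fun z hz => ?_
    rw [closure_ball _ (by norm_num)] at hz
    refine (differentiableAt_riemannZeta ?_).differentiableWithinAt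
    rintro rfl
    have := (him 1 hz).1
    simp at this
    linarith
  have := Complex.norm_deriv_le_of_forall_mem_sphere_norm_le (by norm_num : (0 : ℝ) < 1 / 16) hd
    (C := C₂ * (2 * |s.im| ^ (1 / 8 : ℝ))) ?_
  · refine this.trans (le_of_eq (by ring))
  · intro z hz
    have hz' := Metric.sphere_subset_closedBall hz
    have hre := abs_le.1 (hclose z hz').1
    have hi := him z hz'
    refine (h₂ z (by linarith) (by linarith) (by linarith)).trans ?_
    gcongr
    calc |z.im| ^ (1 / 8 : ℝ) ≤ (2 * |s.im|) ^ (1 / 8 : ℝ) := by gcongr; linarith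
      _ = 2 ^ (1 / 8 : ℝ) * |s.im| ^ (1 / 8 : ℝ) := Real.mul_rpow (by norm_num) (by positivity)
      _ ≤ 2 ^ (1 : ℝ) * |s.im| ^ (1 / 8 : ℝ) := by
        gcongr <;> norm_num
      _ = _ := by norm_num

/-- A polynomial lower bound for `ζ` on and to the right of the line `Re s = 1`. -/
theorem riemannZeta_lower : ∃ c : ℝ, 0 < c ∧ ∀ x t : ℝ, 0 ≤ x → x ≤ 1 → 1 ≤ |t| →
    c * |t| ^ (-(1 / 2) : ℝ) ≤ ‖riemannZeta (1 + x + Complex.I * t)‖ := by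
  obtain ⟨c, hc, h₁⟩ := riemannZeta_lower_of_pos
  obtain ⟨C, hC, h₂⟩ := norm_deriv_riemannZeta_le
  set η : ℝ := min 1 (c / (2 * C)) with hη
  have hη0 : 0 < η := by positivity
  have hη1 : η ≤ 1 := min_le_left _ _
  have hη2 : C * η ≤ c / 2 := by
    have : η ≤ c / (2 * C) := min_le_right _ _
    calc C * η ≤ C * (c / (2 * C)) := by gcongr
      _ = c / 2 := by field_simp
  refine ⟨c / 2 * η ^ 3, by positivity, fun x t hx hx1 ht => ?_⟩
  have ht0 : 0 < |t| := by linarith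
  set X : ℝ := η ^ 4 * |t| ^ (-(5 / 8) : ℝ) with hX
  have hX0 : 0 < X := by positivity
  have hX1 : X ≤ 1 := by
    refine mul_le_one₀ (pow_le_one₀ hη0.le hη1) (by positivity) ?_
    exact Real.rpow_le_one_of_one_le_of_nonpos ht (by norm_num)
  have hXpow : X ^ (3 / 4 : ℝ) * |t| ^ (-(1 / 32) : ℝ) = η ^ 3 * |t| ^ (-(1 / 2) : ℝ) := by
    rw [hX, Real.mul_rpow (by positivity) (by positivity), ← Real.rpow_mul ht0.le,
      ← Real.rpow_natCast η 4, ← Real.rpow_mul hη0.le, mul_assoc, ← Real.rpow_add ht0,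
      ← Real.rpow_natCast η 3]
    norm_num
  by_cases hxX : X ≤ x
  · refine le_trans ?_ (h₁ x t (hX0.trans_le hxX) hx1 ht)
    calc c / 2 * η ^ 3 * |t| ^ (-(1 / 2) : ℝ) ≤ c * (η ^ 3 * |t| ^ (-(1 / 2) : ℝ)) := by
          have : 0 ≤ c * (η ^ 3 * |t| ^ (-(1 / 2) : ℝ)) := by positivity
          linarith
      _ = c * X ^ (3 / 4 : ℝ) * |t| ^ (-(1 / 32) : ℝ) := by rw [← hXpow]; ring
      _ ≤ _ := by gcongr
  · push Not at hxX
    have hlow := h₁ X t hX0 hX1 ht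
    have hlip : ‖riemannZeta (1 + X + Complex.I * t) - riemannZeta (1 + x + Complex.I * t)‖
        ≤ C * |t| ^ (1 / 8 : ℝ) * X := by
      have key := (convex_Icc (0 : ℝ) 1).norm_image_sub_le_of_norm_hasDerivWithin_le
        (f := fun y : ℝ => riemannZeta (1 + y + Complex.I * t))
        (f' := fun y : ℝ => deriv riemannZeta (1 + y + Complex.I * t))
        (C := C * |t| ^ (1 / 8 : ℝ)) (x := x) (y := X) ?_ ?_ ⟨hx, hx1⟩ ⟨hX0.le, hX1⟩
      · refine key.trans ?_
        gcongr
        rw [Real.norm_eq_abs, abs_of_pos (by linarith)]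
        linarith
      · intro y hy
        have hne : (1 + y + Complex.I * t : ℂ) ≠ 1 := by
          intro h
          have := congrArg Complex.im h
          simp at this
          rw [this] at ht; norm_num at ht
        have h3 := (differentiableAt_riemannZeta hne).hasDerivAt
        have h4 : HasDerivAt (fun y : ℝ => (1 + y + Complex.I * t : ℂ)) 1 y := by
          have := ((Complex.ofRealCLM.hasDerivAt (x := y)).const_add (1 : ℂ)).add_const
            (Complex.I * t)
          simpa using this
        have := (h3.comp y h4).hasDerivWithinAt (s := Set.Icc (0 : ℝ) 1)
        rw [mul_one] at this
        exact this
      · intro y hy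
        have := h₂ (1 + y + Complex.I * t) (by simpa using hy.1)
          (by simp; linarith [hy.2]) (by simpa using ht)
        simpa using this
    have e : C * |t| ^ (1 / 8 : ℝ) * X = C * η * (η ^ 3 * |t| ^ (-(1 / 2) : ℝ)) := by
      have : |t| ^ (-(1 / 2) : ℝ) = |t| ^ (1 / 8 : ℝ) * |t| ^ (-(5 / 8) : ℝ) := by
        rw [← Real.rpow_add ht0]; norm_num
      rw [this, hX]; ring
    have h5 := norm_sub_norm_le (riemannZeta (1 + X + Complex.I * t))
      (riemannZeta (1 + x + Complex.I * t))
    have h6 : C * η * (η ^ 3 * |t| ^ (-(1 / 2) : ℝ)) ≤ c / 2 * (η ^ 3 * |t| ^ (-(1 / 2) : ℝ)) := by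
      gcongr
    have h7 : c * X ^ (3 / 4 : ℝ) * |t| ^ (-(1 / 32) : ℝ) = c * (η ^ 3 * |t| ^ (-(1 / 2) : ℝ)) := by
      rw [← hXpow]; ring
    linarith

/-- The function `log^k x / k!` cut off at `x ≥ 1`. -/
noncomputable def logPow (k : ℕ) (x : ℝ) : ℝ :=
  if 1 ≤ x then Real.log x ^ k / k.factorial else 0

lemma logPow_exp (k : ℕ) (y : ℝ) :
    logPow k (Real.exp y) = if 0 ≤ y then y ^ k / k.factorial else 0 := by
  simp [logPow]

lemma normSq_vertical (σ t : ℝ) : ‖(σ + Complex.I * t : ℂ)‖ ^ 2 = σ ^ 2 + t ^ 2 := by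
  rw [Complex.sq_norm, Complex.normSq_apply]
  simp; ring

lemma le_norm_vertical (σ t : ℝ) : |σ| ≤ ‖(σ + Complex.I * t : ℂ)‖ := by
  simpa using Complex.abs_re_le_norm (σ + Complex.I * t : ℂ)

lemma vertical_ne_zero {σ : ℝ} (hσ : 0 < σ) (t : ℝ) : (σ + Complex.I * t : ℂ) ≠ 0 := fun h => by
  have := congrArg Complex.re h
  simp at this
  exact hσ.ne' this

lemma integrable_inv_vertical_pow {σ : ℝ} (hσ : 0 < σ) (k : ℕ) (hk : 1 ≤ k) :
    MeasureTheory.Integrable fun t : ℝ => 1 / (σ + Complex.I * t : ℂ) ^ (k + 1) := by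
  have hc : Continuous fun t : ℝ => 1 / (σ + Complex.I * t : ℂ) ^ (k + 1) :=
    continuous_const.div (by fun_prop) fun t => pow_ne_zero _ (vertical_ne_zero hσ t)
  have hm : 0 < min 1 (σ ^ 2) := by positivity
  refine ((integrable_inv_one_add_sq).const_mul ((σ ^ (k - 1))⁻¹ * (min 1 (σ ^ 2))⁻¹)).mono'
    hc.aestronglyMeasurable (Eventually.of_forall fun t => ?_)
  rw [norm_div, norm_one, norm_pow, one_div, show k + 1 = (k - 1) + 2 by omega, pow_add,
    mul_inv, mul_assoc, ← mul_inv, normSq_vertical]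
  have h1 := le_norm_vertical σ t
  rw [abs_of_pos hσ] at h1
  have h2 : min 1 (σ ^ 2) * (1 + t ^ 2) ≤ σ ^ 2 + t ^ 2 := by
    have a := min_le_left 1 (σ ^ 2)
    have b := min_le_right 1 (σ ^ 2)
    nlinarith [sq_nonneg t]
  have h3 : (‖(σ + Complex.I * t : ℂ)‖ ^ (k - 1))⁻¹ ≤ (σ ^ (k - 1))⁻¹ :=
    inv_anti₀ (by positivity) (pow_le_pow_left₀ hσ.le h1 _)
  rw [mul_inv, ← mul_inv (min 1 (σ ^ 2))]
  exact mul_le_mul h3 (inv_anti₀ (by positivity) h2) (by positivity) (by positivity)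

lemma integrableOn_pow_mul_cexp (k : ℕ) {r : ℂ} (hr : 0 < r.re) :
    MeasureTheory.IntegrableOn (fun v : ℝ => (v : ℂ) ^ k * Complex.exp (-(r * v)))
      (Set.Ioi 0) := by
  have := integrableOn_rpow_mul_exp_neg_mul_rpow (p := 1) (s := k) (b := r.re)
    (by linarith [(Nat.cast_nonneg k : (0 : ℝ) ≤ k)]) one_pos hr
  refine MeasureTheory.Integrable.mono' this (by fun_prop) ?_
  refine (MeasureTheory.ae_restrict_iff' measurableSet_Ioi).mpr (Eventually.of_forall fun v hv =>
      ?_)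
  have hv : 0 < v := hv
  simp [Complex.norm_exp, abs_of_pos hv]

lemma integral_pow_mul_cexp (k : ℕ) {r : ℂ} (hr : 0 < r.re) :
    ∫ v : ℝ in Set.Ioi 0, (v : ℂ) ^ k * Complex.exp (-(r * v)) = k.factorial / r ^ (k + 1) := by
  have hr0 : r ≠ 0 := fun h => by simp [h] at hr
  have hexp : ∀ v : ℝ, HasDerivAt (fun v : ℝ => Complex.exp (-(r * v)))
      (-r * Complex.exp (-(r * v))) v := fun v => by
    have h1 : HasDerivAt (fun v : ℝ => -(r * (v : ℂ))) (-r) v := by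
      simpa using! ((hasDerivAt_id v).ofReal_comp.const_mul r).neg
    simpa [mul_comm] using h1.cexp
  have hnorm : ∀ j : ℕ, Tendsto (fun v : ℝ => (v : ℂ) ^ j * Complex.exp (-(r * v))) atTop
      (nhds 0) := fun j => by
    rw [tendsto_zero_iff_norm_tendsto_zero]
    refine (tendsto_rpow_mul_exp_neg_mul_atTop_nhds_zero j r.re hr).congr' ?_
    filter_upwards [eventually_gt_atTop 0] with v hv
    simp [Complex.norm_exp, abs_of_pos hv]
  induction k with
  | zero =>
    have := MeasureTheory.integral_Ioi_of_hasDerivAt_of_tendsto' (a := 0) (m := 0)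
      (f := fun v : ℝ => -(1 / r) * Complex.exp (-(r * v)))
      (f' := fun v : ℝ => (v : ℂ) ^ 0 * Complex.exp (-(r * v))) (fun v _ => by
        convert! (hexp v).const_mul (-(1 / r)) using 1
        field_simp) (integrableOn_pow_mul_cexp 0 hr) (by simpa using (hnorm 0).const_mul (-(1 / r)))
    rw [this]
    simp
  | succ k ih =>
    have hi := (integrableOn_pow_mul_cexp k hr).const_mul ((k + 1) / r)
    have := MeasureTheory.integral_Ioi_of_hasDerivAt_of_tendsto' (a := 0) (m := 0)
      (f := fun v : ℝ => -(1 / r) * ((v : ℂ) ^ (k + 1) * Complex.exp (-(r * v))))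
      (f' := fun v : ℝ => (v : ℂ) ^ (k + 1) * Complex.exp (-(r * v)) -
        (k + 1) / r * ((v : ℂ) ^ k * Complex.exp (-(r * v)))) (fun v _ => by
        have hp : HasDerivAt (fun v : ℝ => (v : ℂ) ^ (k + 1)) ((k + 1) * (v : ℂ) ^ k) v := by
          simpa using! ((hasDerivAt_id v).ofReal_comp).pow (k + 1)
        convert! (hp.mul (hexp v)).const_mul (-(1 / r)) using 1
        field_simp
        ring) ((integrableOn_pow_mul_cexp (k + 1) hr).sub hi)
        (by simpa using (hnorm (k + 1)).const_mul (-(1 / r)))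
    rw [MeasureTheory.integral_sub (integrableOn_pow_mul_cexp (k + 1) hr) hi,
      MeasureTheory.integral_const_mul, ih] at this
    rw [sub_eq_iff_eq_add] at this
    rw [this, Nat.factorial_succ]
    push_cast
    field_simp
    simp
    ring

lemma perron_logPow {σ : ℝ} (hσ : 0 < σ) (k : ℕ) (hk : 1 ≤ k) (y : ℝ) :
    ∫ t : ℝ, Complex.exp ((σ + Complex.I * t) * y) * (1 / (σ + Complex.I * t) ^ (k + 1)) =
      2 * Real.pi * logPow k (Real.exp y) := by
  set f : ℝ → ℂ := fun v => Complex.exp (-(σ * v)) * (logPow k (Real.exp v) : ℂ) with hf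
  have hlp : Continuous fun v => logPow k (Real.exp v) := by
    simp_rw [logPow_exp]
    refine Continuous.if_le (by fun_prop) (by fun_prop) (by fun_prop) (by fun_prop) ?_
    rintro x rfl
    simp [show k ≠ 0 by omega]
  have hfc : Continuous f := by
    refine Continuous.mul (by fun_prop) (Complex.continuous_ofReal.comp hlp)
  have hind : ∀ v, f v = Set.indicator (Set.Ioi (0 : ℝ))
      (fun v : ℝ => Complex.exp (-(σ * v)) * (v ^ k / k.factorial)) v := by
    intro v
    simp only [hf, logPow_exp, Set.indicator, Set.mem_Ioi]
    rcases lt_trichotomy v 0 with h | h | h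
    · simp [not_le.mpr h, not_lt.mpr h.le]
    · simp [h, show k ≠ 0 by omega]
    · simp [h, h.le]
  have hfi : MeasureTheory.Integrable f := by
    rw [show f = _ from funext hind, MeasureTheory.integrable_indicator_iff measurableSet_Ioi]
    refine ((integrableOn_pow_mul_cexp k (r := σ) (by simpa using hσ)).const_mul
      (1 / (k.factorial : ℂ))).congr (Eventually.of_forall fun v => ?_)
    simp only
    ring
  have hF : ∀ ξ : ℝ, FourierTransform.fourier f ξ =
      1 / (σ + Complex.I * (2 * Real.pi * ξ : ℝ)) ^ (k + 1) := by
    intro ξ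
    rw [Real.fourier_real_eq_integral_exp_smul]
    have e : ∀ v : ℝ, Complex.exp (↑(-2 * Real.pi * v * ξ) * Complex.I) • f v =
        Set.indicator (Set.Ioi (0 : ℝ)) (fun v : ℝ => (1 / (k.factorial : ℂ)) *
          ((v : ℂ) ^ k *
            Complex.exp (-((σ + Complex.I * (2 * Real.pi * ξ : ℝ)) * v)))) v := by
      intro v
      rw [hind]
      by_cases h : v ∈ Set.Ioi (0 : ℝ)
      · simp only [Set.indicator_of_mem h, smul_eq_mul]
        rw [← mul_assoc, ← Complex.exp_add]
        have : (↑(-2 * Real.pi * v * ξ) * Complex.I + -(σ * v) : ℂ) =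
          -((σ + Complex.I * (2 * Real.pi * ξ : ℝ)) * v) := by push_cast; ring
        rw [this]; ring
      · simp [Set.indicator_of_notMem h]
    simp_rw [e]
    rw [MeasureTheory.integral_indicator measurableSet_Ioi, MeasureTheory.integral_const_mul,
      integral_pow_mul_cexp k (by simpa using hσ)]
    have : (k.factorial : ℂ) ≠ 0 := by exact_mod_cast Nat.factorial_ne_zero k
    field_simp
  have hFi : MeasureTheory.Integrable (FourierTransform.fourier f) := by
    rw [show FourierTransform.fourier f = _ from funext hF]
    exact (integrable_inv_vertical_pow hσ k hk).comp_mul_left' (by positivity)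
  have key := congrFun (hfc.fourierInv_fourier_eq hfi hFi) y
  rw [Real.fourierInv_eq'] at key
  simp_rw [hF] at key
  have hs := MeasureTheory.Measure.integral_comp_mul_left (fun t : ℝ =>
    Complex.exp ((σ + Complex.I * t) * y) * (1 / (σ + Complex.I * t) ^ (k + 1))) (2 * Real.pi)
  have e3 : ∀ v : ℝ, Complex.exp ((σ + Complex.I * (2 * Real.pi * v : ℝ)) * y) *
      (1 / (σ + Complex.I * (2 * Real.pi * v : ℝ)) ^ (k + 1)) = Complex.exp (σ * y) *
      (Complex.exp (↑(2 * Real.pi * inner ℝ v y) * Complex.I) •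
        (1 / (σ + Complex.I * (2 * Real.pi * v : ℝ)) ^ (k + 1))) := by
    intro v
    rw [smul_eq_mul, ← mul_assoc, ← Complex.exp_add]
    congr 2
    simp
    ring
  simp_rw [e3] at hs
  rw [MeasureTheory.integral_const_mul, key, hf] at hs
  simp only [← mul_assoc, ← Complex.exp_add, add_neg_cancel, Complex.exp_zero, one_mul] at hs
  rw [hs, abs_of_pos (by positivity), Complex.real_smul]
  rw [← mul_assoc]
  push_cast
  rw [mul_inv_cancel₀ (by simp), one_mul]

/-- The operator `φ ↦ (x ↦ ∑ μ(n)/n φ(x/n))`. -/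
noncomputable def moebiusOp (φ : ℝ → ℝ) (x : ℝ) : ℝ :=
  ∑ n ∈ Finset.Icc 1 ⌊x⌋₊, (ArithmeticFunction.moebius n : ℝ) / n * φ (x / n)

lemma moebiusOp_of_lt_one (φ : ℝ → ℝ) {x : ℝ} (hx : x < 1) : moebiusOp φ x = 0 := by
  simp [moebiusOp, Nat.floor_eq_zero.mpr hx]

lemma norm_term_moebius_vertical (σ t : ℝ) (n : ℕ) :
    ‖LSeries.term (fun n => (ArithmeticFunction.moebius n : ℂ)) (1 + (σ + Complex.I * t)) n‖ =
      ‖LSeries.term (fun n => (ArithmeticFunction.moebius n : ℂ)) (1 + σ) n‖ := by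
  rw [LSeries.norm_term_eq, LSeries.norm_term_eq]
  simp

lemma perron_moebiusOp {σ : ℝ} (hσ : 0 < σ) {φ : ℝ → ℝ} (hφ : ∀ x < 1, φ x = 0) {G : ℝ → ℂ}
    (hG : MeasureTheory.Integrable G)
    (h : ∀ y : ℝ, ∫ t : ℝ, Complex.exp ((σ + Complex.I * t) * y) * G t =
      2 * Real.pi * φ (Real.exp y)) :
    MeasureTheory.Integrable (fun t => G t / riemannZeta (1 + (σ + Complex.I * t))) ∧
    ∀ y : ℝ, ∫ t : ℝ, Complex.exp ((σ + Complex.I * t) * y) *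
      (G t / riemannZeta (1 + (σ + Complex.I * t))) = 2 * Real.pi * moebiusOp φ (Real.exp y) := by
  set f : ℕ → ℂ := fun n => (ArithmeticFunction.moebius n : ℂ) with hf
  have hre : ∀ t : ℝ, 1 < (1 + (σ + Complex.I * t) : ℂ).re := fun t => by simp [hσ]
  have hL : ∀ t : ℝ, LSeries f (1 + (σ + Complex.I * t)) =
      1 / riemannZeta (1 + (σ + Complex.I * t)) := fun t => by
    have h1 := ArithmeticFunction.LSeries_zeta_mul_Lseries_moebius (hre t)
    rw [ArithmeticFunction.LSeries_zeta_eq_riemannZeta (hre t)] at h1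
    exact eq_one_div_of_mul_eq_one_right h1
  have hsum : Summable fun n => ‖LSeries.term f (1 + σ) n‖ :=
    ((ArithmeticFunction.LSeriesSummable_moebius_iff (s := 1 + σ)).mpr (by simp [hσ])).norm
  have hterm : ∀ n, Continuous fun t : ℝ => LSeries.term f (1 + (σ + Complex.I * t)) n := by
    intro n
    rcases eq_or_ne n 0 with rfl | hn
    · simpa using continuous_const
    · simp_rw [LSeries.term_of_ne_zero hn]
      have hn' : (n : ℂ) ≠ 0 := by exact_mod_cast hn
      refine continuous_const.div (Continuous.const_cpow (by fun_prop) (Or.inl hn')) fun t => ?_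
      exact (Complex.cpow_ne_zero_iff.mpr (Or.inl hn'))
  have hFi : ∀ y : ℝ, ∀ n, MeasureTheory.Integrable fun t : ℝ =>
      Complex.exp ((σ + Complex.I * t) * y) * G t *
        LSeries.term f (1 + (σ + Complex.I * t)) n := fun y n => by
    have h1 : MeasureTheory.Integrable fun t : ℝ => Complex.exp ((σ + Complex.I * t) * y) * G t :=
      hG.bdd_mul (c := Real.exp (σ * y))
        (Continuous.aestronglyMeasurable (by fun_prop))
        (Eventually.of_forall fun t => by simp [Complex.norm_exp])
    refine h1.mul_bdd (c := ‖LSeries.term f (1 + σ) n‖) (hterm n).aestronglyMeasurable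
      (Eventually.of_forall fun t => (norm_term_moebius_vertical σ t n).le)
  have hnorm : ∀ y : ℝ, ∀ n, ∫ t : ℝ, ‖Complex.exp ((σ + Complex.I * t) * y) * G t *
        LSeries.term f (1 + (σ + Complex.I * t)) n‖ =
        (Real.exp (σ * y) * ∫ t : ℝ, ‖G t‖) * ‖LSeries.term f (1 + σ) n‖ := fun y n => by
    simp_rw [norm_mul, hf, norm_term_moebius_vertical]
    rw [MeasureTheory.integral_mul_const, ← MeasureTheory.integral_const_mul]
    congr 2
    ext t
    simp [Complex.norm_exp]
  have hF : ∀ y : ℝ, HasSum (fun n => ∫ t : ℝ, Complex.exp ((σ + Complex.I * t) * y) * G t *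
        LSeries.term f (1 + (σ + Complex.I * t)) n)
      (∫ t : ℝ, Complex.exp ((σ + Complex.I * t) * y) *
      (G t / riemannZeta (1 + (σ + Complex.I * t)))) := fun y => by
    have := MeasureTheory.hasSum_integral_of_summable_integral_norm (hFi y)
      (by simp_rw [hnorm]; exact hsum.mul_left _)
    convert! this using 2
    ext t
    rw [tsum_mul_left, ← LSeries, hL]
    ring
  have hint : ∀ y : ℝ, ∀ n : ℕ, n ≠ 0 → ∫ t : ℝ, Complex.exp ((σ + Complex.I * t) * y) * G t *
        LSeries.term f (1 + (σ + Complex.I * t)) n =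
      2 * Real.pi * ((ArithmeticFunction.moebius n : ℝ) / n * φ (Real.exp y / n) : ℝ) := by
    intro y n hn
    have hn0 : (0 : ℝ) < n := by positivity
    have hn' : (n : ℂ) ≠ 0 := by exact_mod_cast hn
    have h1 := h (y - Real.log n)
    rw [Real.exp_sub, Real.exp_log hn0] at h1
    push_cast
    rw [mul_left_comm, ← h1, ← MeasureTheory.integral_const_mul]
    congr 1
    ext t
    rw [LSeries.term_of_ne_zero hn, Complex.cpow_add _ _ hn', Complex.cpow_one,
      Complex.cpow_def_of_ne_zero hn' (σ + Complex.I * t), Complex.ofReal_sub,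
      ← Complex.natCast_log, mul_sub, Complex.exp_sub]
    rw [mul_comm ((Real.log n : ℝ) : ℂ)]
    simp only [hf]
    have := Complex.exp_ne_zero ((σ + Complex.I * t) * (Real.log n : ℝ))
    field_simp
  constructor
  · have hb : ∀ t : ℝ, ‖LSeries f (1 + (σ + Complex.I * t))‖ ≤
        ∑' n, ‖LSeries.term f (1 + σ) n‖ := fun t => by
      have : Summable fun n => ‖LSeries.term f (1 + (σ + Complex.I * t)) n‖ := by
        simp_rw [hf, norm_term_moebius_vertical]; exact hsum
      refine (norm_tsum_le_tsum_norm this).trans_eq ?_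
      simp_rw [hf, norm_term_moebius_vertical]
    have hc : Continuous fun t : ℝ => LSeries f (1 + (σ + Complex.I * t)) := by
      refine continuous_tsum hterm hsum fun n t => (norm_term_moebius_vertical σ t n).le
    refine (hG.mul_bdd hc.aestronglyMeasurable (Eventually.of_forall hb)).congr
      (Eventually.of_forall fun t => ?_)
    simp only [hL]
    ring
  · intro y
    refine (hF y).unique ?_
    have h0 : ∀ n ∉ Finset.Icc 1 ⌊Real.exp y⌋₊,
        ∫ t : ℝ, Complex.exp ((σ + Complex.I * t) * y) * G t *
        LSeries.term f (1 + (σ + Complex.I * t)) n = 0 := by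
      intro n hn
      rcases eq_or_ne n 0 with rfl | hn0
      · simp
      · rw [hint y n hn0, hφ, mul_zero]
        · simp
        · have : ⌊Real.exp y⌋₊ < n := by
            by_contra hlt
            exact hn (Finset.mem_Icc.mpr ⟨Nat.one_le_iff_ne_zero.mpr hn0, not_lt.mp hlt⟩)
          rw [div_lt_one (by positivity)]
          exact Nat.lt_of_floor_lt this
    rw [moebiusOp, Complex.ofReal_sum, Finset.mul_sum]
    have h2 := hasSum_sum_of_ne_finset_zero (L := .unconditional ℕ) h0
    rwa [Finset.sum_congr rfl fun n hn =>
      hint y n (by have := (Finset.mem_Icc.mp hn).1; omega)] at h2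

/-- The entire function `s ζ(1 + s)`. -/
noncomputable def shiftedZeta (s : ℂ) : ℂ := riemannZeta₁ (1 + s)

lemma differentiable_shiftedZeta : Differentiable ℂ shiftedZeta :=
  differentiable_riemannZeta₁.comp (by fun_prop)

lemma shiftedZeta_zero : shiftedZeta 0 = 1 := by simp [shiftedZeta, riemannZeta₁_one]

lemma shiftedZeta_eq {s : ℂ} (hs : s ≠ 0) : shiftedZeta s = s * riemannZeta (1 + s) := by
  rw [riemannZeta_eq_inv_sub_mul (by simpa using hs), shiftedZeta, add_sub_cancel_left,
      mul_inv_cancel_left₀ hs]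

lemma shiftedZeta_ne_zero {s : ℂ} (hs : 0 ≤ s.re) : shiftedZeta s ≠ 0 := by
  rcases eq_or_ne s 0 with rfl | h
  · simp [shiftedZeta_zero]
  · rw [shiftedZeta_eq h]
    exact mul_ne_zero h (riemannZeta_ne_zero_of_one_le_re (by simpa using hs))

lemma shiftedZeta_lower : ∃ c : ℝ, 0 < c ∧ ∀ x t : ℝ, 0 ≤ x → x ≤ 1 → 1 ≤ |t| →
    c * |t| ^ (1 / 2 : ℝ) ≤ ‖shiftedZeta (x + Complex.I * t)‖ := by
  obtain ⟨c, hc, h⟩ := riemannZeta_lower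
  refine ⟨c, hc, fun x t hx hx1 ht => ?_⟩
  have ht0 : 0 < |t| := by linarith
  have him : |t| ≤ ‖(x + Complex.I * t : ℂ)‖ := by
    simpa using Complex.abs_im_le_norm (x + Complex.I * t : ℂ)
  have hne : (x + Complex.I * t : ℂ) ≠ 0 := norm_pos_iff.mp (ht0.trans_le him)
  rw [shiftedZeta_eq hne, norm_mul, ← add_assoc]
  refine le_trans (le_of_eq ?_) (mul_le_mul him (h x t hx hx1 ht) (by positivity) (norm_nonneg _))
  rw [mul_left_comm]
  congr 1
  nth_rewrite 2 [← Real.rpow_one |t|]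
  rw [← Real.rpow_add ht0]
  norm_num

/-- The entire function `(1 - e^{-s}) / s`. -/
noncomputable def expQuot (s : ℂ) : ℂ := dslope (fun s : ℂ => -Complex.exp (-s)) 0 s

lemma differentiable_expQuot : Differentiable ℂ expQuot := by
  rw [← differentiableOn_univ]
  exact (Complex.differentiableOn_dslope univ_mem).mpr (by fun_prop)

lemma expQuot_zero : expQuot 0 = 1 := by
  rw [expQuot, dslope_same]
  have : HasDerivAt (fun s : ℂ => -Complex.exp (-s)) (-(Complex.exp (-0) * -1)) 0 :=
    ((hasDerivAt_id (0 : ℂ)).neg.cexp).neg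
  rw [this.deriv]
  simp

lemma expQuot_eq {s : ℂ} (hs : s ≠ 0) : expQuot s = (1 - Complex.exp (-s)) / s := by
  rw [expQuot, dslope_of_ne _ hs, slope_def_field]
  simp
  ring

/-- The function `(1 / s) ((s ζ(1 + s))^{-k} - (1 - e^{-s}) / s)`, extended to `s = 0`. -/
noncomputable def perronDiff (k : ℕ) (s : ℂ) : ℂ :=
  dslope (fun s => 1 / shiftedZeta s ^ k - expQuot s) 0 s

lemma perronDiff_eq (k : ℕ) {s : ℂ} (hs : s ≠ 0) :
    perronDiff k s = (1 / shiftedZeta s ^ k - expQuot s) / s := by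
  rw [perronDiff, dslope_of_ne _ hs, slope_def_field]
  simp [shiftedZeta_zero, expQuot_zero]

lemma continuousOn_perronDiff (k : ℕ) : ContinuousOn (perronDiff k) {s | shiftedZeta s ≠ 0} := by
  have ho : IsOpen {s | shiftedZeta s ≠ 0} :=
    isOpen_ne.preimage differentiable_shiftedZeta.continuous
  have h0 : {s | shiftedZeta s ≠ 0} ∈ nhds (0 : ℂ) :=
    ho.mem_nhds (by simp [shiftedZeta_zero])
  refine DifferentiableOn.continuousOn (𝕜 := ℂ) ((Complex.differentiableOn_dslope h0).mpr ?_)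
  refine DifferentiableOn.sub (DifferentiableOn.div (differentiableOn_const _)
    (differentiable_shiftedZeta.differentiableOn.pow k) fun s hs => pow_ne_zero _ hs)
    differentiable_expQuot.differentiableOn

lemma continuous_perronDiff_vertical (k : ℕ) {σ : ℝ} (hσ : 0 ≤ σ) :
    Continuous fun t : ℝ => perronDiff k (σ + Complex.I * t) :=
  (continuousOn_perronDiff k).comp_continuous (by fun_prop) fun t =>
    shiftedZeta_ne_zero (by simpa using hσ)

lemma norm_perronDiff_le (k : ℕ) (hk : 1 ≤ k) : ∃ C : ℝ, 0 < C ∧ ∀ x t : ℝ, 0 ≤ x → x ≤ 1 →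
    ‖perronDiff k (x + Complex.I * t)‖ ≤ C * (1 + |t|) ^ (-(3 / 2) : ℝ) := by
  obtain ⟨c, hc, h⟩ := shiftedZeta_lower
  have hcomp : IsCompact ((fun p : ℝ × ℝ => (p.1 + Complex.I * p.2 : ℂ)) ''
      (Set.Icc 0 1 ×ˢ Set.Icc (-1) 1)) :=
    (isCompact_Icc.prod isCompact_Icc).image (by fun_prop)
  obtain ⟨M, hM⟩ := hcomp.exists_bound_of_continuousOn (f := perronDiff k)
    ((continuousOn_perronDiff k).mono (by
      rintro _ ⟨p, hp, rfl⟩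
      exact shiftedZeta_ne_zero (by simpa using hp.1.1)))
  set D : ℝ := |M| + ((c ^ k)⁻¹ + 2) with hD
  have hDp : 0 < D := by positivity
  refine ⟨D * 2 ^ (3 / 2 : ℝ), by positivity, fun x t hx hx1 => ?_⟩
  rw [mul_assoc]
  rcases le_or_gt |t| 1 with ht | ht
  · have h1 : 1 ≤ (2 : ℝ) ^ (3 / 2 : ℝ) * (1 + |t|) ^ (-(3 / 2) : ℝ) := by
      rw [Real.rpow_neg (by positivity), ← div_eq_mul_inv, one_le_div (by positivity)]
      gcongr
      linarith
    refine (hM _ ⟨(x, t), ⟨⟨hx, hx1⟩, abs_le.mp ht⟩, rfl⟩).trans ?_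
    have h2 : M ≤ D := by
      have := le_abs_self M
      have : 0 < (c ^ k)⁻¹ := by positivity
      linarith
    nlinarith
  · have ht0 : 0 < |t| := by linarith
    have him : |t| ≤ ‖(x + Complex.I * t : ℂ)‖ := by
      simpa using Complex.abs_im_le_norm (x + Complex.I * t : ℂ)
    have hn : 0 < ‖(x + Complex.I * t : ℂ)‖ := ht0.trans_le him
    have hne : (x + Complex.I * t : ℂ) ≠ 0 := norm_pos_iff.mp hn
    have hA : ‖1 / shiftedZeta (x + Complex.I * t) ^ k‖ ≤ (c ^ k)⁻¹ * |t| ^ (-(1 / 2) : ℝ) := by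
      rw [norm_div, norm_one, norm_pow, one_div]
      have h1 := pow_le_pow_left₀ (by positivity) (h x t hx hx1 ht.le) k
      refine (inv_anti₀ (by positivity) h1).trans ?_
      rw [mul_pow, mul_inv, Real.rpow_neg ht0.le]
      have h2 : (1 : ℝ) ≤ |t| ^ (1 / 2 : ℝ) := Real.one_le_rpow ht.le (by norm_num)
      gcongr
      exact le_self_pow₀ h2 (by omega)
    have hE : ‖expQuot (x + Complex.I * t)‖ ≤ 2 * |t| ^ (-(1 / 2) : ℝ) := by
      rw [expQuot_eq hne, norm_div]
      have h1 : ‖1 - Complex.exp (-(x + Complex.I * t))‖ ≤ 2 := by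
        refine (norm_sub_le _ _).trans ?_
        rw [Complex.norm_exp, norm_one]
        simp only [Complex.neg_re, Complex.add_re, Complex.ofReal_re, Complex.mul_re, Complex.I_re,
          Complex.I_im, Complex.ofReal_im]
        have : Real.exp (-(x + (0 * t - 1 * 0))) ≤ 1 := Real.exp_le_one_iff.mpr (by linarith)
        linarith
      rw [div_eq_mul_inv]
      refine mul_le_mul h1 ?_ (by positivity) (by norm_num)
      refine (inv_anti₀ ht0 him).trans ?_
      rw [← Real.rpow_neg_one]
      exact Real.rpow_le_rpow_of_exponent_le ht.le (by norm_num)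
    rw [perronDiff_eq k hne, norm_div]
    have h3 : |t| ^ (-(3 / 2) : ℝ) ≤ (2 : ℝ) ^ (3 / 2 : ℝ) * (1 + |t|) ^ (-(3 / 2) : ℝ) := by
      rw [Real.rpow_neg (by positivity), Real.rpow_neg (by positivity), ← div_eq_mul_inv,
        inv_eq_one_div, div_le_div_iff₀ (by positivity) (by positivity), one_mul,
        ← Real.mul_rpow (by norm_num) ht0.le]
      gcongr
      linarith
    calc _ ≤ (((c ^ k)⁻¹ + 2) * |t| ^ (-(1 / 2) : ℝ)) / |t| := by
          gcongr
          refine (norm_sub_le _ _).trans ?_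
          linarith
      _ = ((c ^ k)⁻¹ + 2) * |t| ^ (-(3 / 2) : ℝ) := by
          rw [mul_div_assoc]
          congr 1
          nth_rewrite 2 [← Real.rpow_one |t|]
          rw [← Real.rpow_sub ht0]
          norm_num
      _ ≤ D * |t| ^ (-(3 / 2) : ℝ) := by
          gcongr
          have := abs_nonneg M
          linarith
      _ ≤ _ := by gcongr

lemma iterate_moebiusOp_of_lt_one {φ : ℝ → ℝ} (hφ : ∀ x < 1, φ x = 0) (j : ℕ) :
    ∀ x < 1, moebiusOp^[j] φ x = 0 := by
  cases j with
  | zero => simpa using hφ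
  | succ j =>
    intro x hx
    rw [Function.iterate_succ_apply']
    exact moebiusOp_of_lt_one _ hx

lemma logPow_of_lt_one (k : ℕ) : ∀ x < 1, logPow k x = 0 := fun x hx => by
  simp [logPow, not_le.mpr hx]

lemma perron_iterate {σ : ℝ} (hσ : 0 < σ) (k : ℕ) (hk : 1 ≤ k) (j : ℕ) :
    MeasureTheory.Integrable (fun t : ℝ => 1 / (σ + Complex.I * t : ℂ) ^ (k + 1) /
      riemannZeta (1 + (σ + Complex.I * t)) ^ j) ∧
    ∀ y : ℝ, ∫ t : ℝ, Complex.exp ((σ + Complex.I * t) * y) * (1 / (σ + Complex.I * t) ^ (k + 1) /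
      riemannZeta (1 + (σ + Complex.I * t)) ^ j) =
        2 * Real.pi * moebiusOp^[j] (logPow k) (Real.exp y) := by
  induction j with
  | zero =>
    simp only [pow_zero, div_one]
    exact ⟨integrable_inv_vertical_pow hσ k hk, perron_logPow hσ k hk⟩
  | succ j ih =>
    have := perron_moebiusOp hσ (iterate_moebiusOp_of_lt_one (logPow_of_lt_one k) j) ih.1 ih.2
    simp_rw [div_div _ _ (riemannZeta _), ← pow_succ] at this
    simpa only [Function.iterate_succ_apply', div_div] using this

lemma integral_perronDiff {σ : ℝ} (hσ : 0 < σ) (k : ℕ) (hk : 1 ≤ k) (y : ℝ) :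
    ∫ t : ℝ, Complex.exp ((σ + Complex.I * t) * y) * perronDiff k (σ + Complex.I * t) =
      2 * Real.pi * (moebiusOp^[k] (logPow k) (Real.exp y) -
        (logPow 1 (Real.exp y) - logPow 1 (Real.exp (y - 1))) : ℝ) := by
  obtain ⟨h1, h2⟩ := perron_iterate hσ k hk k
  have h3 := integrable_inv_vertical_pow hσ 1 le_rfl
  have hb : ∀ y : ℝ, ∀ G : ℝ → ℂ, MeasureTheory.Integrable G →
      MeasureTheory.Integrable fun t : ℝ => Complex.exp ((σ + Complex.I * t) * y) * G t :=
    fun y G hG => hG.bdd_mul (c := Real.exp (σ * y))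
      (Continuous.aestronglyMeasurable (by fun_prop))
      (Eventually.of_forall fun t => by simp [Complex.norm_exp])
  have h4 : MeasureTheory.Integrable fun t : ℝ =>
      Complex.exp ((σ + Complex.I * t) * y) * (1 / (σ + Complex.I * t) ^ (1 + 1)) -
        Complex.exp ((σ + Complex.I * t) * (y - 1 : ℝ)) * (1 / (σ + Complex.I * t) ^ (1 + 1)) :=
    (hb y _ h3).sub (hb (y - 1) _ h3)
  push_cast
  rw [mul_sub, mul_sub, ← h2 y, ← perron_logPow hσ 1 le_rfl y,
    ← perron_logPow hσ 1 le_rfl (y - 1), ← MeasureTheory.integral_sub (hb _ _ h3) (hb _ _ h3),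
    ← MeasureTheory.integral_sub (hb _ _ h1) h4]
  congr 1
  ext t
  have hs := vertical_ne_zero hσ t
  have hz : riemannZeta (1 + (σ + Complex.I * t)) ≠ 0 :=
    riemannZeta_ne_zero_of_one_le_re (by simp [hσ.le])
  rw [perronDiff_eq k hs, expQuot_eq hs, shiftedZeta_eq hs]
  push_cast
  rw [mul_sub _ (y : ℂ) 1, mul_one, sub_eq_add_neg _ (σ + Complex.I * t : ℂ), Complex.exp_add]
  generalize (σ + Complex.I * t : ℂ) = s at *
  field_simp
  ring

lemma integral_perronDiff_zero (k : ℕ) (hk : 1 ≤ k) (y : ℝ) :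
    ∫ t : ℝ, Complex.exp (Complex.I * t * y) * perronDiff k (Complex.I * t) =
      2 * Real.pi * (moebiusOp^[k] (logPow k) (Real.exp y) -
        (logPow 1 (Real.exp y) - logPow 1 (Real.exp (y - 1))) : ℝ) := by
  obtain ⟨C, hC, hB⟩ := norm_perronDiff_le k hk
  have hint : MeasureTheory.Integrable fun t : ℝ =>
      Real.exp |y| * (C * (1 + |t|) ^ (-(3 / 2) : ℝ)) := by
    have := integrable_one_add_norm (E := ℝ) (μ := MeasureTheory.volume) (r := 3 / 2)
      (by simp; norm_num)
    simpa using (this.const_mul C).const_mul (Real.exp |y|)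
  have hmem : Set.Ioo (0 : ℝ) 1 ∈ nhdsWithin (0 : ℝ) (Set.Ioi 0) := Ioo_mem_nhdsGT one_pos
  have hlim : Tendsto (fun σ : ℝ => ∫ t : ℝ, Complex.exp ((σ + Complex.I * t) * y) *
      perronDiff k (σ + Complex.I * t)) (nhdsWithin 0 (Set.Ioi 0))
      (nhds (∫ t : ℝ, Complex.exp (Complex.I * t * y) * perronDiff k (Complex.I * t))) := by
    refine MeasureTheory.tendsto_integral_filter_of_dominated_convergence _ ?_ ?_ hint ?_
    · filter_upwards [hmem] with σ hσ
      exact (Continuous.mul (by fun_prop)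
        (continuous_perronDiff_vertical k hσ.1.le)).aestronglyMeasurable
    · filter_upwards [hmem] with σ hσ
      refine Eventually.of_forall fun t => ?_
      rw [norm_mul]
      refine mul_le_mul ?_ (hB σ t hσ.1.le hσ.2.le) (norm_nonneg _) (Real.exp_nonneg _)
      rw [Complex.norm_exp]
      simp only [Complex.mul_re, Complex.add_re, Complex.ofReal_re, Complex.I_re, Complex.I_im,
        Complex.ofReal_im]
      refine Real.exp_le_exp.mpr ?_
      have := neg_abs_le y
      have := le_abs_self y
      have := abs_nonneg y
      obtain ⟨h1, h2⟩ := hσ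
      nlinarith
    · refine Eventually.of_forall fun t => ?_
      have hopen : {s | shiftedZeta s ≠ 0} ∈ nhds (Complex.I * t : ℂ) :=
        (isOpen_ne.preimage differentiable_shiftedZeta.continuous).mem_nhds
          (shiftedZeta_ne_zero (by simp))
      have hc := (continuousOn_perronDiff k).continuousAt hopen
      have hl : Tendsto (fun σ : ℝ => (σ + Complex.I * t : ℂ)) (nhdsWithin 0 (Set.Ioi 0))
          (nhds (Complex.I * t)) := by
        have : Continuous fun σ : ℝ => (σ + Complex.I * t : ℂ) := by fun_prop
        simpa using (this.tendsto 0).mono_left nhdsWithin_le_nhds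
      exact ((hl.mul_const _).cexp).mul (hc.tendsto.comp hl)
  refine tendsto_nhds_unique (hlim.congr' ?_) tendsto_const_nhds
  filter_upwards [self_mem_nhdsWithin] with σ hσ
  exact integral_perronDiff hσ k hk y

lemma logPow_one_sub {y : ℝ} (hy : 1 ≤ y) :
    logPow 1 (Real.exp y) - logPow 1 (Real.exp (y - 1)) = 1 := by
  rw [logPow_exp, logPow_exp, if_pos (by linarith), if_pos (by linarith)]
  simp

lemma logPow_one_sub_bound (y : ℝ) :
    |logPow 1 (Real.exp y) - logPow 1 (Real.exp (y - 1))| ≤ 1 := by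
  rw [logPow_exp, logPow_exp, abs_le]
  split_ifs <;> constructor <;> simp <;> linarith

/-- The function `logPow k` smoothed by `k` applications of `moebiusOp`. -/
noncomputable def mollified (k : ℕ) : ℝ → ℝ := moebiusOp^[k] (logPow k)

lemma mollified_of_lt_one (k : ℕ) : ∀ x < 1, mollified k x = 0 :=
  iterate_moebiusOp_of_lt_one (logPow_of_lt_one k) k

lemma mollified_zero_of_one_le {x : ℝ} (hx : 1 ≤ x) : mollified 0 x = 1 := by
  simp [mollified, logPow, hx]

lemma abs_mollified_le (k : ℕ) : ∃ C : ℝ, 0 < C ∧ ∀ x, |mollified k x| ≤ C := by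
  rcases Nat.eq_zero_or_pos k with rfl | hk
  · refine ⟨1, one_pos, fun x => ?_⟩
    rcases lt_or_ge x 1 with hx | hx
    · simp [mollified_of_lt_one 0 x hx]
    · simp [mollified_zero_of_one_le hx]
  obtain ⟨C, hC, hB⟩ := norm_perronDiff_le k hk
  set J : ℝ := ∫ t : ℝ, ‖perronDiff k (Complex.I * t)‖ with hJ
  have hJ0 : 0 ≤ J := MeasureTheory.integral_nonneg fun t => norm_nonneg _
  refine ⟨J + 1, by positivity, fun x => ?_⟩
  rcases lt_or_ge x 1 with hx | hx
  · rw [mollified_of_lt_one k x hx, abs_zero]; positivity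
  have hx0 : 0 < x := by linarith
  have h := integral_perronDiff_zero k hk (Real.log x)
  rw [Real.exp_log hx0] at h
  have h1 := logPow_one_sub_bound (Real.log x)
  rw [Real.exp_log hx0] at h1
  set q := logPow 1 x - logPow 1 (Real.exp (Real.log x - 1)) with hq
  have h2 : ‖(2 * Real.pi * (moebiusOp^[k] (logPow k) x - q : ℝ) : ℂ)‖ ≤ J := by
    rw [← h]
    refine (MeasureTheory.norm_integral_le_integral_norm _).trans_eq ?_
    simp [Complex.norm_exp, hJ]
  have h3 : ‖(2 * Real.pi * (moebiusOp^[k] (logPow k) x - q : ℝ) : ℂ)‖ =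
      2 * Real.pi * |mollified k x - q| := by
    rw [norm_mul, Complex.norm_real, Real.norm_eq_abs]
    simp [mollified, abs_of_pos Real.pi_pos]
  rw [h3] at h2
  have h4 : |mollified k x - q| ≤ J := by
    have := Real.pi_gt_three
    nlinarith [abs_nonneg (mollified k x - q)]
  have := abs_sub_abs_le_abs_sub (mollified k x) q
  linarith

lemma tendsto_mollified (k : ℕ) : Tendsto (mollified k) atTop (nhds 1) := by
  rcases Nat.eq_zero_or_pos k with rfl | hk
  · refine tendsto_const_nhds.congr' ?_
    filter_upwards [eventually_ge_atTop 1] with x hx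
    rw [mollified_zero_of_one_le hx]
  have hRL := Real.tendsto_integral_exp_smul_cocompact
    (fun t : ℝ => perronDiff k (Complex.I * t))
  have hw : Tendsto (fun x : ℝ => -(Real.log x / (2 * Real.pi))) atTop (cocompact ℝ) :=
    (tendsto_neg_atTop_atBot.comp
      (Real.tendsto_log_atTop.atTop_div_const (by positivity))).mono_right atBot_le_cocompact
  have h1 := hRL.comp hw
  have hπ : (Real.pi : ℂ) ≠ 0 := by exact_mod_cast Real.pi_ne_zero
  have h2 : ∀ᶠ x : ℝ in atTop, ∫ v : ℝ, Real.fourierChar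
      (-(v * -(Real.log x / (2 * Real.pi)))) • perronDiff k (Complex.I * v) =
        2 * Real.pi * (mollified k x - 1 : ℝ) := by
    filter_upwards [eventually_ge_atTop (Real.exp 1)] with x hx
    have hx0 : 0 < x := (Real.exp_pos 1).trans_le hx
    have h := integral_perronDiff_zero k hk (Real.log x)
    rw [logPow_one_sub ((Real.le_log_iff_exp_le hx0).mpr hx), Real.exp_log hx0] at h
    rw [mollified, ← h]
    congr 1
    ext t
    rw [Circle.smul_def, Real.fourierChar_apply, smul_eq_mul]
    congr 2
    push_cast
    field_simp
  have h3 := (h1.congr' h2).norm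
  have h4 : Tendsto (fun x => mollified k x - 1) atTop (nhds 0) := by
    rw [tendsto_zero_iff_abs_tendsto_zero]
    have h5 := h3.const_mul (1 / (2 * Real.pi))
    simp only [norm_zero, mul_zero] at h5
    refine h5.congr fun x => ?_
    rw [norm_mul, Complex.norm_real, Real.norm_eq_abs]
    simp [abs_of_pos Real.pi_pos]
    have := Real.pi_ne_zero
    field_simp
  simpa using h4.add_const 1

lemma sum_Ico_sub_succ (f : ℕ → ℝ) {m n : ℕ} (hmn : m ≤ n) :
    ∑ i ∈ Finset.Ico m n, (f i - f (i + 1)) = f m - f n := by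
  induction n, hmn using Nat.le_induction with
  | base => simp
  | succ n hmn ih =>
    rw [Finset.sum_Ico_succ_top hmn, ih]
    ring


/-- The operator `φ ↦ (x ↦ ∑ φ(x/n)/n)`. -/
noncomputable def divOp (φ : ℝ → ℝ) (x : ℝ) : ℝ :=
  ∑ n ∈ Finset.Icc 1 ⌊x⌋₊, (1 : ℝ) / n * φ (x / n)

lemma divOp_of_lt_one (φ : ℝ → ℝ) {x : ℝ} (hx : x < 1) : divOp φ x = 0 := by
  simp [divOp, Nat.floor_eq_zero.mpr hx]

lemma sum_one_div_le (N : ℕ) {R : ℝ} (hR : 1 ≤ R) (hN : (N : ℝ) ≤ R) :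
    ∑ n ∈ Finset.Icc 1 N, (1 : ℝ) / n ≤ 1 + Real.log R := by
  rcases Nat.eq_zero_or_pos N with rfl | hN0
  · simpa using by linarith [Real.log_nonneg hR]
  have h := harmonic_le_one_add_log N
  rw [harmonic_eq_sum_Icc] at h
  push_cast at h
  simp_rw [one_div]
  refine h.trans ?_
  have : (0 : ℝ) < N := by exact_mod_cast hN0
  gcongr

lemma pow_succ_sub_le {a b : ℝ} (hb : 0 ≤ b) (hab : b ≤ a) (j : ℕ) :
    a ^ (j + 1) - b ^ (j + 1) ≤ (j + 1) * a ^ j * (a - b) := by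
  induction j with
  | zero => simp
  | succ j ih =>
    have h1 : b ^ (j + 1) ≤ a ^ (j + 1) := pow_le_pow_left₀ hb hab _
    have ha : 0 ≤ a := hb.trans hab
    have h2 := mul_le_mul_of_nonneg_left ih ha
    have h3 := mul_le_mul_of_nonneg_right h1 (sub_nonneg.mpr hab)
    push_cast
    calc a ^ (j + 1 + 1) - b ^ (j + 1 + 1)
        = a * (a ^ (j + 1) - b ^ (j + 1)) + b ^ (j + 1) * (a - b) := by ring
      _ ≤ a * ((j + 1) * a ^ j * (a - b)) + a ^ (j + 1) * (a - b) := add_le_add h2 h3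
      _ = _ := by ring

lemma le_pow_succ_sub {a b : ℝ} (hb : 0 ≤ b) (hab : b ≤ a) (j : ℕ) :
    (j + 1) * b ^ j * (a - b) ≤ a ^ (j + 1) - b ^ (j + 1) := by
  induction j with
  | zero => simp
  | succ j ih =>
    have h1 : b ^ (j + 1) ≤ a ^ (j + 1) := pow_le_pow_left₀ hb hab _
    have h2 := mul_le_mul_of_nonneg_left ih hb
    have h3 := mul_le_mul_of_nonneg_right h1 (sub_nonneg.mpr hab)
    push_cast
    calc (j + 1 + 1) * b ^ (j + 1) * (a - b)
        = b * ((j + 1) * b ^ j * (a - b)) + b ^ (j + 1) * (a - b) := by ring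
      _ ≤ b * (a ^ (j + 1) - b ^ (j + 1)) + a ^ (j + 1) * (a - b) := add_le_add h2 h3
      _ = _ := by ring

lemma log_div_sub_log_div {x : ℝ} (hx : 0 < x) {n : ℕ} (hn : 1 ≤ n) :
    (1 : ℝ) / (n + 1 : ℕ) ≤ Real.log (x / n) - Real.log (x / (n + 1 : ℕ)) ∧
      Real.log (x / n) - Real.log (x / (n + 1 : ℕ)) ≤ 1 / n := by
  have hn0 : (0 : ℝ) < n := by exact_mod_cast hn
  have hn1 : (0 : ℝ) < (n + 1 : ℕ) := by positivity
  rw [Real.log_div hx.ne' hn0.ne', Real.log_div hx.ne' hn1.ne', sub_sub_sub_cancel_left,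
    ← Real.log_div hn1.ne' hn0.ne']
  constructor
  · have := Real.one_sub_inv_le_log_of_pos (div_pos hn1 hn0)
    refine le_trans (le_of_eq ?_) this
    push_cast
    field_simp
    ring
  · refine (Real.log_le_sub_one_of_pos (div_pos hn1 hn0)).trans (le_of_eq ?_)
    push_cast
    field_simp
    ring

lemma sum_log_pow_ge (j : ℕ) {x : ℝ} (hx : 1 ≤ x) :
    Real.log x ^ (j + 1) ≤
      (j + 1) * ∑ n ∈ Finset.Icc 1 ⌊x⌋₊, (1 : ℝ) / n * Real.log (x / n) ^ j := by
  have hx0 : 0 < x := by linarith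
  set L : ℕ → ℝ := fun n => max (Real.log (x / n)) 0 with hL
  have hstep : ∀ n ∈ Finset.Ico 1 (⌊x⌋₊ + 1), L n ^ (j + 1) - L (n + 1) ^ (j + 1) ≤
      (j + 1) * (1 / n * Real.log (x / n) ^ j) := by
    intro n hn
    obtain ⟨h1, h2⟩ := Finset.mem_Ico.mp hn
    have hn0 : (0 : ℝ) < n := by exact_mod_cast h1
    have hle : (n : ℝ) ≤ x := (Nat.le_floor_iff hx0.le).mp (by omega)
    have ha : 0 ≤ Real.log (x / n) := Real.log_nonneg ((one_le_div hn0).mpr hle)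
    obtain ⟨h3, h4⟩ := log_div_sub_log_div hx0 h1
    have hLn : L n = Real.log (x / n) := max_eq_left ha
    have hab : L (n + 1) ≤ L n := by
      rw [hLn]
      refine max_le ?_ ha
      have : (0 : ℝ) < 1 / (n + 1 : ℕ) := by positivity
      linarith
    refine (pow_succ_sub_le (le_max_right _ _) hab j).trans ?_
    have h5 : L n - L (n + 1) ≤ 1 / n := by
      have := le_max_left (Real.log (x / (n + 1 : ℕ))) 0
      rw [hLn]
      simp only [hL]
      linarith
    rw [hLn] at h5 ⊢
    rw [mul_assoc, mul_comm (1 / (n : ℝ))]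
    gcongr
  have hsum := Finset.sum_le_sum hstep
  rw [sum_Ico_sub_succ (fun n => L n ^ (j + 1)) (by omega), ← Finset.mul_sum] at hsum
  have h0 : L (⌊x⌋₊ + 1) = 0 := by
    refine max_eq_right (Real.log_nonpos (by positivity) ?_)
    rw [div_le_one (by positivity)]
    exact_mod_cast (Nat.lt_floor_add_one x).le
  have h1 : L 1 = Real.log x := by
    simp [hL, Real.log_nonneg hx]
  rw [h0, h1] at hsum
  simpa using! hsum

lemma sum_log_pow_le (j : ℕ) {x : ℝ} (hx : 1 ≤ x) :
    (j + 1) * ∑ n ∈ Finset.Icc 1 ⌊x⌋₊, (1 : ℝ) / n * Real.log (x / n) ^ j ≤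
      Real.log x ^ (j + 1) + (j + 1) * Real.log x ^ j := by
  have hx0 : 0 < x := by linarith
  have hN : 1 ≤ ⌊x⌋₊ := Nat.le_floor (by simpa using hx)
  have hstep : ∀ n ∈ Finset.Ico 1 ⌊x⌋₊,
      (j + 1) * (1 / (n + 1 : ℕ) * Real.log (x / (n + 1 : ℕ)) ^ j) ≤
      Real.log (x / n) ^ (j + 1) - Real.log (x / (n + 1 : ℕ)) ^ (j + 1) := by
    intro n hn
    obtain ⟨h1, h2⟩ := Finset.mem_Ico.mp hn
    have hle : ((n + 1 : ℕ) : ℝ) ≤ x := (Nat.le_floor_iff hx0.le).mp (by omega)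
    have hb : 0 ≤ Real.log (x / (n + 1 : ℕ)) :=
      Real.log_nonneg ((one_le_div (by positivity)).mpr hle)
    obtain ⟨h3, h4⟩ := log_div_sub_log_div hx0 h1
    have hp : (0 : ℝ) < 1 / (n + 1 : ℕ) := by positivity
    refine le_trans ?_ (le_pow_succ_sub hb (by linarith) j)
    rw [mul_assoc, mul_comm (1 / ((n + 1 : ℕ) : ℝ))]
    gcongr
  have hsum := Finset.sum_le_sum hstep
  rw [sum_Ico_sub_succ (fun n : ℕ => Real.log (x / n) ^ (j + 1)) hN, ← Finset.mul_sum,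
    Finset.sum_Ico_add' (fun n : ℕ => (1 : ℝ) / n * Real.log (x / n) ^ j) 1 ⌊x⌋₊ 1] at hsum
  have hsplit : Finset.Icc 1 ⌊x⌋₊ = insert 1 (Finset.Ico (1 + 1) (⌊x⌋₊ + 1)) := by
    ext n
    simp only [Finset.mem_Icc, Finset.mem_insert, Finset.mem_Ico]
    omega
  rw [hsplit, Finset.sum_insert (by simp), mul_add]
  have hlast : 0 ≤ Real.log (x / ⌊x⌋₊) ^ (j + 1) :=
    pow_nonneg (Real.log_nonneg ((one_le_div (by positivity)).mpr (Nat.floor_le hx0.le))) _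
  simp only [Nat.cast_one, div_one, one_mul] at hsum ⊢
  linarith

/-- `φ` is supported on `[1, ∞)`, is `O(log^j)` and asymptotic to `w log^j / j!`. -/
structure LogAsymp (φ : ℝ → ℝ) (j : ℕ) (w : ℝ) : Prop where
  support : ∀ x < 1, φ x = 0
  bound : ∃ C : ℝ, 0 ≤ C ∧ ∀ R : ℝ, 1 ≤ R → ∀ x ≤ R, |φ x| ≤ C * (1 + Real.log R) ^ j
  limit : Tendsto (fun x => φ x / Real.log x ^ j) atTop (nhds (w / j.factorial))

lemma abs_divOp_le {φ : ℝ → ℝ} {B R : ℝ} (hR : 1 ≤ R) (hB : 0 ≤ B) (h : ∀ x ≤ R, |φ x| ≤ B)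
    {x : ℝ} (hx : x ≤ R) : |divOp φ x| ≤ B * (1 + Real.log R) := by
  rcases lt_or_ge x 1 with h1 | h1
  · rw [divOp_of_lt_one _ h1, abs_zero]
    have := Real.log_nonneg hR
    positivity
  have hx0 : 0 < x := by linarith
  refine (Finset.abs_sum_le_sum_abs _ _).trans ?_
  refine le_trans ?_ (mul_le_mul_of_nonneg_left
    (sum_one_div_le ⌊x⌋₊ hR ((Nat.floor_le hx0.le).trans hx)) hB)
  rw [Finset.mul_sum]
  refine Finset.sum_le_sum fun n hn => ?_
  have hn1 : (1 : ℝ) ≤ n := by exact_mod_cast (Finset.mem_Icc.mp hn).1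
  rw [abs_mul, abs_of_nonneg (by positivity : (0 : ℝ) ≤ 1 / n), mul_comm]
  gcongr
  exact h _ ((div_le_self hx0.le hn1).trans hx)

lemma LogAsymp.divOp {φ : ℝ → ℝ} {j : ℕ} {w : ℝ} (h : LogAsymp φ j w) :
    LogAsymp (divOp φ) (j + 1) w := by
  obtain ⟨C, hC, hbd⟩ := h.bound
  refine ⟨fun x hx => divOp_of_lt_one φ hx, ⟨C, hC, fun R hR x hx => ?_⟩, ?_⟩
  · have hl := Real.log_nonneg hR
    rw [pow_succ, ← mul_assoc]
    exact abs_divOp_le hR (by positivity) (hbd R hR) hx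
  have hjf : (0 : ℝ) < j.factorial := by positivity
  set w' := w / j.factorial with hw'
  have hmain : ∀ ε > 0, ∀ᶠ x in atTop,
      |_root_.divOp φ x - w' * ∑ n ∈ Finset.Icc 1 ⌊x⌋₊, (1 : ℝ) / n * Real.log (x / n) ^ j| ≤
        ε * Real.log x ^ (j + 1) := by
    intro ε hε
    have hlim := (Metric.tendsto_nhds.mp h.limit (ε / 4) (by positivity)).and
      (eventually_gt_atTop (Real.exp 1))
    obtain ⟨T, hT⟩ := eventually_atTop.mp hlim
    have hT1 : 1 ≤ T := (Real.one_le_exp zero_le_one).trans (hT T le_rfl).2.le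
    have hTl := Real.log_nonneg hT1
    set B := C * (1 + Real.log T) ^ j + |w'| * Real.log T ^ j with hB
    have hB0 : 0 ≤ B := by positivity
    have hpt : ∀ y : ℝ, 1 ≤ y → |φ y - w' * Real.log y ^ j| ≤
        ε / 4 * Real.log y ^ j + if y < T then B else 0 := by
      intro y hy
      have hly := Real.log_nonneg hy
      split_ifs with hyT
      · have h1 := hbd T hT1 y hyT.le
        have h2 : |w' * Real.log y ^ j| ≤ |w'| * Real.log T ^ j := by
          rw [abs_mul, abs_of_nonneg (pow_nonneg hly j)]
          gcongr
        have h3 := abs_sub (φ y) (w' * Real.log y ^ j)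
        have : 0 ≤ ε / 4 * Real.log y ^ j := by positivity
        linarith
      · have h4 := hT y (not_lt.mp hyT)
        have hlp : 0 < Real.log y ^ j := pow_pos (Real.log_pos (lt_trans (by
          simp) h4.2)) j
        have h5 := h4.1
        rw [Real.dist_eq] at h5
        rw [add_zero]
        have h6 : φ y - w' * Real.log y ^ j = (φ y / Real.log y ^ j - w') * Real.log y ^ j := by
          field_simp
        rw [h6, abs_mul, abs_of_pos hlp]
        gcongr
    filter_upwards [eventually_ge_atTop (Real.exp 1),
      (Real.tendsto_log_atTop).eventually_ge_atTop (max 1 (2 * (B * T) / ε))] with x hx hlx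
    have hx1 : 1 ≤ x := (Real.one_le_exp zero_le_one).trans hx
    have hx0 : 0 < x := by linarith
    have hl1 : 1 ≤ Real.log x := (le_max_left _ _).trans hlx
    have hl2 : 2 * (B * T) / ε ≤ Real.log x := (le_max_right _ _).trans hlx
    rw [_root_.divOp, Finset.mul_sum, ← Finset.sum_sub_distrib]
    refine (Finset.abs_sum_le_sum_abs _ _).trans ?_
    have hterm : ∀ n ∈ Finset.Icc 1 ⌊x⌋₊,
        |1 / (n : ℝ) * φ (x / n) - w' * (1 / n * Real.log (x / n) ^ j)| ≤
        ε / 4 * (Real.log x ^ j * (1 / n)) + B * T / x := by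
      intro n hn
      obtain ⟨h1, h2⟩ := Finset.mem_Icc.mp hn
      have hn1 : (1 : ℝ) ≤ n := by exact_mod_cast h1
      have hn0 : (0 : ℝ) < n := by linarith
      have hnx : (n : ℝ) ≤ x := (Nat.le_floor_iff hx0.le).mp h2
      have h3 := hpt (x / n) ((one_le_div hn0).mpr hnx)
      have h4 : 1 / (n : ℝ) * φ (x / n) - w' * (1 / n * Real.log (x / n) ^ j) =
        1 / n * (φ (x / n) - w' * Real.log (x / n) ^ j) := by ring
      rw [h4, abs_mul, abs_of_pos (by positivity : (0 : ℝ) < 1 / n)]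
      have h5 : Real.log (x / n) ^ j ≤ Real.log x ^ j := by
        have := Real.log_nonneg ((one_le_div hn0).mpr hnx)
        have := div_le_self hx0.le hn1
        gcongr
      have h6 : 1 / (n : ℝ) * (if x / n < T then B else 0) ≤ B * T / x := by
        split_ifs with hlt
        · rw [div_lt_iff₀ hn0] at hlt
          rw [one_div_mul_eq_div, div_le_div_iff₀ hn0 hx0]
          nlinarith
        · simp only [mul_zero]; positivity
      calc _ ≤ 1 / (n : ℝ) * (ε / 4 * Real.log (x / n) ^ j + if x / n < T then B else 0) := by
            gcongr
        _ = ε / 4 * (Real.log (x / n) ^ j * (1 / n)) +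
            1 / (n : ℝ) * (if x / n < T then B else 0) := by ring
        _ ≤ _ := by gcongr
    refine (Finset.sum_le_sum hterm).trans ?_
    rw [Finset.sum_add_distrib, ← Finset.mul_sum, ← Finset.mul_sum, Finset.sum_const,
      Nat.card_Icc, nsmul_eq_mul, Nat.add_sub_cancel]
    have h7 := sum_one_div_le ⌊x⌋₊ hx1 (Nat.floor_le hx0.le)
    have h8 : (⌊x⌋₊ : ℝ) * (B * T / x) ≤ B * T := by
      rw [mul_div_assoc', div_le_iff₀ hx0, mul_comm]
      gcongr
      exact Nat.floor_le hx0.le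
    have h9 : Real.log x ^ j * ∑ n ∈ Finset.Icc 1 ⌊x⌋₊, (1 : ℝ) / n ≤
        2 * Real.log x ^ (j + 1) := by
      rw [pow_succ]
      have : 0 ≤ Real.log x ^ j := by positivity
      nlinarith
    have h10 : B * T ≤ ε / 2 * Real.log x ^ (j + 1) := by
      rw [div_le_iff₀ hε] at hl2
      have : Real.log x ≤ Real.log x ^ (j + 1) := le_self_pow₀ hl1 (by omega)
      nlinarith
    nlinarith
  have hlogpos : ∀ᶠ x : ℝ in atTop, 0 < Real.log x := Real.tendsto_log_atTop.eventually_gt_atTop 0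
  have hS : Tendsto (fun x => (∑ n ∈ Finset.Icc 1 ⌊x⌋₊, (1 : ℝ) / n * Real.log (x / n) ^ j) /
      Real.log x ^ (j + 1)) atTop (nhds (1 / (j + 1))) := by
    have hup : Tendsto (fun x : ℝ => 1 / ((j : ℝ) + 1) + (Real.log x)⁻¹) atTop
        (nhds (1 / (j + 1))) := by
      simpa using (tendsto_inv_atTop_zero.comp Real.tendsto_log_atTop).const_add (1 / ((j : ℝ) + 1))
    refine tendsto_of_tendsto_of_tendsto_of_le_of_le' tendsto_const_nhds hup ?_ ?_
    · filter_upwards [hlogpos, eventually_ge_atTop 1] with x hl hx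
      have := sum_log_pow_ge j hx
      rw [div_le_div_iff₀ (by positivity) (by positivity), one_mul, mul_comm]
      linarith
    · filter_upwards [hlogpos, eventually_ge_atTop 1] with x hl hx
      have h1 := sum_log_pow_le j hx
      rw [div_le_iff₀ (by positivity)]
      have h2 : (1 / ((j : ℝ) + 1) + (Real.log x)⁻¹) * Real.log x ^ (j + 1) =
        (Real.log x ^ (j + 1) + (j + 1) * Real.log x ^ j) / (j + 1) := by
        field_simp
        ring
      rw [h2, le_div_iff₀ (by positivity)]
      linarith
  have hdiff : Tendsto (fun x => (_root_.divOp φ x -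
      w' * ∑ n ∈ Finset.Icc 1 ⌊x⌋₊, (1 : ℝ) / n * Real.log (x / n) ^ j) /
        Real.log x ^ (j + 1)) atTop (nhds 0) := by
    rw [Metric.tendsto_nhds]
    intro ε hε
    filter_upwards [hmain (ε / 2) (by positivity), hlogpos] with x hx hl
    rw [Real.dist_eq, sub_zero, abs_div, abs_of_pos (pow_pos hl (j + 1)),
      div_lt_iff₀ (by positivity)]
    have : 0 < Real.log x ^ (j + 1) := by positivity
    nlinarith
  have hfin := hdiff.add (hS.const_mul w')
  have e : w / ((j + 1).factorial : ℝ) = 0 + w' * (1 / (j + 1)) := by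
    rw [hw', Nat.factorial_succ]
    push_cast
    field_simp
    simp
  rw [e]
  refine hfin.congr fun x => ?_
  ring

lemma logAsymp_mollified (k : ℕ) : LogAsymp (mollified k) 0 1 := by
  obtain ⟨C, hC, h⟩ := abs_mollified_le k
  refine ⟨mollified_of_lt_one k, ⟨C, hC.le, fun R _ x _ => by simpa using h x⟩, ?_⟩
  simpa using tendsto_mollified k

lemma logAsymp_iterate_divOp {φ : ℝ → ℝ} {j : ℕ} {w : ℝ} (h : LogAsymp φ j w) (l : ℕ) :
    LogAsymp (divOp^[l] φ) (j + l) w := by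
  induction l with
  | zero => simpa using h
  | succ l ih =>
    rw [Function.iterate_succ_apply']
    exact ih.divOp

/-- The algebra of formal combinations of pairs of dilations. -/
abbrev DilAlg := MonoidAlgebra ℝ (ℕ × ℕ)

namespace DilAlg

/-- The sum of the absolute values of the coefficients. -/
noncomputable def norm₁ (a : DilAlg) : ℝ := a.coeff.sum fun _ c => |c|

lemma norm₁_nonneg (a : DilAlg) : 0 ≤ norm₁ a := Finset.sum_nonneg fun _ _ => abs_nonneg _

lemma norm₁_single (p : ℕ × ℕ) (c : ℝ) : norm₁ (MonoidAlgebra.single p c) = |c| := by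
  simp [norm₁]

lemma norm₁_zero : norm₁ 0 = 0 := by simp [norm₁]

lemma norm₁_one : norm₁ 1 = 1 := by
  rw [MonoidAlgebra.one_def, norm₁_single, abs_one]

lemma norm₁_add_le (a b : DilAlg) : norm₁ (a + b) ≤ norm₁ a + norm₁ b := by
  classical
  have h : ∀ c : DilAlg, c.coeff.support ⊆ a.coeff.support ∪ b.coeff.support →
      norm₁ c = ∑ p ∈ a.coeff.support ∪ b.coeff.support, |c.coeff p| := fun c hc =>
    Finsupp.sum_of_support_subset _ hc _ (by simp)
  rw [h a Finset.subset_union_left, h b Finset.subset_union_right,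
    h (a + b) (by rw [MonoidAlgebra.coeff_add]; exact Finsupp.support_add),
    ← Finset.sum_add_distrib]
  refine Finset.sum_le_sum fun p _ => ?_
  rw [MonoidAlgebra.coeff_add, Finsupp.add_apply]
  exact abs_add_le _ _

lemma norm₁_sum_le {ι : Type*} (s : Finset ι) (f : ι → DilAlg) :
    norm₁ (∑ i ∈ s, f i) ≤ ∑ i ∈ s, norm₁ (f i) :=
  Finset.le_sum_of_subadditive norm₁ norm₁_zero.le norm₁_add_le s f

lemma norm₁_mul_le (a b : DilAlg) : norm₁ (a * b) ≤ norm₁ a * norm₁ b := by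
  rw [MonoidAlgebra.mul_def]
  refine (norm₁_sum_le _ _).trans ?_
  rw [norm₁, norm₁, Finsupp.sum, Finsupp.sum, Finset.sum_mul_sum]
  refine Finset.sum_le_sum fun p _ => (norm₁_sum_le _ _).trans_eq ?_
  exact Finset.sum_congr rfl fun q _ => by rw [norm₁_single, abs_mul]

lemma norm₁_prod_le {ι : Type*} (s : Finset ι) (f : ι → DilAlg) :
    norm₁ (∏ i ∈ s, f i) ≤ ∏ i ∈ s, norm₁ (f i) := by
  classical
  induction s using Finset.induction_on with
  | empty => simp [norm₁_one]
  | insert i s hi ih =>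
    rw [Finset.prod_insert hi, Finset.prod_insert hi]
    exact (norm₁_mul_le _ _).trans (mul_le_mul_of_nonneg_left ih (norm₁_nonneg _))

/-- The augmentation: the sum of the coefficients. -/
noncomputable def aug : DilAlg →ₐ[ℝ] ℝ := MonoidAlgebra.lift ℝ ℝ (ℕ × ℕ) 1

lemma aug_single (p : ℕ × ℕ) (c : ℝ) : aug (MonoidAlgebra.single p c) = c := by
  simp [aug]

lemma aug_eq (a : DilAlg) : aug a = a.coeff.sum fun _ c => c := by
  simp [aug, MonoidAlgebra.lift_apply]

lemma abs_aug_le (a : DilAlg) : |aug a| ≤ norm₁ a := by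
  rw [aug_eq]
  exact Finset.abs_sum_le_sum_abs _ _

/-- A pair of integers acts on functions of two variables by dilating both variables. -/
noncomputable def dilation : ℕ × ℕ →* Module.End ℝ (ℝ → ℝ → ℝ) where
  toFun p :=
    { toFun := fun Φ X Y => Φ (X / p.1) (Y / p.2)
      map_add' := fun _ _ => rfl
      map_smul' := fun _ _ => rfl }
  map_one' := by
    ext Φ X Y
    simp
  map_mul' p q := by
    ext Φ X Y
    simp [div_div]

/-- The action of `DilAlg` on functions of two variables. -/
noncomputable def act : DilAlg →ₐ[ℝ] Module.End ℝ (ℝ → ℝ → ℝ) :=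
  MonoidAlgebra.lift ℝ _ (ℕ × ℕ) dilation

lemma act_apply (a : DilAlg) (Φ : ℝ → ℝ → ℝ) (X Y : ℝ) :
    act a Φ X Y = a.coeff.sum fun p c => c * Φ (X / p.1) (Y / p.2) := by
  rw [act, MonoidAlgebra.lift_apply, Finsupp.sum, Finsupp.sum, LinearMap.sum_apply,
    Finset.sum_apply, Finset.sum_apply]
  rfl

lemma act_single (p : ℕ × ℕ) (c : ℝ) (Φ : ℝ → ℝ → ℝ) (X Y : ℝ) :
    act (MonoidAlgebra.single p c) Φ X Y = c * Φ (X / p.1) (Y / p.2) := by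
  rw [act_apply]
  simp

lemma abs_act_le (a : DilAlg) (Φ : ℝ → ℝ → ℝ) (X Y B : ℝ)
    (h : ∀ p ∈ a.coeff.support, |Φ (X / p.1) (Y / p.2)| ≤ B) :
    |act a Φ X Y| ≤ norm₁ a * B := by
  rw [act_apply, norm₁, Finsupp.sum, Finsupp.sum, Finset.sum_mul]
  refine (Finset.abs_sum_le_sum_abs _ _).trans (Finset.sum_le_sum fun p hp => ?_)
  rw [abs_mul]
  exact mul_le_mul_of_nonneg_left (h p hp) (abs_nonneg _)

/-- `Φ` vanishes unless both variables are at least one. -/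
def Supported (Φ : ℝ → ℝ → ℝ) : Prop := ∀ X Y, X < 1 ∨ Y < 1 → Φ X Y = 0

lemma div_lt_one_of_lt {X : ℝ} (h : X < 1) (d : ℕ) : X / d < 1 := by
  rcases Nat.eq_zero_or_pos d with rfl | hd
  · simp
  · have : (1 : ℝ) ≤ d := by exact_mod_cast hd
    rw [div_lt_one (by linarith)]
    linarith

lemma Supported.act {Φ : ℝ → ℝ → ℝ} (h : Supported Φ) (a : DilAlg) :
    Supported (DilAlg.act a Φ) := by
  intro X Y hXY
  rw [act_apply]
  refine Finset.sum_eq_zero fun p _ => ?_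
  simp only
  rw [h, mul_zero]
  exact hXY.imp (fun h => div_lt_one_of_lt h _) (fun h => div_lt_one_of_lt h _)

/-- `F n` only involves pairs of nonzero integers whose product is divisible by `n`. -/
def Graded (F : ArithmeticFunction DilAlg) : Prop :=
  ∀ n, ∀ p ∈ (F n).coeff.support, p.1 ≠ 0 ∧ p.2 ≠ 0 ∧ n ∣ p.1 * p.2

lemma Graded.mul_support {F G : ArithmeticFunction DilAlg} (hF : Graded F) (hG : Graded G)
    {i j : ℕ} {p : ℕ × ℕ} (hp : p ∈ (F i * G j).coeff.support) :
    p.1 ≠ 0 ∧ p.2 ≠ 0 ∧ i * j ∣ p.1 * p.2 := by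
  classical
  obtain ⟨q, hq, r, hr, rfl⟩ := Finset.mem_mul.mp (MonoidAlgebra.support_coeff_mul_subset _ _ hp)
  obtain ⟨hq1, hq2, hq3⟩ := hF _ _ hq
  obtain ⟨hr1, hr2, hr3⟩ := hG _ _ hr
  refine ⟨mul_ne_zero hq1 hr1, mul_ne_zero hq2 hr2, ?_⟩
  simpa [mul_mul_mul_comm] using mul_dvd_mul hq3 hr3

lemma Graded.mul {F G : ArithmeticFunction DilAlg} (hF : Graded F) (hG : Graded G) :
    Graded (F * G) := by
  classical
  intro n p hp
  rw [ArithmeticFunction.mul_apply, MonoidAlgebra.coeff_sum] at hp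
  obtain ⟨⟨i, j⟩, hij, hp⟩ := Finset.mem_biUnion.mp (Finsupp.support_finsetSum hp)
  rw [← (Nat.mem_divisorsAntidiagonal.mp hij).1]
  exact hF.mul_support hG hp

lemma Graded.one : Graded 1 := by
  intro n p hp
  rcases eq_or_ne n 1 with rfl | hn
  · rw [ArithmeticFunction.one_one, MonoidAlgebra.support_coeff_one] at hp
    obtain rfl : p = 1 := by simpa using hp
    simp
  · rw [ArithmeticFunction.one_apply_ne hn] at hp
    simp at hp

lemma Graded.pow {F : ArithmeticFunction DilAlg} (hF : Graded F) (k : ℕ) : Graded (F ^ k) := by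
  induction k with
  | zero => simpa using Graded.one
  | succ k ih => rw [pow_succ]; exact ih.mul hF

lemma act_eq_zero {a : DilAlg} {n : ℕ}
    (ha : ∀ p ∈ a.coeff.support, p.1 ≠ 0 ∧ p.2 ≠ 0 ∧ n ∣ p.1 * p.2) {Φ : ℝ → ℝ → ℝ}
    (hΦ : Supported Φ) {X Y : ℝ} (h : X * Y < n) : act a Φ X Y = 0 := by
  rw [act_apply]
  refine Finset.sum_eq_zero fun p hp => ?_
  obtain ⟨h1, h2, h3⟩ := ha p hp
  simp only
  rw [hΦ, mul_zero]
  by_contra! hc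
  have e1 : (0 : ℝ) < p.1 := by exact_mod_cast Nat.pos_of_ne_zero h1
  have e2 : (0 : ℝ) < p.2 := by exact_mod_cast Nat.pos_of_ne_zero h2
  rw [one_le_div e1, one_le_div e2] at hc
  have h4 : (n : ℝ) ≤ p.1 * p.2 := by
    exact_mod_cast Nat.le_of_dvd (Nat.mul_pos (by omega) (by omega)) h3
  nlinarith [mul_le_mul hc.1 hc.2 e2.le (by linarith)]

/-- The action of an arithmetic function with values in `DilAlg`. -/
noncomputable def star (F : ArithmeticFunction DilAlg) (Φ : ℝ → ℝ → ℝ) : ℝ → ℝ → ℝ :=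
  fun X Y => ∑' n, act (F n) Φ X Y

lemma Supported.star {Φ : ℝ → ℝ → ℝ} (h : Supported Φ) (F : ArithmeticFunction DilAlg) :
    Supported (DilAlg.star F Φ) := by
  intro X Y hXY
  simp [DilAlg.star, h.act _ X Y hXY]

lemma star_eq_sum {F : ArithmeticFunction DilAlg} (hF : Graded F) {Φ : ℝ → ℝ → ℝ}
    (hΦ : Supported Φ) {T : ℕ} {X Y : ℝ} (h : X * Y ≤ T) :
    star F Φ X Y = ∑ n ∈ Finset.Icc 1 T, act (F n) Φ X Y := by
  refine tsum_eq_sum fun n hn => ?_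
  rcases Nat.eq_zero_or_pos n with rfl | hn0
  · simp
  · have : T < n := by
      by_contra hc
      exact hn (Finset.mem_Icc.mpr ⟨hn0, by omega⟩)
    exact act_eq_zero (hF n) hΦ (h.trans_lt (by exact_mod_cast this))

lemma star_mul {F G : ArithmeticFunction DilAlg} (hF : Graded F) (hG : Graded G)
    {Φ : ℝ → ℝ → ℝ} (hΦ : Supported Φ) : star (F * G) Φ = star F (star G Φ) := by
  ext X Y
  by_cases hXY : X < 1 ∨ Y < 1
  · rw [hΦ.star _ X Y hXY, (hΦ.star G).star _ X Y hXY]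
  push Not at hXY
  obtain ⟨hX, hY⟩ := hXY
  obtain ⟨T, hT⟩ := exists_nat_ge (X * Y)
  rw [star_eq_sum (hF.mul hG) hΦ hT, star_eq_sum hF (hΦ.star G) hT]
  have hin : ∀ n, act (F n) (star G Φ) X Y =
      ∑ m ∈ Finset.Icc 1 T, act (F n * G m) Φ X Y := by
    intro n
    have h1 : act (F n) (star G Φ) X Y =
        act (F n) (∑ m ∈ Finset.Icc 1 T, act (G m) Φ) X Y := by
      rw [act_apply, act_apply]
      refine Finset.sum_congr rfl fun p hp => ?_
      obtain ⟨h1, h2, -⟩ := hF n p hp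
      have e1 : (1 : ℝ) ≤ p.1 := by exact_mod_cast Nat.pos_of_ne_zero h1
      have e2 : (1 : ℝ) ≤ p.2 := by exact_mod_cast Nat.pos_of_ne_zero h2
      simp only
      rw [star_eq_sum hG hΦ (T := T), Finset.sum_apply, Finset.sum_apply]
      refine le_trans ?_ hT
      exact mul_le_mul (div_le_self (by linarith) e1) (div_le_self (by linarith) e2)
        (by positivity) (by positivity)
    rw [h1, map_sum, Finset.sum_apply, Finset.sum_apply]
    refine Finset.sum_congr rfl fun m _ => ?_
    rw [map_mul]
    rfl
  simp_rw [hin]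
  rw [← Finset.sum_product']
  have hout : ∀ N, act ((F * G) N) Φ X Y =
      ∑ p ∈ N.divisorsAntidiagonal, act (F p.1 * G p.2) Φ X Y := by
    intro N
    rw [ArithmeticFunction.mul_apply, map_sum, LinearMap.sum_apply, Finset.sum_apply,
      Finset.sum_apply]
  simp_rw [hout]
  rw [← Finset.sum_filter_add_sum_filter_not (Finset.Icc 1 T ×ˢ Finset.Icc 1 T)
    (fun p => p.1 * p.2 ≤ T)]
  have hzero : ∑ p ∈ Finset.Icc 1 T ×ˢ Finset.Icc 1 T with ¬p.1 * p.2 ≤ T,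
      act (F p.1 * G p.2) Φ X Y = 0 := by
    refine Finset.sum_eq_zero fun p hp => ?_
    have hlt : T < p.1 * p.2 := by simpa using (Finset.mem_filter.mp hp).2
    exact act_eq_zero (fun _ => hF.mul_support hG) hΦ (hT.trans_lt (by exact_mod_cast hlt))
  rw [hzero, add_zero]
  have hset : (Finset.Icc 1 T ×ˢ Finset.Icc 1 T).filter (fun p => p.1 * p.2 ≤ T) =
      (Finset.Icc 1 T).biUnion fun N => N.divisorsAntidiagonal := by
    ext ⟨i, j⟩
    simp only [Finset.mem_filter, Finset.mem_product, Finset.mem_Icc, Finset.mem_biUnion,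
      Nat.mem_divisorsAntidiagonal]
    constructor
    · rintro ⟨⟨⟨h1, -⟩, h2, -⟩, h3⟩
      exact ⟨i * j, ⟨Nat.mul_pos h1 h2, h3⟩, rfl, (Nat.mul_pos h1 h2).ne'⟩
    · rintro ⟨N, ⟨h1, h2⟩, rfl, h3⟩
      have hi : 0 < i := Nat.pos_of_ne_zero (left_ne_zero_of_mul h3)
      have hj : 0 < j := Nat.pos_of_ne_zero (right_ne_zero_of_mul h3)
      exact ⟨⟨⟨hi, (Nat.le_mul_of_pos_right i hj).trans h2⟩, hj,
        (Nat.le_mul_of_pos_left j hi).trans h2⟩, h2⟩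
  rw [hset, Finset.sum_biUnion]
  intro a _ b _ hab
  refine Finset.disjoint_left.mpr fun p hp hq => hab ?_
  rw [← (Nat.mem_divisorsAntidiagonal.mp hp).1, (Nat.mem_divisorsAntidiagonal.mp hq).1]

end DilAlg

namespace DilAlg

lemma star_one (Φ : ℝ → ℝ → ℝ) : star 1 Φ = Φ := by
  ext X Y
  rw [star, tsum_eq_single 1]
  · simp
  · intro n hn
    simp [ArithmeticFunction.one_apply_ne hn]

lemma star_pow {F : ArithmeticFunction DilAlg} (hF : Graded F) {Φ : ℝ → ℝ → ℝ}
    (hΦ : Supported Φ) (k : ℕ) : star (F ^ k) Φ = (star F)^[k] Φ := by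
  induction k with
  | zero => rw [pow_zero, star_one, Function.iterate_zero_apply]
  | succ k ih => rw [pow_succ', star_mul hF (hF.pow k) hΦ, ih, Function.iterate_succ_apply']

/-- A real arithmetic function placed on the pairs `(n ^ a, n ^ b)`. -/
noncomputable def mono (a b : ℕ) (c : ArithmeticFunction ℝ) : ArithmeticFunction DilAlg :=
  ⟨fun n => MonoidAlgebra.single (n ^ a, n ^ b) (c n), by simp⟩

lemma mono_apply (a b : ℕ) (c : ArithmeticFunction ℝ) (n : ℕ) :
    mono a b c n = MonoidAlgebra.single (n ^ a, n ^ b) (c n) := rfl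

lemma mono_one (a b : ℕ) : mono a b 1 = 1 := by
  ext1 n
  rw [mono_apply]
  rcases eq_or_ne n 1 with rfl | hn
  · simp [MonoidAlgebra.one_def, Prod.mk_one_one]
  · simp [ArithmeticFunction.one_apply_ne hn]

lemma mono_mul (a b : ℕ) (c d : ArithmeticFunction ℝ) :
    mono a b (c * d) = mono a b c * mono a b d := by
  ext1 n
  rw [mono_apply, ArithmeticFunction.mul_apply, ArithmeticFunction.mul_apply,
    ← MonoidAlgebra.singleAddHom_apply, map_sum]
  refine Finset.sum_congr rfl fun p hp => ?_
  rw [mono_apply, mono_apply, MonoidAlgebra.single_mul_single, MonoidAlgebra.singleAddHom_apply,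
    Prod.mk_mul_mk, ← mul_pow, ← mul_pow, (Nat.mem_divisorsAntidiagonal.mp hp).1]

lemma mono_isMultiplicative (a b : ℕ) {c : ArithmeticFunction ℝ} (hc : c.IsMultiplicative) :
    (mono a b c).IsMultiplicative := by
  refine ⟨by simp [mono_apply, hc.1, MonoidAlgebra.one_def, Prod.mk_one_one], fun {m n} h => ?_⟩
  rw [mono_apply, mono_apply, mono_apply, MonoidAlgebra.single_mul_single, hc.2 h,
    Prod.mk_mul_mk, ← mul_pow, ← mul_pow]

lemma graded_mono {a b : ℕ} (hab : a ≠ 0 ∨ b ≠ 0) (c : ArithmeticFunction ℝ) :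
    Graded (mono a b c) := by
  intro n p hp
  rw [mono_apply, MonoidAlgebra.coeff_single] at hp
  have hn : n ≠ 0 := by
    rintro rfl
    simp at hp
  obtain rfl : p = (n ^ a, n ^ b) := by simpa using Finsupp.support_single_subset hp
  refine ⟨pow_ne_zero _ hn, pow_ne_zero _ hn, ?_⟩
  rcases hab with h | h
  · exact (dvd_pow_self n h).mul_right _
  · exact (dvd_pow_self n h).mul_left _

/-- The arithmetic function `1 / n`. -/
noncomputable def recip : ArithmeticFunction ℝ := ⟨fun n => 1 / n, by simp⟩

/-- The arithmetic function `μ(n) / n`. -/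
noncomputable def moebRecip : ArithmeticFunction ℝ :=
  ⟨fun n => (ArithmeticFunction.moebius n : ℝ) / n, by simp⟩

lemma recip_apply (n : ℕ) : recip n = 1 / n := rfl

lemma moebRecip_apply (n : ℕ) : moebRecip n = (ArithmeticFunction.moebius n : ℝ) / n := rfl

lemma recip_isMultiplicative : recip.IsMultiplicative :=
  ⟨by simp [recip_apply], fun {m n} _ => by simp [recip_apply, mul_comm]⟩

lemma moebRecip_isMultiplicative : moebRecip.IsMultiplicative := by
  refine ⟨by simp [moebRecip_apply], fun {m n} h => ?_⟩
  rw [moebRecip_apply, moebRecip_apply, moebRecip_apply,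
    ArithmeticFunction.isMultiplicative_moebius.2 h]
  push_cast
  rw [mul_div_mul_comm]

lemma recip_mul_moebRecip : recip * moebRecip = 1 := by
  ext n
  have h1 := congrArg (fun F : ArithmeticFunction ℝ => F n)
    (ArithmeticFunction.coe_zeta_mul_coe_moebius (R := ℝ))
  simp only [ArithmeticFunction.mul_apply] at h1
  have h2 : (recip * moebRecip) n = 1 / n * ∑ p ∈ n.divisorsAntidiagonal,
      ((ArithmeticFunction.zeta : ArithmeticFunction ℝ) p.1) *
        ((ArithmeticFunction.moebius : ArithmeticFunction ℝ) p.2) := by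
    rw [ArithmeticFunction.mul_apply, Finset.mul_sum]
    refine Finset.sum_congr rfl fun p hp => ?_
    obtain ⟨hp1, hp2⟩ := Nat.mem_divisorsAntidiagonal.mp hp
    have h0 : p.1 ≠ 0 := left_ne_zero_of_mul (hp1 ▸ hp2)
    rw [recip_apply, moebRecip_apply, ArithmeticFunction.natCoe_apply,
      ArithmeticFunction.intCoe_apply, ArithmeticFunction.zeta_apply_ne h0, ← hp1]
    push_cast
    ring
  rw [h2, h1]
  rcases eq_or_ne n 1 with rfl | hn
  · simp
  · simp [ArithmeticFunction.one_apply_ne hn]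

lemma mono_recip_mul_moebRecip (a b : ℕ) : mono a b recip * mono a b moebRecip = 1 := by
  rw [← mono_mul, recip_mul_moebRecip, mono_one]

/-- The function `(X, Y) ↦ φ(X) ψ(Y)`. -/
def tensor (φ ψ : ℝ → ℝ) : ℝ → ℝ → ℝ := fun X Y => φ X * ψ Y

lemma supported_tensor {φ ψ : ℝ → ℝ} (hφ : ∀ x < 1, φ x = 0) (hψ : ∀ x < 1, ψ x = 0) :
    Supported (tensor φ ψ) := by
  rintro X Y (h | h)
  · simp [tensor, hφ X h]
  · simp [tensor, hψ Y h]

/-- One-variable convolution `∑_{n ≤ x} c(n) φ(x / n)`. -/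
noncomputable def convOp (c : ArithmeticFunction ℝ) (φ : ℝ → ℝ) (x : ℝ) : ℝ :=
  ∑ n ∈ Finset.Icc 1 ⌊x⌋₊, c n * φ (x / n)

lemma convOp_recip : convOp recip = divOp := rfl

lemma convOp_moebRecip : convOp moebRecip = moebiusOp := rfl

lemma convOp_of_lt_one (c : ArithmeticFunction ℝ) (φ : ℝ → ℝ) {x : ℝ} (hx : x < 1) :
    convOp c φ x = 0 := by
  have : ⌊x⌋₊ = 0 := Nat.floor_eq_zero.mpr hx
  simp [convOp, this]

lemma convOp_eq_tsum (c : ArithmeticFunction ℝ) {φ : ℝ → ℝ} (hφ : ∀ x < 1, φ x = 0) (x : ℝ) :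
    convOp c φ x = ∑' n : ℕ, c n * φ (x / n) := by
  rw [convOp]
  refine (tsum_eq_sum fun n hn => ?_).symm
  rcases Nat.eq_zero_or_pos n with rfl | hn0
  · simp
  rw [hφ, mul_zero]
  have hlt : ⌊x⌋₊ < n := by
    by_contra hc
    exact hn (Finset.mem_Icc.mpr ⟨hn0, by omega⟩)
  rw [div_lt_one (by exact_mod_cast hn0)]
  exact Nat.lt_of_floor_lt hlt

lemma star_mono_fst (c : ArithmeticFunction ℝ) {φ : ℝ → ℝ} (hφ : ∀ x < 1, φ x = 0) (ψ : ℝ → ℝ) :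
    star (mono 1 0 c) (tensor φ ψ) = tensor (convOp c φ) ψ := by
  ext X Y
  rw [tensor, convOp_eq_tsum c hφ, star, ← tsum_mul_right]
  refine tsum_congr fun n => ?_
  rw [mono_apply, act_single, tensor]
  simp [mul_assoc]

lemma star_mono_snd (c : ArithmeticFunction ℝ) (φ : ℝ → ℝ) {ψ : ℝ → ℝ} (hψ : ∀ x < 1, ψ x = 0) :
    star (mono 0 1 c) (tensor φ ψ) = tensor φ (convOp c ψ) := by
  ext X Y
  rw [tensor, convOp_eq_tsum c hψ, star, ← tsum_mul_left]
  refine tsum_congr fun n => ?_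
  rw [mono_apply, act_single, tensor]
  simp [mul_left_comm]

lemma iterate_convOp_of_lt_one (c : ArithmeticFunction ℝ) {φ : ℝ → ℝ} (hφ : ∀ x < 1, φ x = 0)
    (k : ℕ) : ∀ x < 1, (convOp c)^[k] φ x = 0 := by
  cases k with
  | zero => exact hφ
  | succ k =>
    intro x hx
    rw [Function.iterate_succ_apply', convOp_of_lt_one _ _ hx]

lemma star_mono_fst_pow (c : ArithmeticFunction ℝ) {φ ψ : ℝ → ℝ} (hφ : ∀ x < 1, φ x = 0)
    (hψ : ∀ x < 1, ψ x = 0) (k : ℕ) :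
    star (mono 1 0 c ^ k) (tensor φ ψ) = tensor ((convOp c)^[k] φ) ψ := by
  rw [star_pow (graded_mono (by simp) c) (supported_tensor hφ hψ)]
  induction k with
  | zero => rfl
  | succ k ih =>
    rw [Function.iterate_succ_apply', ih, star_mono_fst c (iterate_convOp_of_lt_one c hφ k),
      Function.iterate_succ_apply']

lemma star_mono_snd_pow (c : ArithmeticFunction ℝ) {φ ψ : ℝ → ℝ} (hφ : ∀ x < 1, φ x = 0)
    (hψ : ∀ x < 1, ψ x = 0) (k : ℕ) :
    star (mono 0 1 c ^ k) (tensor φ ψ) = tensor φ ((convOp c)^[k] ψ) := by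
  rw [star_pow (graded_mono (by simp) c) (supported_tensor hφ hψ)]
  induction k with
  | zero => rfl
  | succ k ih =>
    rw [Function.iterate_succ_apply', ih, star_mono_snd c _ (iterate_convOp_of_lt_one c hψ k),
      Function.iterate_succ_apply']

lemma star_mono_diag (c : ArithmeticFunction ℝ) {Φ : ℝ → ℝ → ℝ} (hΦ : Supported Φ)
    {α β : ℝ} (hα : 0 ≤ α) (hα1 : α ≤ 1) (x : ℝ) :
    star (mono 1 1 c) Φ (α * x) (β * x) = convOp c (fun x => Φ (α * x) (β * x)) x := by
  rw [convOp_eq_tsum, star]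
  · refine tsum_congr fun n => ?_
    rw [mono_apply, act_single]
    simp [mul_div_assoc]
  · intro x hx
    refine hΦ _ _ (Or.inl ?_)
    rcases le_or_gt x 0 with h | h <;> nlinarith

lemma star_mono_diag_pow (c : ArithmeticFunction ℝ) {Φ : ℝ → ℝ → ℝ} (hΦ : Supported Φ)
    {α β : ℝ} (hα : 0 ≤ α) (hα1 : α ≤ 1) (k : ℕ) (x : ℝ) :
    star (mono 1 1 c ^ k) Φ (α * x) (β * x) =
      (convOp c)^[k] (fun x => Φ (α * x) (β * x)) x := by
  rw [star_pow (graded_mono (by simp) c) hΦ]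
  induction k generalizing Φ with
  | zero => rfl
  | succ k ih =>
    rw [Function.iterate_succ_apply, ih (hΦ.star _), Function.iterate_succ_apply]
    exact congrArg (fun φ => (convOp c)^[k] φ x)
      (funext fun x => star_mono_diag c hΦ hα hα1 x)

end DilAlg

lemma LogAsymp.tendsto_smul {φ : ℝ → ℝ} {j : ℕ} {w : ℝ} (h : LogAsymp φ j w) {α : ℝ}
    (hα : 0 < α) :
    Tendsto (fun x => φ (α * x) / Real.log x ^ j) atTop (nhds (w / j.factorial)) := by
  have h1 : Tendsto (fun x : ℝ => α * x) atTop atTop := tendsto_id.const_mul_atTop hα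
  have h2 : Tendsto (fun x : ℝ => Real.log (α * x) / Real.log x) atTop (nhds 1) := by
    have h3 : Tendsto (fun x : ℝ => Real.log α * (Real.log x)⁻¹ + 1) atTop (nhds 1) := by
      simpa using ((tendsto_inv_atTop_zero.comp Real.tendsto_log_atTop).const_mul
        (Real.log α)).add_const 1
    refine h3.congr' ?_
    filter_upwards [Real.tendsto_log_atTop.eventually_gt_atTop 0, eventually_gt_atTop 0]
      with x hl hx
    rw [Real.log_mul hα.ne' hx.ne']
    field_simp
  have h4 := (h.limit.comp h1).mul (h2.pow j)
  rw [one_pow, mul_one] at h4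
  refine h4.congr' ?_
  filter_upwards [(Real.tendsto_log_atTop.comp h1).eventually_gt_atTop 0,
    Real.tendsto_log_atTop.eventually_gt_atTop 0] with x hl1 hl2
  have hl1' : Real.log (α * x) ≠ 0 := hl1.ne'
  simp only [Function.comp_apply]
  rw [div_pow]
  field_simp

lemma LogAsymp.mul {φ ψ : ℝ → ℝ} {i j : ℕ} {v w : ℝ} (hφ : LogAsymp φ i v)
    (hψ : LogAsymp ψ j w) {α β : ℝ} (hα : 0 < α) (hα1 : α ≤ 1) (hβ : 0 < β) (hβ1 : β ≤ 1) :
    LogAsymp (fun x => φ (α * x) * ψ (β * x)) (i + j) (v * w * (i + j).choose i) := by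
  obtain ⟨C, hC, hCb⟩ := hφ.bound
  obtain ⟨D, hD, hDb⟩ := hψ.bound
  have hle : ∀ {γ x R : ℝ}, 0 < γ → γ ≤ 1 → 1 ≤ R → x ≤ R → γ * x ≤ R := by
    intro γ x R h1 h2 h3 h4
    rcases le_or_gt x 0 with h | h <;> nlinarith
  refine ⟨fun x hx => ?_, ⟨C * D, by positivity, fun R hR x hx => ?_⟩, ?_⟩
  · rw [hφ.support, zero_mul]
    rcases le_or_gt x 0 with h | h <;> nlinarith
  · have hl := Real.log_nonneg hR
    rw [abs_mul, pow_add, mul_mul_mul_comm]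
    exact mul_le_mul (hCb R hR _ (hle hα hα1 hR hx)) (hDb R hR _ (hle hβ hβ1 hR hx))
      (abs_nonneg _) (by positivity)
  · have h := (hφ.tendsto_smul hα).mul (hψ.tendsto_smul hβ)
    have e : v * w * ((i + j).choose i : ℝ) / ((i + j).factorial : ℝ) =
        v / i.factorial * (w / j.factorial) := by
      have h1 := Nat.choose_mul_factorial_mul_factorial (Nat.le_add_right i j)
      rw [Nat.add_sub_cancel_left] at h1
      have h2 : ((i + j).choose i : ℝ) * i.factorial * j.factorial = (i + j).factorial := by
        exact_mod_cast h1
      rw [← h2]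
      have : ((i + j).choose i : ℝ) ≠ 0 := by
        exact_mod_cast (Nat.choose_pos (Nat.le_add_right i j)).ne'
      field_simp
    rw [e]
    refine h.congr fun x => ?_
    rw [pow_add, div_mul_div_comm]

lemma abs_iterate_divOp_le {φ : ℝ → ℝ} {B R : ℝ} (hR : 1 ≤ R) (hB : 0 ≤ B)
    (h : ∀ x ≤ R, |φ x| ≤ B) (k : ℕ) :
    ∀ x ≤ R, |divOp^[k] φ x| ≤ B * (1 + Real.log R) ^ k := by
  have hl := Real.log_nonneg hR
  induction k with
  | zero => simpa using h
  | succ k ih =>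
    intro x hx
    rw [Function.iterate_succ_apply', pow_succ, ← mul_assoc]
    exact abs_divOp_le hR (by positivity) ih hx

namespace DilAlg

/-- The main term obtained after factoring out the singular series. -/
noncomputable def model (k l₁ l₂ : ℕ) : ℝ → ℝ → ℝ :=
  star (mono 1 1 recip ^ k)
    (tensor (divOp^[l₁] (mollified (k + l₁))) (divOp^[l₂] (mollified (k + l₂))))

lemma logAsymp_divOp_mollified (k l : ℕ) : LogAsymp (divOp^[l] (mollified k)) l 1 := by
  simpa using logAsymp_iterate_divOp (logAsymp_mollified k) l

lemma supported_tensor_divOp (k l₁ l₂ : ℕ) :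
    Supported (tensor (divOp^[l₁] (mollified (k + l₁))) (divOp^[l₂] (mollified (k + l₂)))) :=
  supported_tensor (logAsymp_divOp_mollified _ _).support (logAsymp_divOp_mollified _ _).support

lemma supported_model (k l₁ l₂ : ℕ) : Supported (model k l₁ l₂) :=
  (supported_tensor_divOp k l₁ l₂).star _

lemma supported_tensor_logPow (j j' : ℕ) : Supported (tensor (logPow j) (logPow j')) :=
  supported_tensor (logPow_of_lt_one _) (logPow_of_lt_one _)

/-- The operator turning products of powers of logarithms into `model`. -/
noncomputable def mainFactor (k l₁ l₂ : ℕ) : ArithmeticFunction DilAlg :=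
  mono 1 1 recip ^ k * (mono 1 0 recip ^ l₁ * (mono 0 1 recip ^ l₂ *
    (mono 1 0 moebRecip ^ (k + l₁) * mono 0 1 moebRecip ^ (k + l₂))))

lemma graded_mainFactor (k l₁ l₂ : ℕ) : Graded (mainFactor k l₁ l₂) :=
  ((graded_mono (by simp) _).pow _).mul <| ((graded_mono (by simp) _).pow _).mul <|
    ((graded_mono (by simp) _).pow _).mul <| ((graded_mono (by simp) _).pow _).mul <|
      (graded_mono (by simp) _).pow _

lemma star_mainFactor (k l₁ l₂ : ℕ) :
    star (mainFactor k l₁ l₂) (tensor (logPow (k + l₁)) (logPow (k + l₂))) = model k l₁ l₂ := by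
  have hg : ∀ {a b : ℕ} (hab : a ≠ 0 ∨ b ≠ 0) (c : ArithmeticFunction ℝ) (j : ℕ),
    Graded (mono a b c ^ j) := fun hab c j => (graded_mono hab c).pow j
  have hs := supported_tensor_logPow (k + l₁) (k + l₂)
  have h1 : ∀ j, ∀ x < 1, logPow j x = 0 := logPow_of_lt_one
  have h2 : ∀ j, ∀ x < 1, mollified j x = 0 := mollified_of_lt_one
  rw [mainFactor, star_mul (hg (by simp) _ _)
      ((hg (by simp) _ _).mul ((hg (by simp) _ _).mul ((hg (by simp) _ _).mul (hg (by simp) _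
          _)))) hs,
    star_mul (hg (by simp) _ _) ((hg (by simp) _ _).mul ((hg (by simp) _ _).mul (hg (by simp) _
        _))) hs,
    star_mul (hg (by simp) _ _) ((hg (by simp) _ _).mul (hg (by simp) _ _)) hs,
    star_mul (hg (by simp) _ _) (hg (by simp) _ _) hs,
    star_mono_snd_pow _ (h1 _) (h1 _), star_mono_fst_pow _ (h1 _)
      (iterate_convOp_of_lt_one _ (h1 _) _)]
  simp only [convOp_moebRecip]
  rw [← mollified, ← mollified, star_mono_snd_pow _ (h2 _) (h2 _), star_mono_fst_pow _ (h2 _)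
    (iterate_convOp_of_lt_one _ (h2 _) _)]
  rfl

lemma abs_model_le (k l₁ l₂ : ℕ) : ∃ C : ℝ, 0 ≤ C ∧ ∀ R : ℝ, 1 ≤ R → ∀ X ≤ R, ∀ Y ≤ R,
    |model k l₁ l₂ X Y| ≤ C * (1 + Real.log R) ^ (k + l₁ + l₂) := by
  obtain ⟨C, hC, hCb⟩ := (logAsymp_divOp_mollified (k + l₁) l₁).bound
  obtain ⟨D, hD, hDb⟩ := (logAsymp_divOp_mollified (k + l₂) l₂).bound
  refine ⟨C * D, by positivity, fun R hR X hX Y hY => ?_⟩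
  have hl := Real.log_nonneg hR
  by_cases hXY : X < 1 ∨ Y < 1
  · rw [supported_model k l₁ l₂ X Y hXY, abs_zero]
    positivity
  push Not at hXY
  have hR0 : (0 : ℝ) < R := by linarith
  have hle : ∀ {x : ℝ} {Z : ℝ}, 1 ≤ Z → Z ≤ R → x ≤ R → Z / R * x ≤ R := by
    intro x Z h1 h2 h3
    have h4 : Z / R ≤ 1 := (div_le_one hR0).mpr h2
    have h5 : 0 ≤ Z / R := by positivity
    rcases le_or_gt x 0 with h | h <;> nlinarith
  have h := star_mono_diag_pow recip (supported_tensor_divOp k l₁ l₂) (α := X / R) (β := Y / R)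
    (div_nonneg (by linarith) hR0.le) ((div_le_one hR0).mpr hX) k R
  rw [div_mul_cancel₀ _ hR0.ne', div_mul_cancel₀ _ hR0.ne'] at h
  rw [model, h, convOp_recip]
  refine (abs_iterate_divOp_le hR (B := C * D * (1 + Real.log R) ^ (l₁ + l₂)) (by positivity)
    (fun x hx => ?_) k R le_rfl).trans_eq (by ring)
  rw [tensor, abs_mul, pow_add, mul_mul_mul_comm]
  exact mul_le_mul (hCb R hR _ (hle hXY.1 hX hx)) (hDb R hR _ (hle hXY.2 hY hx))
    (abs_nonneg _) (by positivity)

lemma tendsto_model (k l₁ l₂ : ℕ) {m m' : ℕ} (hm : m ≠ 0) (hm' : m' ≠ 0) :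
    Tendsto (fun R : ℝ => model k l₁ l₂ (R / m) (R / m') / Real.log R ^ (k + l₁ + l₂)) atTop
      (nhds (((l₁ + l₂).choose l₁ : ℝ) / (k + l₁ + l₂).factorial)) := by
  have e1 : (1 : ℝ) ≤ m := by exact_mod_cast Nat.pos_of_ne_zero hm
  have e2 : (1 : ℝ) ≤ m' := by exact_mod_cast Nat.pos_of_ne_zero hm'
  have h := logAsymp_iterate_divOp ((logAsymp_divOp_mollified (k + l₁) l₁).mul
    (logAsymp_divOp_mollified (k + l₂) l₂) (α := (m : ℝ)⁻¹) (β := (m' : ℝ)⁻¹) (by positivity)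
    (inv_le_one_of_one_le₀ e1) (by positivity) (inv_le_one_of_one_le₀ e2)) k
  have hlim := h.limit
  rw [one_mul, one_mul] at hlim
  rw [show l₁ + l₂ + k = k + l₁ + l₂ by ring] at hlim
  refine hlim.congr fun R => ?_
  have h1 := star_mono_diag_pow recip (supported_tensor_divOp k l₁ l₂) (α := (m : ℝ)⁻¹)
    (β := (m' : ℝ)⁻¹) (by positivity) (inv_le_one_of_one_le₀ e1) k R
  rw [model, div_eq_inv_mul R, div_eq_inv_mul R, h1]
  rfl

end DilAlg

lemma nu_one (H : Finset ℕ) : nu H 1 = 1 := by simp [nu]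

lemma nu_eq_card (H : Finset ℕ) (m : ℕ) [NeZero m] :
    nu H m = Nat.card {x : ZMod m // ∏ h ∈ H, (x + h) = 0} := by
  classical
  have key : ∀ n : ℕ, m ∣ ∏ h ∈ H, (n + h) ↔ ∏ h ∈ H, ((n : ZMod m) + h) = 0 := fun n => by
    rw [← ZMod.natCast_eq_zero_iff]
    push_cast
    rfl
  rw [nu, Nat.card_eq_fintype_card, Fintype.card_subtype]
  refine Finset.card_bij (fun n _ => (n : ZMod m)) (fun n hn => ?_) (fun a ha b hb hab => ?_)
    (fun x hx => ⟨x.val, ?_, ZMod.natCast_zmod_val x⟩)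
  · simpa using (key n).mp (Finset.mem_filter.mp hn).2
  · have h1 := Finset.mem_range.mp (Finset.mem_filter.mp ha).1
    have h2 := Finset.mem_range.mp (Finset.mem_filter.mp hb).1
    have := (ZMod.natCast_eq_natCast_iff' a b m).mp hab
    rwa [Nat.mod_eq_of_lt h1, Nat.mod_eq_of_lt h2] at this
  · refine Finset.mem_filter.mpr ⟨Finset.mem_range.mpr (ZMod.val_lt x), (key _).mpr ?_⟩
    rw [ZMod.natCast_zmod_val]
    simpa using hx

lemma nu_mul (H : Finset ℕ) {m n : ℕ} (h : m.Coprime n) : nu H (m * n) = nu H m * nu H n := by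
  rcases Nat.eq_zero_or_pos m with rfl | hm
  · simp [nu]
  rcases Nat.eq_zero_or_pos n with rfl | hn
  · simp [nu]
  have : NeZero m := ⟨hm.ne'⟩
  have : NeZero n := ⟨hn.ne'⟩
  have : NeZero (m * n) := ⟨(Nat.mul_pos hm hn).ne'⟩
  rw [nu_eq_card, nu_eq_card, nu_eq_card, ← Nat.card_prod]
  refine Nat.card_congr ((Equiv.subtypeEquiv (ZMod.chineseRemainder h).toEquiv (fun x => ?_)).trans
    (Equiv.subtypeProdEquivProd (p := fun x : ZMod m => ∏ h ∈ H, (x + h) = 0)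
      (q := fun x : ZMod n => ∏ h ∈ H, (x + h) = 0)))
  have e : (ZMod.chineseRemainder h) (∏ a ∈ H, (x + (a : ZMod (m * n)))) =
      (∏ a ∈ H, ((ZMod.chineseRemainder h x).1 + a), ∏ a ∈ H,
          ((ZMod.chineseRemainder h x).2 + a)) := by
    rw [map_prod]
    ext
    · rw [Prod.fst_prod]
      simp
    · rw [Prod.snd_prod]
      simp
  rw [← (ZMod.chineseRemainder h).map_eq_zero_iff, e, Prod.mk_eq_zero]
  rfl

lemma nu_le_card (H : Finset ℕ) {p : ℕ} (hp : p.Prime) : nu H p ≤ H.card := by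
  classical
  have := Fact.mk hp
  rw [nu_eq_card, Nat.card_eq_fintype_card, Fintype.card_subtype]
  refine (Finset.card_le_card (t := H.image fun h : ℕ => -(h : ZMod p)) fun x hx => ?_).trans
    Finset.card_image_le
  obtain ⟨h, hh, h0⟩ := Finset.prod_eq_zero_iff.mp (Finset.mem_filter.mp hx).2
  exact Finset.mem_image.mpr ⟨h, hh, (eq_neg_of_add_eq_zero_left h0).symm⟩

lemma nu_eq_card_of_lt (H : Finset ℕ) {p : ℕ} (hp : p.Prime) (hH : ∀ h ∈ H, h < p) :
    nu H p = H.card := by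
  classical
  have := Fact.mk hp
  refine le_antisymm (nu_le_card H hp) ?_
  rw [nu_eq_card, Nat.card_eq_fintype_card, Fintype.card_subtype]
  rw [← Finset.card_image_of_injOn (s := H) (f := fun h : ℕ => -(h : ZMod p))]
  · refine Finset.card_le_card fun x hx => ?_
    obtain ⟨h, hh, rfl⟩ := Finset.mem_image.mp hx
    simp only [Finset.mem_filter, Finset.mem_univ, true_and]
    exact Finset.prod_eq_zero hh (by simp)
  · intro a ha b hb hab
    have := (ZMod.natCast_eq_natCast_iff' a b p).mp (neg_injective hab)
    rwa [Nat.mod_eq_of_lt (hH a ha), Nat.mod_eq_of_lt (hH b hb)] at this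

lemma ArithmeticFunction.mul_apply_prime_pow {R : Type*} [Semiring R]
    (F G : ArithmeticFunction R) {p : ℕ} (hp : p.Prime) (e : ℕ) :
    (F * G) (p ^ e) = ∑ x ∈ Finset.HasAntidiagonal.antidiagonal e, F (p ^ x.1) * G (p ^ x.2) := by
  rw [ArithmeticFunction.mul_apply, Nat.sum_divisorsAntidiagonal (fun i j => F i * G j),
    Nat.divisors_prime_pow hp, Finset.sum_map,
    Finset.Nat.sum_antidiagonal_eq_sum_range_succ (fun i j => F (p ^ i) * G (p ^ j))]
  refine Finset.sum_congr rfl fun i hi => ?_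
  have : i ≤ e := by
    have := Finset.mem_range.mp hi
    omega
  rw [Function.Embedding.coeFn_mk, Nat.pow_div this hp.pos]

lemma ArithmeticFunction.mul_apply_prime {R : Type*} [CommSemiring R] {F G : ArithmeticFunction R}
    (hF : F.IsMultiplicative) (hG : G.IsMultiplicative) {p : ℕ} (hp : p.Prime) :
    (F * G) p = F p + G p := by
  have h := ArithmeticFunction.mul_apply_prime_pow F G hp 1
  rw [pow_one, Finset.Nat.antidiagonal_succ] at h
  simpa [hF.1, hG.1, add_comm] using h

lemma ArithmeticFunction.pow_apply_prime {R : Type*} [CommSemiring R] {F : ArithmeticFunction R}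
    (hF : F.IsMultiplicative) {p : ℕ} (hp : p.Prime) (k : ℕ) : (F ^ k) p = k • F p := by
  induction k with
  | zero => simp [ArithmeticFunction.one_apply_ne hp.ne_one]
  | succ k ih => rw [pow_succ, ArithmeticFunction.mul_apply_prime hF.pow hF hp, ih, succ_nsmul]

namespace DilAlg

/-- The element `∑ μ(d) μ(e) (d, e)` over the pairs with least common multiple `n`. -/
noncomputable def lcmMoebius : ArithmeticFunction DilAlg where
  toFun n := ∑ p ∈ (n.divisors ×ˢ n.divisors).filter fun p => p.1.lcm p.2 = n,
    MonoidAlgebra.single p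
      ((ArithmeticFunction.moebius p.1 : ℝ) * (ArithmeticFunction.moebius p.2 : ℝ))
  map_zero' := by simp

lemma lcmMoebius_apply (n : ℕ) : lcmMoebius n =
    ∑ p ∈ (n.divisors ×ˢ n.divisors).filter fun p => p.1.lcm p.2 = n,
      MonoidAlgebra.single p
        ((ArithmeticFunction.moebius p.1 : ℝ) * (ArithmeticFunction.moebius p.2 : ℝ)) := rfl

lemma zeta_mul_lcmMoebius :
    ((ArithmeticFunction.zeta : ArithmeticFunction DilAlg)) * lcmMoebius =
      ArithmeticFunction.pmul
        ((ArithmeticFunction.zeta : ArithmeticFunction DilAlg) *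
          mono 1 0 (ArithmeticFunction.moebius : ArithmeticFunction ℝ))
        ((ArithmeticFunction.zeta : ArithmeticFunction DilAlg) *
          mono 0 1 (ArithmeticFunction.moebius : ArithmeticFunction ℝ)) := by
  ext1 n
  rw [ArithmeticFunction.pmul_apply, ArithmeticFunction.coe_zeta_mul_apply,
    ArithmeticFunction.coe_zeta_mul_apply, ArithmeticFunction.coe_zeta_mul_apply,
    Finset.sum_mul_sum, ← Finset.sum_product',
    ← Finset.sum_fiberwise_of_maps_to (g := fun p : ℕ × ℕ => p.1.lcm p.2) (t := n.divisors)]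
  · refine Finset.sum_congr rfl fun m hm => ?_
    obtain ⟨hmn, hn⟩ := Nat.mem_divisors.mp hm
    rw [lcmMoebius_apply]
    refine Finset.sum_congr ?_ fun p _ => ?_
    · ext ⟨d, e⟩
      simp only [Finset.mem_filter, Finset.mem_product, Nat.mem_divisors]
      constructor
      · rintro ⟨⟨⟨h1, -⟩, h2, -⟩, h3⟩
        exact ⟨⟨⟨h1.trans hmn, hn⟩, h2.trans hmn, hn⟩, h3⟩
      · rintro ⟨-, rfl⟩
        have h0 := ne_zero_of_dvd_ne_zero hn hmn
        exact ⟨⟨⟨Nat.dvd_lcm_left d e, h0⟩, Nat.dvd_lcm_right d e, h0⟩, rfl⟩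
    · rw [mono_apply, mono_apply, MonoidAlgebra.single_mul_single]
      simp
  · intro p hp
    obtain ⟨h1, h2⟩ := Finset.mem_product.mp hp
    exact Nat.mem_divisors.mpr ⟨Nat.lcm_dvd (Nat.dvd_of_mem_divisors h1)
      (Nat.dvd_of_mem_divisors h2), (Nat.mem_divisors.mp h1).2⟩

lemma lcmMoebius_isMultiplicative : lcmMoebius.IsMultiplicative := by
  have h : lcmMoebius = (ArithmeticFunction.moebius : ArithmeticFunction DilAlg) *
      ((ArithmeticFunction.zeta : ArithmeticFunction DilAlg) * lcmMoebius) := by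
    rw [← mul_assoc, ArithmeticFunction.coe_moebius_mul_coe_zeta, one_mul]
  rw [h, zeta_mul_lcmMoebius]
  have hz : ((ArithmeticFunction.zeta : ArithmeticFunction DilAlg)).IsMultiplicative :=
    ArithmeticFunction.isMultiplicative_zeta.natCast
  have hm : ((ArithmeticFunction.moebius : ArithmeticFunction ℝ)).IsMultiplicative :=
    ArithmeticFunction.isMultiplicative_moebius.intCast
  exact ArithmeticFunction.isMultiplicative_moebius.intCast.mul
    ((hz.mul (mono_isMultiplicative _ _ hm)).pmul (hz.mul (mono_isMultiplicative _ _ hm)))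

lemma lcmMoebius_prime {p : ℕ} (hp : p.Prime) : lcmMoebius p =
    MonoidAlgebra.single (p, 1) (-1) + MonoidAlgebra.single (1, p) (-1) +
      MonoidAlgebra.single (p, p) 1 := by
  have h1 : 1 ≠ p := hp.one_lt.ne
  rw [lcmMoebius_apply, Finset.sum_filter, hp.divisors, Finset.sum_product, Finset.sum_pair h1,
    Finset.sum_pair h1, Finset.sum_pair h1]
  simp [h1, ArithmeticFunction.moebius_apply_prime hp]
  abel

lemma lcmMoebius_prime_pow {p e : ℕ} (hp : p.Prime) (he : 2 ≤ e) : lcmMoebius (p ^ e) = 0 := by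
  rw [lcmMoebius_apply]
  refine Finset.sum_eq_zero fun x hx => ?_
  obtain ⟨hx1, hx2⟩ := Finset.mem_filter.mp hx
  obtain ⟨h1, h2⟩ := Finset.mem_product.mp hx1
  obtain ⟨i, hi, hi'⟩ := (Nat.mem_divisors_prime_pow hp e).mp h1
  obtain ⟨j, hj, hj'⟩ := (Nat.mem_divisors_prime_pow hp e).mp h2
  have hz : ∀ i, 2 ≤ i → ArithmeticFunction.moebius (p ^ i) = 0 := fun i hi => by
    rw [ArithmeticFunction.moebius_apply_prime_pow hp (by omega), if_neg (by omega)]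
  have hij : i = e ∨ j = e := by
    by_contra! hc
    have : p ^ e ∣ p ^ (e - 1) := by
      rw [← hx2, hi', hj']
      exact Nat.lcm_dvd (pow_dvd_pow _ (by omega)) (pow_dvd_pow _ (by omega))
    have := (Nat.pow_dvd_pow_iff_le_right hp.one_lt).mp this
    omega
  rw [hi', hj']
  rcases hij with rfl | rfl
  · simp [hz _ he]
  · simp [hz _ he]

/-- The density `ν_n(H) / n`. -/
noncomputable def density (H : Finset ℕ) (n : ℕ) : ℝ := nu H n / n

/-- The arithmetic function encoding the main term of the correlation of Selberg weights. -/
noncomputable def selberg (H : Finset ℕ) : ArithmeticFunction DilAlg :=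
  ⟨fun n => density H n • lcmMoebius n, by simp⟩

lemma selberg_apply (H : Finset ℕ) (n : ℕ) : selberg H n = density H n • lcmMoebius n := rfl

lemma selberg_isMultiplicative (H : Finset ℕ) : (selberg H).IsMultiplicative := by
  refine ⟨?_, fun {m n} h => ?_⟩
  · rw [selberg_apply, lcmMoebius_isMultiplicative.1, density, nu_one]
    simp
  · rw [selberg_apply, selberg_apply, selberg_apply, lcmMoebius_isMultiplicative.2 h,
      smul_mul_smul_comm, density, density, density, nu_mul H h]
    congr 1
    push_cast
    rw [mul_div_mul_comm]

lemma graded_selberg (H : Finset ℕ) : Graded (selberg H) := by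
  classical
  intro n p hp
  rw [selberg_apply, MonoidAlgebra.coeff_smul] at hp
  have hp := Finsupp.support_smul hp
  rw [lcmMoebius_apply, MonoidAlgebra.coeff_sum] at hp
  obtain ⟨q, hq, hp⟩ := Finset.mem_biUnion.mp (Finsupp.support_finsetSum hp)
  rw [MonoidAlgebra.coeff_single] at hp
  obtain rfl : p = q := by simpa using Finsupp.support_single_subset hp
  obtain ⟨hx1, hx2⟩ := Finset.mem_filter.mp hq
  obtain ⟨h1, h2⟩ := Finset.mem_product.mp hx1
  refine ⟨(Nat.pos_of_mem_divisors h1).ne', (Nat.pos_of_mem_divisors h2).ne', ?_⟩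
  have := Nat.lcm_dvd_mul p.1 p.2
  rwa [hx2] at this

/-- What remains of `selberg H` after extracting the factors responsible for the main term. -/
noncomputable def residual (H : Finset ℕ) : ArithmeticFunction DilAlg :=
  selberg H * (mono 1 0 recip ^ H.card * (mono 0 1 recip ^ H.card *
    mono 1 1 moebRecip ^ H.card))

lemma graded_residual (H : Finset ℕ) : Graded (residual H) :=
  (graded_selberg H).mul <| ((graded_mono (by simp) _).pow _).mul <|
    ((graded_mono (by simp) _).pow _).mul <| (graded_mono (by simp) _).pow _

lemma residual_isMultiplicative (H : Finset ℕ) : (residual H).IsMultiplicative :=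
  (selberg_isMultiplicative H).mul <|
    ((mono_isMultiplicative _ _ recip_isMultiplicative).pow).mul <|
    ((mono_isMultiplicative _ _ recip_isMultiplicative).pow).mul <|
    (mono_isMultiplicative _ _ moebRecip_isMultiplicative).pow

lemma residual_mul_mainFactor (H : Finset ℕ) (l₁ l₂ : ℕ) :
    residual H * mainFactor H.card l₁ l₂ = selberg H := by
  have e : residual H * mainFactor H.card l₁ l₂ = selberg H *
      ((mono 1 0 recip * mono 1 0 moebRecip) ^ (H.card + l₁) *
        (mono 0 1 recip * mono 0 1 moebRecip) ^ (H.card + l₂) *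
        (mono 1 1 recip * mono 1 1 moebRecip) ^ H.card) := by
    rw [residual, mainFactor]
    ring
  rw [e]
  simp only [mono_recip_mul_moebRecip, one_pow, mul_one]

lemma star_selberg (H : Finset ℕ) (l₁ l₂ : ℕ) :
    star (selberg H) (tensor (logPow (H.card + l₁)) (logPow (H.card + l₂))) =
      star (residual H) (model H.card l₁ l₂) := by
  rw [← star_mainFactor, ← star_mul (graded_residual H) (graded_mainFactor _ _ _)
    (supported_tensor_logPow _ _), residual_mul_mainFactor]

end DilAlg

lemma summable_add_pow_mul_geometric (J : ℕ) (a : ℕ) {r : ℝ} (hr0 : 0 < r) (hr : r < 1) :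
    Summable fun e : ℕ => ((e : ℝ) + a) ^ J * r ^ e := by
  have h := (summable_nat_add_iff a).mpr (summable_pow_mul_geometric_of_norm_lt_one J
    (r := r) (by rwa [Real.norm_eq_abs, abs_of_pos hr0]))
  refine (h.mul_left ((r ^ a)⁻¹)).congr fun e => ?_
  push_cast
  rw [pow_add]
  field_simp

/-- A nonnegative multiplicative function is summable when its local factors are. -/
lemma summable_of_multiplicative {h : ℕ → ℝ} (h1 : h 1 = 1)
    (hmul : ∀ {m n : ℕ}, m.Coprime n → h (m * n) = h m * h n) (hnn : ∀ n, 0 ≤ h n)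
    (hs : ∀ {p : ℕ}, p.Prime → Summable fun e => h (p ^ e)) {a : ℕ → ℝ} (ha : Summable a)
    (ha0 : ∀ n, 0 ≤ a n) (hta : ∀ p : ℕ, p.Prime → ∑' e, h (p ^ (e + 1)) ≤ a p) :
    Summable h := by
  have hnorm : ∀ {p : ℕ}, p.Prime → Summable fun e => ‖h (p ^ e)‖ := fun hp => (hs hp).norm
  refine summable_of_sum_range_le (c := h 0 + Real.exp (∑' n, a n)) hnn fun N => ?_
  have hE := hasSum_subtype_iff_indicator.mp
      (EulerProduct.summable_and_hasSum_factoredNumbers_prod_filter_prime_tsum h1 hmul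
    hnorm (Finset.range N)).2
  have hind : ∀ n, 0 ≤ (Nat.factoredNumbers (Finset.range N)).indicator h n :=
    Set.indicator_nonneg fun n _ => hnn n
  have hsub : Finset.range N ⊆ insert 0 (Finset.Ico 1 N) := by
    intro n hn
    have := Finset.mem_range.mp hn
    simp only [Finset.mem_insert, Finset.mem_Ico]
    omega
  refine (Finset.sum_le_sum_of_subset_of_nonneg hsub fun n _ _ => hnn n).trans ?_
  rw [Finset.sum_insert (by simp)]
  refine add_le_add le_rfl ?_
  have hb : ∑ n ∈ Finset.Ico 1 N, h n ≤
      ∏ p ∈ Finset.range N with p.Prime, ∑' e, h (p ^ e) := by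
    refine le_trans (Finset.sum_le_sum fun n hn => ?_) (sum_le_hasSum (Finset.Ico 1 N)
      (fun n _ => hind n) hE)
    obtain ⟨hn1, hn2⟩ := Finset.mem_Ico.mp hn
    rw [Set.indicator_of_mem]
    refine Nat.mem_factoredNumbers.mpr ⟨by omega, fun p hp => Finset.mem_range.mpr ?_⟩
    exact (Nat.le_of_mem_primeFactorsList hp).trans_lt hn2
  refine hb.trans ?_
  have hfac : ∀ p ∈ (Finset.range N).filter Nat.Prime, ∑' e, h (p ^ e) ≤ Real.exp (a p) := by
    intro p hp
    have hp := (Finset.mem_filter.mp hp).2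
    rw [(hs hp).tsum_eq_zero_add, pow_zero, h1, add_comm]
    exact (add_le_add (hta p hp) le_rfl).trans (Real.add_one_le_exp _)
  refine (Finset.prod_le_prod (fun p _ => tsum_nonneg fun e => hnn _) hfac).trans ?_
  rw [← Real.exp_sum]
  exact Real.exp_le_exp.mpr (ha.sum_le_tsum _ fun n _ => ha0 n)

namespace DilAlg

/-- Polynomially corrected geometric decay along prime powers. -/
def LocalBound (F : ArithmeticFunction DilAlg) : Prop :=
  ∃ C : ℝ, 0 ≤ C ∧ ∃ J : ℕ, ∀ p : ℕ, p.Prime → ∀ e : ℕ,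
    norm₁ (F (p ^ e)) ≤ C * ((e : ℝ) + 1) ^ J / (p : ℝ) ^ e

lemma LocalBound.mul {F G : ArithmeticFunction DilAlg} (hF : LocalBound F) (hG : LocalBound G) :
    LocalBound (F * G) := by
  obtain ⟨C, hC, I, hF⟩ := hF
  obtain ⟨D, hD, J, hG⟩ := hG
  refine ⟨C * D, by positivity, I + J + 1, fun p hp e => ?_⟩
  have hp0 : (0 : ℝ) < p := by exact_mod_cast hp.pos
  rw [ArithmeticFunction.mul_apply_prime_pow F G hp]
  refine (norm₁_sum_le _ _).trans ?_
  have hb : ∀ x ∈ Finset.HasAntidiagonal.antidiagonal e,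
      norm₁ (F (p ^ x.1) * G (p ^ x.2)) ≤ C * D * ((e : ℝ) + 1) ^ (I + J) / (p : ℝ) ^ e := by
    rintro ⟨i, j⟩ hx
    obtain rfl : i + j = e := by simpa using hx
    refine (norm₁_mul_le _ _).trans ((mul_le_mul (hF p hp i) (hG p hp j) (norm₁_nonneg _)
      (by positivity)).trans ?_)
    rw [div_mul_div_comm, ← pow_add, mul_mul_mul_comm, pow_add _ I J]
    push_cast
    gcongr <;> linarith [Nat.cast_nonneg (α := ℝ) i, Nat.cast_nonneg (α := ℝ) j]
  refine (Finset.sum_le_sum hb).trans_eq ?_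
  rw [Finset.sum_const, Finset.Nat.card_antidiagonal, nsmul_eq_mul, pow_succ]
  push_cast
  ring

lemma LocalBound.one : LocalBound 1 := by
  refine ⟨1, zero_le_one, 0, fun p hp e => ?_⟩
  rcases Nat.eq_zero_or_pos e with rfl | he
  · simp [norm₁_one]
  · rw [ArithmeticFunction.one_apply_ne (Nat.one_lt_pow he.ne' hp.one_lt).ne', norm₁_zero]
    positivity

lemma LocalBound.pow {F : ArithmeticFunction DilAlg} (hF : LocalBound F) (k : ℕ) :
    LocalBound (F ^ k) := by
  induction k with
  | zero => simpa using LocalBound.one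
  | succ k ih => rw [pow_succ]; exact ih.mul hF

lemma localBound_mono (a b : ℕ) {c : ArithmeticFunction ℝ} (hc : ∀ n, |c n| ≤ 1 / n) :
    LocalBound (mono a b c) := by
  refine ⟨1, zero_le_one, 0, fun p _ e => ?_⟩
  rw [mono_apply, norm₁_single]
  simpa using hc (p ^ e)

lemma abs_recip_le (n : ℕ) : |recip n| ≤ 1 / n := by
  rw [recip_apply, abs_of_nonneg (by positivity)]

lemma abs_moebRecip_le (n : ℕ) : |moebRecip n| ≤ 1 / n := by
  rw [moebRecip_apply, abs_div, Nat.abs_cast]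
  gcongr
  exact_mod_cast ArithmeticFunction.abs_moebius_le_one

lemma density_nonneg (H : Finset ℕ) (n : ℕ) : 0 ≤ density H n := by
  rw [density]
  positivity

lemma localBound_selberg (H : Finset ℕ) : LocalBound (selberg H) := by
  refine ⟨3 * H.card + 1, by positivity, 0, fun p hp e => ?_⟩
  have hp0 : (0 : ℝ) < p := by exact_mod_cast hp.pos
  obtain rfl | rfl | he : e = 0 ∨ e = 1 ∨ 2 ≤ e := by omega
  · rw [pow_zero, (selberg_isMultiplicative H).1, norm₁_one]
    simp
  · rw [pow_one, pow_one, pow_zero, selberg_apply, lcmMoebius_prime hp, smul_add, smul_add]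
    have hd : density H p ≤ H.card / p := by
      rw [density]
      gcongr
      exact nu_le_card H hp
    have hd0 := density_nonneg H p
    refine ((norm₁_add_le _ _).trans (add_le_add (norm₁_add_le _ _) le_rfl)).trans ?_
    rw [MonoidAlgebra.smul_single, MonoidAlgebra.smul_single, MonoidAlgebra.smul_single,
      norm₁_single, norm₁_single, norm₁_single]
    simp only [smul_eq_mul, abs_mul, abs_neg, abs_one, mul_one, abs_of_nonneg hd0]
    have h1 : (3 * (H.card : ℝ) + 1) / p = 3 * (H.card / p) + 1 / p := by ring
    have : (0 : ℝ) < 1 / p := by positivity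
    linarith
  · rw [selberg_apply, lcmMoebius_prime_pow hp he, smul_zero, norm₁_zero]
    positivity

lemma localBound_residual (H : Finset ℕ) : LocalBound (residual H) :=
  (localBound_selberg H).mul <| ((localBound_mono _ _ abs_recip_le).pow _).mul <|
    ((localBound_mono _ _ abs_recip_le).pow _).mul <| (localBound_mono _ _ abs_moebRecip_le).pow _

lemma LocalBound.summable {F : ArithmeticFunction DilAlg} (hF : LocalBound F) {p : ℕ}
    (hp : p.Prime) : Summable fun e => norm₁ (F (p ^ e)) := by
  obtain ⟨C, hC, J, hF⟩ := hF
  have hp1 : (1 : ℝ) < p := by exact_mod_cast hp.one_lt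
  have h := (summable_add_pow_mul_geometric J 1 (r := (p : ℝ)⁻¹) (by positivity)
    (inv_lt_one_of_one_lt₀ hp1)).mul_left C
  refine Summable.of_nonneg_of_le (fun _ => norm₁_nonneg _) (fun e => ?_) h
  refine (hF p hp e).trans_eq ?_
  rw [inv_pow, div_eq_mul_inv, mul_assoc, Nat.cast_one]

lemma residual_prime (H : Finset ℕ) {p : ℕ} (hp : p.Prime) (hH : ∀ h ∈ H, h < p) :
    residual H p = 0 := by
  have h1 := fun a b => mono_isMultiplicative a b recip_isMultiplicative
  have h2 := fun a b => mono_isMultiplicative a b moebRecip_isMultiplicative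
  rw [residual, ArithmeticFunction.mul_apply_prime (selberg_isMultiplicative H)
      (((h1 1 0).pow).mul
        (((h1 0 1).pow).mul ((h2 1 1).pow))) hp,
    ArithmeticFunction.mul_apply_prime ((h1 1 0).pow)
        (((h1 0 1).pow).mul ((h2 1 1).pow)) hp,
    ArithmeticFunction.mul_apply_prime ((h1 0 1).pow) ((h2 1 1).pow) hp,
    ArithmeticFunction.pow_apply_prime (h1 1 0) hp,
    ArithmeticFunction.pow_apply_prime (h1 0 1) hp, ArithmeticFunction.pow_apply_prime (h2 1 1) hp,
    ← Nat.cast_smul_eq_nsmul ℝ, ← Nat.cast_smul_eq_nsmul ℝ, ← Nat.cast_smul_eq_nsmul ℝ,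
    selberg_apply, lcmMoebius_prime hp, density, nu_eq_card_of_lt H hp hH,
    mono_apply, mono_apply, mono_apply, recip_apply, moebRecip_apply,
    ArithmeticFunction.moebius_apply_prime hp]
  simp only [smul_add, MonoidAlgebra.smul_single, smul_eq_mul, pow_one, pow_zero]
  have e : ∀ (x : ℕ × ℕ) (s : ℝ), MonoidAlgebra.single x (-s) = -MonoidAlgebra.single x s :=
    fun x s => MonoidAlgebra.single_neg x s
  have e1 : (H.card : ℝ) / p * -1 = -(H.card / p) := by ring
  have e2 : (H.card : ℝ) * (1 / p) = H.card / p := by ring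
  have e3 : (H.card : ℝ) * (((-1 : ℤ) : ℝ) / p) = -(H.card / p) := by
    push_cast
    ring
  rw [e1, e2, e3, e, e, e, mul_one]
  abel

end DilAlg

namespace DilAlg

/-- The multiplicative majorant of `norm₁ ∘ F`. -/
noncomputable def majorant (F : ArithmeticFunction DilAlg) (n : ℕ) : ℝ :=
  n.factorization.prod fun p e => norm₁ (F (p ^ e))

lemma majorant_prime_pow {F : ArithmeticFunction DilAlg} (hF : F.IsMultiplicative) {p : ℕ}
    (hp : p.Prime) (e : ℕ) : majorant F (p ^ e) = norm₁ (F (p ^ e)) := by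
  rw [majorant, hp.factorization_pow, Finsupp.prod_single_index]
  rw [pow_zero, hF.1, norm₁_one]

lemma majorant_mul (F : ArithmeticFunction DilAlg) {m n : ℕ} (h : m.Coprime n) :
    majorant F (m * n) = majorant F m * majorant F n := by
  rw [majorant, Nat.factorization_mul_of_coprime h,
    Finsupp.prod_add_index_of_disjoint (by simpa using h.disjoint_primeFactors)]
  rfl

lemma majorant_nonneg (F : ArithmeticFunction DilAlg) (n : ℕ) : 0 ≤ majorant F n := by
  rw [majorant, Finsupp.prod]
  exact Finset.prod_nonneg fun _ _ => norm₁_nonneg _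

lemma norm₁_le_majorant {F : ArithmeticFunction DilAlg} (hF : F.IsMultiplicative) (n : ℕ) :
    norm₁ (F n) ≤ majorant F n := by
  rcases eq_or_ne n 0 with rfl | hn
  · rw [ArithmeticFunction.map_zero, norm₁_zero]
    exact majorant_nonneg F 0
  · rw [hF.multiplicative_factorization F hn]
    exact norm₁_prod_le _ _

lemma exists_tsum_norm₁_residual_le (H : Finset ℕ) : ∃ B : ℝ, 0 ≤ B ∧ ∃ P : ℕ, ∀ p : ℕ, p.Prime →
    P ≤ p → ∑' e, norm₁ (residual H (p ^ (e + 1))) ≤ B * (1 / (p : ℝ) ^ 2) := by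
  have hloc := localBound_residual H
  obtain ⟨C, hC, J, hb⟩ := localBound_residual H
  obtain ⟨D, hD⟩ : ∃ D : ℕ → ℝ, ∀ e, D e = C * (((e : ℝ) + 2) ^ J * (1 / 2) ^ e) :=
    ⟨_, fun _ => rfl⟩
  have hDs : Summable D := by
    refine ((summable_add_pow_mul_geometric J 2 (r := 1 / 2) (by norm_num)
      (by norm_num)).mul_left C).congr fun e => ?_
    rw [hD]
    norm_num
  have hD0 : ∀ e, 0 ≤ D e := fun e => by
    rw [hD]
    positivity
  refine ⟨2 * ∑' e, D e, mul_nonneg zero_le_two (tsum_nonneg hD0), H.sup id + 1,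
    fun p hp hPp => ?_⟩
  have hH : ∀ h ∈ H, h < p := fun h hh =>
    (Nat.lt_succ_of_le (Finset.le_sup (f := id) hh)).trans_le hPp
  have hp2 : (2 : ℝ) ≤ p := by exact_mod_cast hp.two_le
  have hterm : ∀ e, norm₁ (residual H (p ^ (e + 1))) ≤ 2 * D e * (1 / (p : ℝ) ^ 2) := by
    intro e
    rcases Nat.eq_zero_or_pos e with rfl | he
    · rw [zero_add, pow_one, residual_prime H hp hH, norm₁_zero]
      have := hD0 0
      positivity
    obtain ⟨i, rfl⟩ := Nat.exists_eq_add_of_le' he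
    refine (hb p hp _).trans ?_
    have h1 : (2 : ℝ) ^ i ≤ (p : ℝ) ^ i := pow_le_pow_left₀ (by norm_num) hp2 i
    have h2 : (2 : ℝ) * D (i + 1) * (1 / (p : ℝ) ^ 2) =
        C * ((i : ℝ) + 3) ^ J / (2 ^ i * (p : ℝ) ^ 2) := by
      rw [hD, pow_succ (1 / 2 : ℝ), one_div_pow]
      push_cast
      rw [show (i : ℝ) + 1 + 2 = i + 3 by ring]
      field_simp
    rw [h2, show i + 1 + 1 = i + 2 by ring, pow_add (p : ℝ)]
    push_cast
    rw [show (i : ℝ) + 2 + 1 = i + 3 by ring]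
    gcongr
  have hts : Summable fun e => norm₁ (residual H (p ^ (e + 1))) :=
    (summable_nat_add_iff (f := fun e => norm₁ (residual H (p ^ e))) 1).mpr (hloc.summable hp)
  refine (hts.tsum_le_tsum hterm ((hDs.mul_left 2).mul_right _)).trans_eq ?_
  rw [tsum_mul_right, tsum_mul_left]

lemma summable_norm₁_residual (H : Finset ℕ) : Summable fun n => norm₁ (residual H n) := by
  have hmult := residual_isMultiplicative H
  have hloc := localBound_residual H
  obtain ⟨B, hB, P, hlarge⟩ := exists_tsum_norm₁_residual_le H
  obtain ⟨T, hT⟩ : ∃ T : ℕ → ℝ, ∀ p, T p = ∑' e, norm₁ (residual H (p ^ (e + 1))) :=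
    ⟨_, fun _ => rfl⟩
  have hT0 : ∀ p, 0 ≤ T p := fun p => hT p ▸ tsum_nonneg fun _ => norm₁_nonneg _
  have hsum : Summable (majorant (residual H)) := by
    refine summable_of_multiplicative
      (a := fun n : ℕ => (if n < P then T n else 0) + B * (1 / (n : ℝ) ^ 2))
      ?_ (majorant_mul _) (majorant_nonneg _) (fun hp => ?_) ?_ (fun n => ?_) (fun p hp => ?_)
    · simp [majorant]
    · simp_rw [majorant_prime_pow hmult hp]
      exact hloc.summable hp
    · refine Summable.add (summable_of_ne_finset_zero (s := Finset.range P) fun n hn => ?_)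
        ((Real.summable_one_div_nat_pow.mpr (by norm_num)).mul_left _)
      rw [if_neg]
      simpa using hn
    · refine add_nonneg ?_ (by positivity)
      split_ifs
      exacts [hT0 n, le_rfl]
    · simp_rw [majorant_prime_pow hmult hp]
      rw [← hT]
      split_ifs with h
      · exact le_add_of_nonneg_right (by positivity)
      · rw [zero_add, hT]
        exact hlarge p hp (by omega)
  exact hsum.of_nonneg_of_le (fun _ => norm₁_nonneg _) (norm₁_le_majorant hmult)

/-- The augmented local factor at `p`. -/
noncomputable def localFactor (F : ArithmeticFunction DilAlg) (p : ℕ) : ℝ :=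
  ∑' e, aug (F (p ^ e))

lemma LocalBound.summable_aug {F : ArithmeticFunction DilAlg} (hF : LocalBound F) {p : ℕ}
    (hp : p.Prime) : Summable fun e => ‖aug (F (p ^ e))‖ :=
  (hF.summable hp).of_nonneg_of_le (fun _ => norm_nonneg _) fun _ => abs_aug_le _

lemma localFactor_mul {F G : ArithmeticFunction DilAlg} (hF : LocalBound F) (hG : LocalBound G)
    {p : ℕ} (hp : p.Prime) : localFactor (F * G) p = localFactor F p * localFactor G p := by
  rw [localFactor, localFactor, localFactor, tsum_mul_tsum_eq_tsum_sum_antidiagonal_of_summable_norm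
    (hF.summable_aug hp) (hG.summable_aug hp)]
  refine tsum_congr fun e => ?_
  rw [ArithmeticFunction.mul_apply_prime_pow F G hp, map_sum]
  exact Finset.sum_congr rfl fun x _ => map_mul _ _ _

lemma localFactor_one {p : ℕ} (hp : p.Prime) : localFactor 1 p = 1 := by
  rw [localFactor, tsum_eq_single 0]
  · simp
  · intro e he
    rw [ArithmeticFunction.one_apply_ne (Nat.one_lt_pow he hp.one_lt).ne', map_zero]

lemma localFactor_pow {F : ArithmeticFunction DilAlg} (hF : LocalBound F) {p : ℕ} (hp : p.Prime)
    (k : ℕ) : localFactor (F ^ k) p = localFactor F p ^ k := by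
  induction k with
  | zero => rw [pow_zero, pow_zero, localFactor_one hp]
  | succ k ih => rw [pow_succ, localFactor_mul (hF.pow k) hF hp, ih, pow_succ]

lemma localFactor_recip (a b : ℕ) {p : ℕ} (hp : p.Prime) :
    localFactor (mono a b recip) p = (1 - 1 / (p : ℝ))⁻¹ := by
  have hp1 : (1 : ℝ) < p := by exact_mod_cast hp.one_lt
  rw [localFactor, one_div, ← tsum_geometric_of_lt_one (by positivity) (inv_lt_one_of_one_lt₀ hp1)]
  refine tsum_congr fun e => ?_
  rw [mono_apply, aug_single, recip_apply]
  simp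

lemma localFactor_moebRecip (a b : ℕ) {p : ℕ} (hp : p.Prime) :
    localFactor (mono a b moebRecip) p = 1 - 1 / (p : ℝ) := by
  rw [localFactor, tsum_eq_sum (s := Finset.range 2)]
  · rw [Finset.sum_range_succ, Finset.sum_range_one, mono_apply, mono_apply, aug_single, aug_single,
      moebRecip_apply, moebRecip_apply, pow_one, ArithmeticFunction.moebius_apply_prime hp]
    simp
    ring
  · intro e he
    have : 2 ≤ e := not_lt.mp fun h => he (Finset.mem_range.mpr h)
    rw [mono_apply, aug_single, moebRecip_apply,
      ArithmeticFunction.moebius_apply_prime_pow hp (by omega), if_neg (by omega)]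
    simp

lemma localFactor_selberg (H : Finset ℕ) {p : ℕ} (hp : p.Prime) :
    localFactor (selberg H) p = 1 - (nu H p : ℝ) / p := by
  rw [localFactor, tsum_eq_sum (s := Finset.range 2)]
  · rw [Finset.sum_range_succ, Finset.sum_range_one, pow_zero, pow_one,
      (selberg_isMultiplicative H).1, map_one, selberg_apply, lcmMoebius_prime hp, map_smul,
      map_add, map_add, aug_single, aug_single, aug_single, density, smul_eq_mul]
    ring
  · intro e he
    have : 2 ≤ e := not_lt.mp fun h => he (Finset.mem_range.mpr h)
    rw [selberg_apply, lcmMoebius_prime_pow hp this, smul_zero, map_zero]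

lemma localFactor_residual (H : Finset ℕ) {p : ℕ} (hp : p.Prime) :
    localFactor (residual H) p =
      (1 - (nu H p : ℝ) / p) * (1 - 1 / (p : ℝ)) ^ (-(H.card : ℤ)) := by
  have hr := fun a b => localBound_mono a b abs_recip_le
  have hm := fun a b => localBound_mono a b abs_moebRecip_le
  have hp1 : (1 : ℝ) < p := by exact_mod_cast hp.one_lt
  have hne : (1 - 1 / (p : ℝ)) ≠ 0 := by
    have : 1 / (p : ℝ) < 1 := by
      rw [div_lt_one] <;> linarith
    linarith
  rw [residual, localFactor_mul (localBound_selberg H)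
      (((hr 1 0).pow _).mul (((hr 0 1).pow _).mul ((hm 1 1).pow _))) hp,
    localFactor_mul ((hr 1 0).pow _) (((hr 0 1).pow _).mul ((hm 1 1).pow _)) hp,
    localFactor_mul ((hr 0 1).pow _) ((hm 1 1).pow _) hp, localFactor_pow (hr 1 0) hp,
    localFactor_pow (hr 0 1) hp, localFactor_pow (hm 1 1) hp, localFactor_recip 1 0 hp,
    localFactor_recip 0 1 hp, localFactor_moebRecip 1 1 hp, localFactor_selberg H hp, zpow_neg,
    zpow_natCast, inv_pow, inv_mul_cancel₀ (pow_ne_zero _ hne), mul_one]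

lemma tsum_aug_residual (H : Finset ℕ) : ∑' n, aug (residual H n) = singSeries H := by
  have hmult := residual_isMultiplicative H
  have h := EulerProduct.eulerProduct_hasProd (f := fun n => aug (residual H n))
    (by rw [hmult.1, map_one]) (fun {m n} h => by rw [hmult.2 h, map_mul])
    ((summable_norm₁_residual H).of_nonneg_of_le (fun _ => norm_nonneg _) fun _ => abs_aug_le _)
    (by rw [ArithmeticFunction.map_zero, map_zero])
  rw [← h.tprod_eq, singSeries]
  exact tprod_congr fun p => localFactor_residual H p.2

lemma tendsto_star_selberg (H : Finset ℕ) (l₁ l₂ : ℕ) :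
    Tendsto (fun R : ℝ => star (selberg H)
        (tensor (logPow (H.card + l₁)) (logPow (H.card + l₂))) R R /
          Real.log R ^ (H.card + l₁ + l₂)) atTop
      (nhds (singSeries H * (((l₁ + l₂).choose l₁ : ℝ) / (H.card + l₁ + l₂).factorial))) := by
  set k := H.card
  obtain ⟨C, hC, hb⟩ := abs_model_le k l₁ l₂
  set w : ℝ := ((l₁ + l₂).choose l₁ : ℝ) / (k + l₁ + l₂).factorial with hw
  have hlim : ∀ n, Tendsto (fun R : ℝ => act (residual H n) (model k l₁ l₂) R R /
      Real.log R ^ (k + l₁ + l₂)) atTop (nhds (aug (residual H n) * w)) := by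
    intro n
    have e : aug (residual H n) * w =
        ∑ p ∈ (residual H n).coeff.support, (residual H n).coeff p * w := by
      rw [aug_eq, Finsupp.sum, Finset.sum_mul]
    rw [e]
    refine (tendsto_finsetSum (f := fun p R => (residual H n).coeff p *
      (model k l₁ l₂ (R / p.1) (R / p.2) / Real.log R ^ (k + l₁ + l₂))) _ fun p hp => ?_).congr
        fun R => ?_
    · obtain ⟨h1, h2, -⟩ := graded_residual H n p hp
      exact (tendsto_model k l₁ l₂ h1 h2).const_mul _
    · rw [act_apply, Finsupp.sum, Finset.sum_div]
      exact Finset.sum_congr rfl fun p _ => (mul_div_assoc _ _ _).symm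
  have hdom : ∀ᶠ R : ℝ in atTop, ∀ n, ‖act (residual H n) (model k l₁ l₂) R R /
      Real.log R ^ (k + l₁ + l₂)‖ ≤ norm₁ (residual H n) * (C * 2 ^ (k + l₁ + l₂)) := by
    filter_upwards [Real.tendsto_log_atTop.eventually_ge_atTop 1, eventually_ge_atTop 1]
      with R hl hR n
    have hl0 : 0 < Real.log R ^ (k + l₁ + l₂) := by positivity
    rw [Real.norm_eq_abs, abs_div, abs_of_pos hl0, div_le_iff₀ hl0]
    refine (abs_act_le _ _ _ _ (C * (1 + Real.log R) ^ (k + l₁ + l₂)) fun p hp => ?_).trans ?_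
    · obtain ⟨h1, h2, -⟩ := graded_residual H n p hp
      exact hb R hR _ (div_le_self (by linarith) (by exact_mod_cast Nat.pos_of_ne_zero h1))
        _ (div_le_self (by linarith) (by exact_mod_cast Nat.pos_of_ne_zero h2))
    · rw [mul_assoc]
      refine mul_le_mul_of_nonneg_left ?_ (norm₁_nonneg _)
      rw [mul_assoc, ← mul_pow]
      gcongr
      linarith
  have h := tendsto_tsum_of_dominated_convergence
    ((summable_norm₁_residual H).mul_right (C * 2 ^ (k + l₁ + l₂))) hlim hdom
  rw [tsum_mul_right, tsum_aug_residual] at h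
  refine h.congr fun R => ?_
  rw [star_selberg, tsum_div_const]
  rfl

end DilAlg

lemma nu_le_pow_card_primeFactors (H : Finset ℕ) {n : ℕ} (hn : Squarefree n) :
    nu H n ≤ H.card ^ n.primeFactors.card := by
  induction n using Nat.recOnPosPrimePosCoprime with
  | zero => exact absurd hn not_squarefree_zero
  | one => simp [nu_one]
  | prime_pow p m hp hm =>
    rcases (Nat.squarefree_pow_iff hp.ne_one hm.ne').mp hn with ⟨-, rfl⟩
    rw [pow_one, hp.primeFactors, Finset.card_singleton, pow_one]
    exact nu_le_card H hp
  | coprime a b ha hb hab iha ihb =>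
    rw [nu_mul H hab, hab.primeFactors_mul, Finset.card_union_of_disjoint hab.disjoint_primeFactors,
      pow_add]
    exact Nat.mul_le_mul (iha hn.of_mul_left) (ihb hn.of_mul_right)

lemma recip_pow_apply_of_squarefree (k : ℕ) {n : ℕ} (hn : Squarefree n) :
    (DilAlg.recip ^ k) n = (k : ℝ) ^ n.primeFactors.card / n := by
  have hm := DilAlg.recip_isMultiplicative.pow (k := k)
  induction n using Nat.recOnPosPrimePosCoprime with
  | zero => exact absurd hn not_squarefree_zero
  | one => simp [hm.1]
  | prime_pow p m hp hm' =>
    rcases (Nat.squarefree_pow_iff hp.ne_one hm'.ne').mp hn with ⟨-, rfl⟩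
    rw [pow_one, hp.primeFactors, Finset.card_singleton, pow_one,
      ArithmeticFunction.pow_apply_prime DilAlg.recip_isMultiplicative hp, DilAlg.recip_apply,
      nsmul_eq_mul, mul_one_div]
  | coprime a b ha hb hab iha ihb =>
    rw [hm.2 hab, iha hn.of_mul_left, ihb hn.of_mul_right, hab.primeFactors_mul,
      Finset.card_union_of_disjoint hab.disjoint_primeFactors, pow_add, div_mul_div_comm,
      Nat.cast_mul]

lemma squarefree_lcm {a b : ℕ} (ha : Squarefree a) (hb : Squarefree b) : Squarefree (a.lcm b) := by
  rw [Nat.squarefree_iff_factorization_le_one (Nat.lcm_ne_zero ha.ne_zero hb.ne_zero)]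
  intro p
  rw [Nat.factorization_lcm ha.ne_zero hb.ne_zero, Finsupp.sup_apply]
  exact sup_le (ha.natFactorization_le_one p) (hb.natFactorization_le_one p)

lemma nu_lcm_le (H : Finset ℕ) {K : ℕ} (hK : H.card ≤ K) (hK1 : 1 ≤ K) {d e : ℕ}
    (hd : Squarefree d) (he : Squarefree e) :
    nu H (d.lcm e) ≤ K ^ d.primeFactors.card * K ^ e.primeFactors.card := by
  refine (nu_le_pow_card_primeFactors H (squarefree_lcm hd he)).trans ?_
  rw [← pow_add]
  refine (Nat.pow_le_pow_left hK _).trans (Nat.pow_le_pow_right hK1 ?_)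
  have : (d.lcm e).primeFactors ⊆ d.primeFactors ∪ e.primeFactors := by
    rw [← Nat.primeFactors_mul hd.ne_zero he.ne_zero]
    exact Nat.primeFactors_mono (Nat.lcm_dvd_mul d e) (Nat.mul_ne_zero hd.ne_zero he.ne_zero)
  refine (Finset.card_le_card this).trans ?_
  exact Finset.card_union_le _ _

lemma sum_Icc_mul_le {F G : ArithmeticFunction ℝ} (hF : ∀ n, 0 ≤ F n) (hG : ∀ n, 0 ≤ G n)
    (N : ℕ) : ∑ n ∈ Finset.Icc 1 N, (F * G) n ≤
      (∑ n ∈ Finset.Icc 1 N, F n) * ∑ n ∈ Finset.Icc 1 N, G n := by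
  rw [Finset.sum_mul_sum, ← Finset.sum_product']
  simp_rw [ArithmeticFunction.mul_apply]
  rw [Finset.sum_sigma']
  refine (Finset.sum_image (f := fun p : ℕ × ℕ => F p.1 * G p.2)
    (g := fun x : (_ : ℕ) × ℕ × ℕ => x.2) ?_).symm.trans_le ?_
  · rintro ⟨n, p⟩ h ⟨n', p'⟩ h' (rfl : p = p')
    have e1 := (Nat.mem_divisorsAntidiagonal.mp (Finset.mem_sigma.mp h).2).1
    have e2 := (Nat.mem_divisorsAntidiagonal.mp (Finset.mem_sigma.mp h').2).1
    simp only at e1 e2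
    rw [← e1, ← e2]
  · refine Finset.sum_le_sum_of_subset_of_nonneg (fun p hp => ?_)
      fun p _ _ => mul_nonneg (hF _) (hG _)
    obtain ⟨⟨n, q⟩, h, rfl⟩ := Finset.mem_image.mp hp
    obtain ⟨h1, h2⟩ := Finset.mem_sigma.mp h
    obtain ⟨hq, h0⟩ := Nat.mem_divisorsAntidiagonal.mp h2
    have hN := (Finset.mem_Icc.mp h1).2
    rw [← hq] at h0 hN
    have hq1 := Nat.pos_of_ne_zero (left_ne_zero_of_mul h0)
    have hq2 := Nat.pos_of_ne_zero (right_ne_zero_of_mul h0)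
    simp only [Finset.mem_product, Finset.mem_Icc]
    exact ⟨⟨hq1, (Nat.le_mul_of_pos_right _ hq2).trans hN⟩, hq2,
      (Nat.le_mul_of_pos_left _ hq1).trans hN⟩

lemma recip_pow_nonneg (k n : ℕ) : 0 ≤ (DilAlg.recip ^ k) n := by
  induction k generalizing n with
  | zero =>
    rw [pow_zero, ArithmeticFunction.one_apply]
    positivity
  | succ k ih =>
    rw [pow_succ, ArithmeticFunction.mul_apply]
    refine Finset.sum_nonneg fun x _ => mul_nonneg (ih _) ?_
    rw [DilAlg.recip_apply]
    positivity

lemma sum_recip_pow_le (k : ℕ) {N : ℕ} {R : ℝ} (hR : 1 ≤ R) (hN : (N : ℝ) ≤ R) :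
    ∑ n ∈ Finset.Icc 1 N, (DilAlg.recip ^ k) n ≤ (1 + Real.log R) ^ k := by
  have hl := Real.log_nonneg hR
  induction k with
  | zero =>
    rw [pow_zero, pow_zero]
    simp_rw [ArithmeticFunction.one_apply]
    rw [Finset.sum_ite_eq']
    split_ifs <;> norm_num
  | succ k ih =>
    rw [pow_succ, pow_succ]
    refine (sum_Icc_mul_le (recip_pow_nonneg k) (fun n => ?_) N).trans
      (mul_le_mul ih ?_ (Finset.sum_nonneg fun n _ => ?_) (by positivity))
    · simpa using recip_pow_nonneg 1 n
    · simp_rw [DilAlg.recip_apply]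
      exact sum_one_div_le N hR hN
    · simpa using recip_pow_nonneg 1 n

lemma sum_pow_card_primeFactors_le (K : ℕ) {N : ℕ} {R : ℝ} (hR : 1 ≤ R) (hN : (N : ℝ) ≤ R) :
    ∑ n ∈ Finset.Icc 1 N, (if Squarefree n then (K : ℝ) ^ n.primeFactors.card else 0) ≤
      R * (1 + Real.log R) ^ K := by
  refine le_trans ?_ (mul_le_mul_of_nonneg_left (sum_recip_pow_le K hR hN) (by linarith))
  rw [Finset.mul_sum]
  refine Finset.sum_le_sum fun n hn => ?_
  obtain ⟨h1, h2⟩ := Finset.mem_Icc.mp hn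
  have h0 : (0 : ℝ) < n := by exact_mod_cast h1
  split_ifs with h
  · rw [recip_pow_apply_of_squarefree K h, mul_div_assoc', le_div_iff₀ h0, mul_comm]
    exact mul_le_mul_of_nonneg_right ((Nat.cast_le.mpr h2).trans hN) (by positivity)
  · exact mul_nonneg (by linarith) (recip_pow_nonneg K n)

lemma card_filter_Ico_mul (H : Finset ℕ) (m N q : ℕ) :
    ((Finset.Ico N (N + q * m)).filter fun n => m ∣ ∏ h ∈ H, (n + h)).card = q * nu H m := by
  have hper : Function.Periodic (fun n => m ∣ ∏ h ∈ H, (n + h)) m := fun n => by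
    simp only [eq_iff_iff, ← ZMod.natCast_eq_zero_iff]
    push_cast
    simp
  have hper' : Function.Periodic (fun n => m ∣ ∏ h ∈ H, (n + h)) (q * m) := by
    simpa using hper.nat_mul q
  have hone : ∀ n, ((Finset.Ico n (n + m)).filter fun n => m ∣ ∏ h ∈ H, (n + h)).card =
      nu H m := fun n => by
    rw [Nat.filter_Ico_card_eq_of_periodic n m _ hper, Nat.count_eq_card_filter_range, nu]
  induction q with
  | zero => simp
  | succ q ih =>
    rw [← Finset.Ico_union_Ico_eq_Ico (Nat.le_add_right N (q * m))
      (show N + q * m ≤ N + (q + 1) * m by gcongr; omega), Finset.filter_union,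
      Finset.card_union_of_disjoint, ih (by simpa using hper.nat_mul q),
      show N + (q + 1) * m = N + q * m + m by ring, hone]
    · ring
    · exact Finset.disjoint_filter_filter (Finset.Ico_disjoint_Ico_consecutive _ _ _)

lemma abs_card_filter_Ico_sub_le (H : Finset ℕ) {m : ℕ} (hm : 0 < m) (N : ℕ) :
    |(((Finset.Ico N (2 * N)).filter fun n => m ∣ ∏ h ∈ H, (n + h)).card : ℝ) -
      N * DilAlg.density H m| ≤ nu H m := by
  have hm0 : (0 : ℝ) < m := by exact_mod_cast hm
  have h1 : N / m * nu H m ≤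
      ((Finset.Ico N (2 * N)).filter fun n => m ∣ ∏ h ∈ H, (n + h)).card := by
    rw [← card_filter_Ico_mul H m N]
    refine Finset.card_le_card (Finset.filter_subset_filter _ (Finset.Ico_subset_Ico_right ?_))
    have := Nat.div_mul_le_self N m
    omega
  have h2 : ((Finset.Ico N (2 * N)).filter fun n => m ∣ ∏ h ∈ H, (n + h)).card ≤
      (N / m + 1) * nu H m := by
    rw [← card_filter_Ico_mul H m N]
    refine Finset.card_le_card (Finset.filter_subset_filter _ (Finset.Ico_subset_Ico_right ?_))
    have := Nat.lt_div_mul_add hm (a := N)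
    rw [add_mul]
    omega
  have h1' : ((N / m : ℕ) : ℝ) * nu H m ≤
      ((Finset.Ico N (2 * N)).filter fun n => m ∣ ∏ h ∈ H, (n + h)).card := by exact_mod_cast h1
  have h2' : (((Finset.Ico N (2 * N)).filter fun n => m ∣ ∏ h ∈ H, (n + h)).card : ℝ) ≤
      ((N / m : ℕ) + 1) * nu H m := by exact_mod_cast h2
  have h3 : ((N / m : ℕ) : ℝ) * nu H m ≤ N * DilAlg.density H m := by
    rw [DilAlg.density, ← mul_div_assoc, mul_comm (N : ℝ), mul_div_assoc, mul_comm]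
    exact mul_le_mul_of_nonneg_left Nat.cast_div_le (by positivity)
  have h4 : N * DilAlg.density H m ≤ ((N / m : ℕ) + 1) * nu H m := by
    rw [DilAlg.density, ← mul_div_assoc, mul_comm (N : ℝ), mul_div_assoc, mul_comm]
    refine mul_le_mul_of_nonneg_right ?_ (by positivity)
    rw [div_le_iff₀ hm0]
    have := (Nat.lt_div_mul_add hm (a := N)).le
    rw [add_mul, one_mul]
    exact_mod_cast this
  rw [abs_le]
  constructor <;> linarith

/-- The coefficient of the pair `(d, e)` in the correlation of two Selberg weights. -/
noncomputable def pairWeight (j j' : ℕ) (R : ℝ) (p : ℕ × ℕ) : ℝ :=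
  (ArithmeticFunction.moebius p.1 : ℝ) * (ArithmeticFunction.moebius p.2 : ℝ) *
    DilAlg.tensor (logPow j) (logPow j') (R / p.1) (R / p.2)

lemma le_floor_of_one_le_div {R : ℝ} {d : ℕ} (hd : d ≠ 0) (h : 1 ≤ R / d) : d ≤ ⌊R⌋₊ := by
  rw [one_le_div (by exact_mod_cast Nat.pos_of_ne_zero hd)] at h
  exact Nat.le_floor h

lemma star_selberg_eq_sum (H : Finset ℕ) (j j' : ℕ) (R : ℝ) :
    DilAlg.star (DilAlg.selberg H) (DilAlg.tensor (logPow j) (logPow j')) R R =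
      ∑ p ∈ Finset.Icc 1 ⌊R⌋₊ ×ˢ Finset.Icc 1 ⌊R⌋₊,
        DilAlg.density H (p.1.lcm p.2) * pairWeight j j' R p := by
  obtain ⟨T, hT1, hT2⟩ : ∃ T : ℕ, R * R ≤ T ∧ ⌊R⌋₊ * ⌊R⌋₊ ≤ T :=
    ⟨max ⌈R * R⌉₊ (⌊R⌋₊ * ⌊R⌋₊), (Nat.le_ceil _).trans (by exact_mod_cast le_max_left _ _),
      le_max_right _ _⟩
  rw [DilAlg.star_eq_sum (DilAlg.graded_selberg H) (DilAlg.supported_tensor_logPow j j') hT1,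
    ← Finset.sum_fiberwise_of_maps_to (g := fun p : ℕ × ℕ => p.1.lcm p.2) (t := Finset.Icc 1 T)]
  · refine Finset.sum_congr rfl fun n hn => ?_
    have hn0 : n ≠ 0 := by
      have := (Finset.mem_Icc.mp hn).1
      omega
    rw [DilAlg.selberg_apply, DilAlg.lcmMoebius_apply, map_smul, map_sum, LinearMap.smul_apply,
      LinearMap.sum_apply, Pi.smul_apply, Pi.smul_apply, Finset.sum_apply, Finset.sum_apply,
      smul_eq_mul, Finset.mul_sum]
    simp_rw [DilAlg.act_single]
    symm
    refine Finset.sum_subset_zero_on_sdiff (fun p hp => ?_) (fun p hp => ?_) fun p hp => ?_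
    · obtain ⟨-, rfl⟩ := Finset.mem_filter.mp hp
      simp only [Finset.mem_filter, Finset.mem_product, Nat.mem_divisors]
      exact ⟨⟨⟨Nat.dvd_lcm_left _ _, hn0⟩, Nat.dvd_lcm_right _ _, hn0⟩, trivial⟩
    · obtain ⟨hp1, hp2⟩ := Finset.mem_sdiff.mp hp
      obtain ⟨hp1, hp3⟩ := Finset.mem_filter.mp hp1
      simp only [Finset.mem_product, Nat.mem_divisors] at hp1
      have h1 := ne_zero_of_dvd_ne_zero hn0 hp1.1.1
      have h2 := ne_zero_of_dvd_ne_zero hn0 hp1.2.1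
      rw [DilAlg.supported_tensor_logPow, mul_zero, mul_zero]
      by_contra! hc
      refine hp2 (Finset.mem_filter.mpr ⟨Finset.mem_product.mpr ⟨Finset.mem_Icc.mpr ⟨?_, ?_⟩,
        Finset.mem_Icc.mpr ⟨?_, ?_⟩⟩, hp3⟩)
      exacts [Nat.pos_of_ne_zero h1, le_floor_of_one_le_div h1 hc.1, Nat.pos_of_ne_zero h2,
        le_floor_of_one_le_div h2 hc.2]
    · rw [(Finset.mem_filter.mp hp).2, pairWeight]
  · intro p hp
    simp only [Finset.mem_product, Finset.mem_Icc] at hp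
    exact Finset.mem_Icc.mpr ⟨Nat.lcm_pos hp.1.1 hp.2.1,
      (Nat.le_of_dvd (Nat.mul_pos hp.1.1 hp.2.1) (Nat.lcm_dvd_mul _ _)).trans
        ((Nat.mul_le_mul hp.1.2 hp.2.2).trans hT2)⟩

lemma LambdaR_eq_sum_logPow (R : ℝ) (n : ℕ) (H : Finset ℕ) (l : ℕ) :
    LambdaR R n H l = ∑ d ∈ Finset.Icc 1 ⌊R⌋₊, if d ∣ ∏ h ∈ H, (n + h) then
      (ArithmeticFunction.moebius d : ℝ) * logPow (H.card + l) (R / d) else 0 := by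
  rw [LambdaR, Finset.mul_sum]
  refine Finset.sum_congr rfl fun d hd => ?_
  obtain ⟨h1, h2⟩ := Finset.mem_Icc.mp hd
  have hd0 : (0 : ℝ) < d := by exact_mod_cast h1
  have hle : 1 ≤ R / d := by
    rw [one_le_div hd0]
    exact (Nat.le_floor_iff' (by omega)).mp h2
  rw [logPow, if_pos hle, mul_ite, mul_zero]
  split_ifs
  · ring
  · rfl

lemma sum_LambdaR_mul (R : ℝ) (N : ℕ) (H : Finset ℕ) (l₁ l₂ : ℕ) :
    ∑ n ∈ Finset.Ico N (2 * N), LambdaR R n H l₁ * LambdaR R n H l₂ =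
      ∑ p ∈ Finset.Icc 1 ⌊R⌋₊ ×ˢ Finset.Icc 1 ⌊R⌋₊,
        (((Finset.Ico N (2 * N)).filter fun n => p.1.lcm p.2 ∣ ∏ h ∈ H, (n + h)).card : ℝ) *
          pairWeight (H.card + l₁) (H.card + l₂) R p := by
  simp_rw [LambdaR_eq_sum_logPow, Finset.sum_mul_sum, ← Finset.sum_product']
  rw [Finset.sum_product, Finset.sum_comm]
  refine Finset.sum_congr rfl fun p _ => ?_
  rw [← nsmul_eq_mul, ← Finset.sum_const, Finset.sum_filter]
  refine Finset.sum_congr rfl fun n _ => ?_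
  simp only [Nat.lcm_dvd_iff, pairWeight, DilAlg.tensor]
  by_cases h1 : p.1 ∣ ∏ h ∈ H, (n + h) <;> by_cases h2 : p.2 ∣ ∏ h ∈ H, (n + h) <;>
    simp [h1, h2, mul_mul_mul_comm]

lemma logPow_div_le {R : ℝ} (hR : 1 ≤ R) (j : ℕ) {d : ℕ} (hd : 1 ≤ d) :
    |logPow j (R / d)| ≤ (1 + Real.log R) ^ j := by
  have hl := Real.log_nonneg hR
  rw [logPow]
  split_ifs with h
  · have h0 := Real.log_nonneg h
    have h1 : Real.log (R / d) ≤ 1 + Real.log R := by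
      have := Real.log_le_log (by linarith) (div_le_self (by linarith : (0 : ℝ) ≤ R)
        (by exact_mod_cast hd : (1 : ℝ) ≤ d))
      linarith
    rw [abs_of_nonneg (by positivity)]
    exact (div_le_self (by positivity) (by exact_mod_cast j.factorial_pos)).trans (by gcongr)
  · rw [abs_zero]
    positivity

lemma abs_sum_LambdaR_mul_sub_le {R : ℝ} (hR : 1 ≤ R) (N : ℕ) (H : Finset ℕ) (l₁ l₂ : ℕ) :
    |∑ n ∈ Finset.Ico N (2 * N), LambdaR R n H l₁ * LambdaR R n H l₂ -
      N * DilAlg.star (DilAlg.selberg H)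
        (DilAlg.tensor (logPow (H.card + l₁)) (logPow (H.card + l₂))) R R| ≤
      R ^ 2 * (1 + Real.log R) ^ (H.card + l₁ + (H.card + l₂) + 2 * (H.card + 1)) := by
  have hl := Real.log_nonneg hR
  obtain ⟨K, hK⟩ : ∃ K, K = H.card + 1 := ⟨_, rfl⟩
  obtain ⟨g, hg⟩ : ∃ g : ℕ → ℝ, ∀ n, g n =
    if Squarefree n then (K : ℝ) ^ n.primeFactors.card else 0 := ⟨_, fun _ => rfl⟩
  have hg0 : ∀ n, 0 ≤ g n := fun n => by
    rw [hg]
    positivity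
  have hgs : ∑ n ∈ Finset.Icc 1 ⌊R⌋₊, g n ≤ R * (1 + Real.log R) ^ K := by
    simp_rw [hg]
    exact sum_pow_card_primeFactors_le K hR (Nat.floor_le (by linarith))
  rw [sum_LambdaR_mul, star_selberg_eq_sum, Finset.mul_sum, ← Finset.sum_sub_distrib]
  have hterm : ∀ p ∈ Finset.Icc 1 ⌊R⌋₊ ×ˢ Finset.Icc 1 ⌊R⌋₊,
      |(((Finset.Ico N (2 * N)).filter fun n => p.1.lcm p.2 ∣ ∏ h ∈ H, (n + h)).card : ℝ) *
          pairWeight (H.card + l₁) (H.card + l₂) R p -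
        N * (DilAlg.density H (p.1.lcm p.2) * pairWeight (H.card + l₁) (H.card + l₂) R p)| ≤
      g p.1 * g p.2 * (1 + Real.log R) ^ (H.card + l₁ + (H.card + l₂)) := by
    rintro ⟨d, e⟩ hp
    simp only [Finset.mem_product, Finset.mem_Icc] at hp
    obtain ⟨⟨hd, -⟩, he, -⟩ := hp
    have hcount := abs_card_filter_Ico_sub_le H (Nat.lcm_pos hd he) N
    rw [← mul_assoc, ← sub_mul, abs_mul, pairWeight, abs_mul, abs_mul, DilAlg.tensor, abs_mul]
    by_cases hs : Squarefree d ∧ Squarefree e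
    · rw [hg, hg, if_pos hs.1, if_pos hs.2, pow_add]
      have hnu : (nu H (d.lcm e) : ℝ) ≤
          (K : ℝ) ^ d.primeFactors.card * K ^ e.primeFactors.card := by
        exact_mod_cast nu_lcm_le H (by omega) (by omega) hs.1 hs.2
      have hmu : |(ArithmeticFunction.moebius d : ℝ)| * |(ArithmeticFunction.moebius e : ℝ)| ≤ 1 :=
        mul_le_one₀ (by exact_mod_cast ArithmeticFunction.abs_moebius_le_one) (abs_nonneg _)
          (by exact_mod_cast ArithmeticFunction.abs_moebius_le_one)
      refine mul_le_mul (hcount.trans hnu) ?_ (by positivity) (by positivity)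
      rw [← one_mul ((1 + Real.log R) ^ (H.card + l₁) * _)]
      exact mul_le_mul hmu (mul_le_mul (logPow_div_le hR _ hd) (logPow_div_le hR _ he)
        (abs_nonneg _) (by positivity)) (by positivity) zero_le_one
    · have : |(ArithmeticFunction.moebius d : ℝ)| * |(ArithmeticFunction.moebius e : ℝ)| = 0 := by
        rw [← abs_mul, abs_eq_zero, mul_eq_zero]
        by_contra! hc
        simp only [ne_eq, Int.cast_eq_zero, ArithmeticFunction.moebius_ne_zero_iff_squarefree]
          at hc
        exact hs hc
      rw [this, zero_mul, mul_zero]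
      have := hg0 d
      have := hg0 e
      positivity
  refine (Finset.abs_sum_le_sum_abs _ _).trans ((Finset.sum_le_sum hterm).trans ?_)
  rw [← Finset.sum_mul, Finset.sum_product' (f := fun d e => g d * g e), ← Finset.sum_mul_sum]
  have hsum0 : 0 ≤ ∑ n ∈ Finset.Icc 1 ⌊R⌋₊, g n := Finset.sum_nonneg fun n _ => hg0 n
  refine (mul_le_mul_of_nonneg_right (mul_le_mul hgs hgs hsum0 (by positivity))
    (by positivity)).trans_eq ?_
  rw [← hK]
  ring

lemma sq_mul_log_pow_le {A : ℕ} {N R : ℝ} (hN : Real.exp 1 ≤ N) (hR : 1 ≤ R)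
    (h : R ≤ N ^ ((1 : ℝ) / 2) * Real.log N ^ (-((A : ℝ) + 1))) :
    N⁻¹ * (R ^ 2 * (1 + Real.log R) ^ A) ≤ 2 ^ A * (Real.log N)⁻¹ := by
  have hN0 : 0 < N := (Real.exp_pos 1).trans_le hN
  have hL : 1 ≤ Real.log N := (Real.le_log_iff_exp_le hN0).mpr hN
  have hL0 : 0 < Real.log N := by linarith
  have hlog : Real.log N ^ (-((A : ℝ) + 1)) = (Real.log N ^ (A + 1))⁻¹ := by
    rw [Real.rpow_neg hL0.le, ← Nat.cast_succ, Real.rpow_natCast]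
  rw [hlog, ← Real.sqrt_eq_rpow] at h
  have hsq : R ^ 2 ≤ N * ((Real.log N ^ (A + 1))⁻¹) ^ 2 := by
    refine (pow_le_pow_left₀ (by linarith) h 2).trans_eq ?_
    rw [mul_pow, Real.sq_sqrt hN0.le]
  have hN1 : 1 ≤ N := by
    have := Real.one_le_exp (zero_le_one (α := ℝ))
    linarith
  have hRN : R ≤ N := by
    refine h.trans ((mul_le_of_le_one_right (Real.sqrt_nonneg _)
      (inv_le_one_of_one_le₀ (one_le_pow₀ hL))).trans ?_)
    rw [Real.sqrt_le_left hN0.le]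
    nlinarith
  have hlR : 1 + Real.log R ≤ 2 * Real.log N := by
    have := Real.log_le_log (by linarith) hRN
    linarith
  have hlR0 := Real.log_nonneg hR
  calc N⁻¹ * (R ^ 2 * (1 + Real.log R) ^ A)
      ≤ N⁻¹ * (N * ((Real.log N ^ (A + 1))⁻¹) ^ 2 * (2 * Real.log N) ^ A) := by gcongr
    _ = 2 ^ A * (Real.log N)⁻¹ * (Real.log N ^ (A + 1))⁻¹ := by
      field_simp
      ring
    _ ≤ 2 ^ A * (Real.log N)⁻¹ :=
      mul_le_of_le_one_right (by positivity) (inv_le_one_of_one_le₀ (one_le_pow₀ hL))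

/-- **Lemma 1 (GPY Proposition 1).** For `R ≤ N^{1/2} (log N)^{-C}`, `R → ∞`,
`(1/N) ∑_{n ~ N} Λ_R(n; H, l₁) Λ_R(n; H, l₂)
  = (𝔖(H) + o(1)) C(l₁+l₂, l₁) (log R)^{k+l₁+l₂}/(k+l₁+l₂)!`. -/
theorem lambda_squared_average (k l₁ l₂ : ℕ) (H : Finset ℕ) (hH : H.card = k) :
    ∃ C : ℝ, 0 < C ∧ ∀ R : ℕ → ℝ,
      (∀ N : ℕ, 2 ≤ N → R N ≤ (N : ℝ) ^ ((1 : ℝ) / 2) * Real.log N ^ (-C)) →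
      Tendsto R atTop atTop →
      Tendsto
        (fun N : ℕ =>
          ((N : ℝ)⁻¹ * ∑ n ∈ Finset.Ico N (2 * N), LambdaR (R N) n H l₁ * LambdaR (R N) n H l₂) /
            (Real.log (R N) ^ (k + l₁ + l₂) / (k + l₁ + l₂).factorial))
        atTop (nhds (singSeries H * ((l₁ + l₂).choose l₁))) := by
  subst hH
  obtain ⟨A, hA⟩ : ∃ A, A = H.card + l₁ + (H.card + l₂) + 2 * (H.card + 1) := ⟨_, rfl⟩
  refine ⟨A + 1, by positivity, fun R hR hRt => ?_⟩
  have hmain := (DilAlg.tendsto_star_selberg H l₁ l₂).comp hRt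
  have hlogN : Tendsto (fun N : ℕ => 2 ^ A * (Real.log N)⁻¹) atTop (nhds 0) := by
    simpa using (Real.tendsto_log_atTop.comp
      tendsto_natCast_atTop_atTop).inv_tendsto_atTop.const_mul (2 ^ A : ℝ)
  have herr : Tendsto (fun N : ℕ =>
      ((N : ℝ)⁻¹ * ∑ n ∈ Finset.Ico N (2 * N), LambdaR (R N) n H l₁ * LambdaR (R N) n H l₂) /
        Real.log (R N) ^ (H.card + l₁ + l₂) - DilAlg.star (DilAlg.selberg H)
          (DilAlg.tensor (logPow (H.card + l₁)) (logPow (H.card + l₂))) (R N) (R N) /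
            Real.log (R N) ^ (H.card + l₁ + l₂)) atTop (nhds 0) := by
    refine squeeze_zero_norm' ?_ hlogN
    filter_upwards [tendsto_natCast_atTop_atTop.eventually_ge_atTop (Real.exp 1),
      eventually_ge_atTop 2, hRt.eventually_ge_atTop 1,
      (Real.tendsto_log_atTop.comp hRt).eventually_ge_atTop 1] with N hN hN2 hR1 hlR
    have hN0 : (0 : ℝ) < N := (Real.exp_pos 1).trans_le hN
    have hl : 1 ≤ Real.log (R N) ^ (H.card + l₁ + l₂) := one_le_pow₀ hlR
    rw [← sub_div, Real.norm_eq_abs, abs_div, abs_of_pos (zero_lt_one.trans_le hl)]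
    refine (div_le_self (abs_nonneg _) hl).trans
      (le_trans ?_ (sq_mul_log_pow_le hN hR1 (hR N hN2)))
    have e : ∀ x y : ℝ, (N : ℝ)⁻¹ * x - y = (N : ℝ)⁻¹ * (x - N * y) := fun x y => by
      field_simp
    rw [e, abs_mul, abs_of_pos (inv_pos.mpr hN0), hA]
    exact mul_le_mul_of_nonneg_left (abs_sum_LambdaR_mul_sub_le hR1 N H l₁ l₂)
      (inv_pos.mpr hN0).le
  have h := (herr.add hmain).mul_const ((H.card + l₁ + l₂).factorial : ℝ)
  have hf : ((H.card + l₁ + l₂).factorial : ℝ) ≠ 0 := by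
    exact_mod_cast (Nat.factorial_pos _).ne'
  rw [zero_add, mul_assoc, div_mul_cancel₀ _ hf] at h
  refine h.congr fun N => ?_
  rw [Function.comp_apply, sub_add_cancel, div_div_eq_mul_div, div_mul_eq_mul_div]
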